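/- Let s ∈ (0,1), γ ∈ (0,s), β ∈ (γ,1), and α = s+γ−β ∈ (0,s). Let L be an operator of the form (1.3). Let w : (−∞,0)×ℝ^n → ℝ satisfy w = 0 in (−∞,0)×{x_n ≤ 0} and suppose that, for every h ∈ ℝ^n with h_n ≥ 0 and every τ < 0, the increment v(t,x) = w(t+τ,x+h) − w(t,x) satisfies ∂_t v − Lv = 0 in (−∞,0)×{x_n > 0}. Assume the growth condition [w/(x_n)_+^s]_{C_{t,x}^{β/(2s),β}(Q_R^+)} ≤ C R^α for all R ≥ 1 and some constant C > 0. Then w(t,x) = (x_n)_+^s (p·x + q) for some p ∈ ℝ^n and q ∈ ℝ; in particular w is independent of t. Moreover, if α+β < 1 then p = 0. -/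

import Mathlib

open Set MeasureTheory Metric Topology Filter
noncomputable section

/-- `ℝ^n` as Euclidean space. -/
abbrev En (n : ℕ) := EuclideanSpace ℝ (Fin n)

/-- The last coordinate `x_n` of a point `x ∈ ℝ^n`. -/
def lastC {n : ℕ} (x : En n) : ℝ := if h : 0 < n then x ⟨n - 1, by omega⟩ else 0

/-- The unit vector `e_n ∈ ℝ^n`. -/
def eLast (n : ℕ) : En n := if h : 0 < n then EuclideanSpace.single ⟨n - 1, by omega⟩ (1 : ℝ) else 0

/-- Ellipticity bounds `λ ≤ a ≤ Λ` on the unit sphere. -/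
def KernelBounds {n : ℕ} (lam Lam : ℝ) (a : En n → ℝ) : Prop :=
  ∀ y : En n, ‖y‖ = 1 → lam ≤ a y ∧ a y ≤ Lam

/-- `‖a‖_{C^{1,γ}(S^{n-1})} ≤ A`. -/
def SphereC1GammaBound {n : ℕ} (γ A : ℝ) (a : En n → ℝ) : Prop :=
  ∃ g : En n → (En n →L[ℝ] ℝ),
    (∀ y ∈ sphere (0 : En n) 1, HasFDerivWithinAt a (g y) (sphere (0 : En n) 1) y) ∧
    (∀ y ∈ sphere (0 : En n) 1, |a y| ≤ A ∧ ‖g y‖ ≤ A) ∧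
    (∀ y ∈ sphere (0 : En n) 1, ∀ z ∈ sphere (0 : En n) 1, ‖g y - g z‖ ≤ A * ‖y - z‖ ^ γ)

/-- The integrand of the nonlocal operator (1.3). -/
def Lintegrand (n : ℕ) (s : ℝ) (a u : En n → ℝ) (x y : En n) : ℝ :=
  (u (x + y) + u (x - y) - 2 * u x) * a (‖y‖⁻¹ • y) / ‖y‖ ^ ((n : ℝ) + 2 * s)

/-- The nonlocal operator `L` of the form (1.3). -/
def Lop (n : ℕ) (s : ℝ) (a u : En n → ℝ) (x : En n) : ℝ := ∫ y : En n, Lintegrand n s a u x y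

/-- `u` solves `∂_t u - L u = f` pointwise at `(t,x)`, the integral defining `Lu`
being absolutely convergent. -/
def SolvesAt (n : ℕ) (s : ℝ) (a : En n → ℝ) (u f : ℝ → En n → ℝ) (t : ℝ) (x : En n) : Prop :=
  Integrable (Lintegrand n s a (u t) x) ∧
  HasDerivAt (fun τ : ℝ => u τ x) (Lop n s a (u t) x + f t x) t

/-- `‖w‖_{L^∞(I×D)} ≤ M`. -/
def SupBnd {n : ℕ} (M : ℝ) (I : Set ℝ) (D : Set (En n)) (w : ℝ → En n → ℝ) : Prop :=
  ∀ t ∈ I, ∀ x ∈ D, |w t x| ≤ M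

/-- `[w]_{C_{t,x}^{θ/2s,θ}(I×D)} ≤ M`, for `θ ∈ (0,1)`. -/
def ParHolderBnd {n : ℕ} (s θ M : ℝ) (I : Set ℝ) (D : Set (En n)) (w : ℝ → En n → ℝ) : Prop :=
  ∀ t ∈ I, ∀ x ∈ D, ∀ t' ∈ I, ∀ x' ∈ D,
    |w t x - w t' x'| ≤ M * (|t - t'| ^ (θ / (2 * s)) + ‖x - x'‖ ^ θ)

/-- `[w]_{C_t^α(I×D)} ≤ M`. -/
def TimeHolderBnd {n : ℕ} (α M : ℝ) (I : Set ℝ) (D : Set (En n)) (w : ℝ → En n → ℝ) : Prop :=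
  ∀ x ∈ D, ∀ t ∈ I, ∀ t' ∈ I, |w t x - w t' x| ≤ M * |t - t'| ^ α

/-- Spatial gradient `∇_x w`. -/
def SpaceGrad {n : ℕ} (w : ℝ → En n → ℝ) (t : ℝ) (x : En n) : En n →L[ℝ] ℝ := fderiv ℝ (w t) x

/-- Spatial Hessian `D²_x w`. -/
def SpaceHess {n : ℕ} (w : ℝ → En n → ℝ) (t : ℝ) (x : En n) :
    ContinuousMultilinearMap ℝ (fun _ : Fin 2 => En n) ℝ := iteratedFDeriv ℝ 2 (w t) x

/-- Time derivative `∂_t w`. -/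
def TimeDeriv {n : ℕ} (w : ℝ → En n → ℝ) (t : ℝ) (x : En n) : ℝ := deriv (fun τ => w τ x) t

/-- `‖∇_x w‖_{L^∞(I×D)} ≤ M`. -/
def GradSupBnd {n : ℕ} (M : ℝ) (I : Set ℝ) (D : Set (En n)) (w : ℝ → En n → ℝ) : Prop :=
  ∀ t ∈ I, ∀ x ∈ D, ‖SpaceGrad w t x‖ ≤ M

/-- `[∇_x w]_{C_{t,x}^{θ/2s,θ}(I×D)} ≤ M`. -/
def GradParHolderBnd {n : ℕ} (s θ M : ℝ) (I : Set ℝ) (D : Set (En n)) (w : ℝ → En n → ℝ) : Prop :=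
  ∀ t ∈ I, ∀ x ∈ D, ∀ t' ∈ I, ∀ x' ∈ D,
    ‖SpaceGrad w t x - SpaceGrad w t' x'‖ ≤ M * (|t - t'| ^ (θ / (2 * s)) + ‖x - x'‖ ^ θ)

/-- `[∇_x w]_{C_t^α(I×D)} ≤ M`. -/
def GradTimeHolderBnd {n : ℕ} (α M : ℝ) (I : Set ℝ) (D : Set (En n)) (w : ℝ → En n → ℝ) : Prop :=
  ∀ x ∈ D, ∀ t ∈ I, ∀ t' ∈ I, ‖SpaceGrad w t x - SpaceGrad w t' x‖ ≤ M * |t - t'| ^ α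

/-- `[w]_{C_{t,x}^{θ/2s,θ}(I×D)} ≤ M`, covering both `θ ∈ (0,1)` and `θ ∈ (1,2)`. -/
def ParSemiBnd {n : ℕ} (s θ M : ℝ) (I : Set ℝ) (D : Set (En n)) (w : ℝ → En n → ℝ) : Prop :=
  (θ < 1 → ParHolderBnd s θ M I D w) ∧
  (1 < θ → TimeHolderBnd (θ / (2 * s)) M I D w ∧ GradParHolderBnd s (θ - 1) M I D w)

/-- `‖w‖_{C_{t,x}^{θ/2s,θ}(I×D)} ≤ M`, covering both `θ ∈ (0,1)` and `θ ∈ (1,2)`. -/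
def ParNormBnd {n : ℕ} (s θ M : ℝ) (I : Set ℝ) (D : Set (En n)) (w : ℝ → En n → ℝ) : Prop :=
  SupBnd M I D w ∧ (1 < θ → GradSupBnd M I D w) ∧ ParSemiBnd s θ M I D w

/-- `[w]_{C_{t,x}^{(α+β+s)/2s, α+β+s}(I×D)} ≤ M`, the higher-order parabolic seminorm
`[∂_t w]_{C^{(α+β-s)/2s, α+β-s}} + [∇_x w]_{C_t^{(α+β-s)/2s}} + [D²_x w]_{C^{(α+β-3s)/2s, α+β+s-2}}`,
each term being present when the corresponding exponent is positive. -/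
def HighSemiBnd {n : ℕ} (s α β M : ℝ) (I : Set ℝ) (D : Set (En n)) (w : ℝ → En n → ℝ) : Prop :=
  (0 < α + β - s → α + β - s < 1 → ParHolderBnd s (α + β - s) M I D (TimeDeriv w)) ∧
  (0 < α + β - s → GradTimeHolderBnd ((α + β - s) / (2 * s)) M I D w) ∧
  (0 < α + β + s - 2 → ∀ t ∈ I, ∀ x ∈ D, ∀ x' ∈ D,
      ‖SpaceHess w t x - SpaceHess w t x'‖ ≤ M * ‖x - x'‖ ^ (α + β + s - 2)) ∧
  (0 < α + β - 3 * s → ∀ x ∈ D, ∀ t ∈ I, ∀ t' ∈ I,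
      ‖SpaceHess w t x - SpaceHess w t' x‖ ≤ M * |t - t'| ^ ((α + β - 3 * s) / (2 * s)))

/-- `Γ` is a `C^{2,γ}` surface splitting `ℝ^n` into `Ω^+` and `Ω^-` with norm smaller
than 1: it is the graph `{x_n = φ(x')}` of a `C^{2,γ}` function `φ` (independent of the last
coordinate) with `C^{2,γ}` norm smaller than 1, passing through `0` with normal `e_n` there,
and `Ω^± = {±(x_n - φ) > 0}`. -/
def IsSplitSurface {n : ℕ} (γ : ℝ) (φ : En n → ℝ) (Ωp Ωm : Set (En n)) : Prop :=
  (∀ x y : En n, (∀ i : Fin n, (i : ℕ) ≠ n - 1 → x i = y i) → φ x = φ y) ∧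
  ContDiff ℝ 2 φ ∧ φ 0 = 0 ∧ fderiv ℝ φ 0 = 0 ∧
  (∃ c < (1 : ℝ),
    (∀ x, |φ x| + ‖fderiv ℝ φ x‖ + ‖iteratedFDeriv ℝ 2 φ x‖ ≤ c) ∧
    (∀ x y, ‖iteratedFDeriv ℝ 2 φ x - iteratedFDeriv ℝ 2 φ y‖ ≤ c * ‖x - y‖ ^ γ)) ∧
  Ωp = {x | φ x < lastC x} ∧ Ωm = {x | lastC x < φ x}

/-- `d` is a `C^{2,γ}(closure Ω^+)` function coinciding with `dist(·,Ω^-)` in a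
neighborhood of `Γ ∩ B_4` and vanishing outside `B_5`. -/
def IsDistLike {n : ℕ} (γ : ℝ) (Ωp Ωm : Set (En n)) (d : En n → ℝ) : Prop :=
  ContDiffOn ℝ 2 d (closure Ωp) ∧
  (∃ M : ℝ, ∀ x ∈ closure Ωp, ∀ y ∈ closure Ωp,
    ‖iteratedFDerivWithin ℝ 2 d (closure Ωp) x - iteratedFDerivWithin ℝ 2 d (closure Ωp) y‖
      ≤ M * ‖x - y‖ ^ γ) ∧
  (∃ U : Set (En n), IsOpen U ∧ frontier Ωp ∩ ball (0 : En n) 4 ⊆ U ∧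
    ∀ x ∈ U, d x = infDist x Ωm) ∧
  (∀ x : En n, x ∉ ball (0 : En n) 5 → d x = 0)


theorem lastC_eq {n : ℕ} (hn : 0 < n) (x : En n) : lastC x = x ⟨n - 1, by omega⟩ := by
  simp [lastC, hn]

theorem lastC_add {n : ℕ} (x y : En n) : lastC (x + y) = lastC x + lastC y := by
  unfold lastC; split_ifs <;> simp

theorem lastC_sub {n : ℕ} (x y : En n) : lastC (x - y) = lastC x - lastC y := by
  unfold lastC; split_ifs <;> simp

theorem lastC_neg {n : ℕ} (x : En n) : lastC (-x) = - lastC x := by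
  unfold lastC; split_ifs <;> simp

theorem lastC_smul {n : ℕ} (c : ℝ) (x : En n) : lastC (c • x) = c * lastC x := by
  unfold lastC; split_ifs <;> simp

theorem lastC_zero {n : ℕ} : lastC (0 : En n) = 0 := by
  unfold lastC; split_ifs <;> simp

theorem continuous_lastC {n : ℕ} : Continuous (lastC : En n → ℝ) := by
  unfold lastC; split_ifs <;> fun_prop

theorem abs_lastC_le {n : ℕ} (x : En n) : |lastC x| ≤ ‖x‖ := by
  unfold lastC; split_ifs with h
  · exact PiLp.norm_apply_le x _
  · simp

theorem lastC_eLast {n : ℕ} (hn : 0 < n) : lastC (eLast n) = 1 := by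
  simp [lastC, eLast, hn]

theorem norm_eLast {n : ℕ} (hn : 0 < n) : ‖eLast n‖ = 1 := by
  simp [eLast, hn]

/-- the second difference -/
def DD {n : ℕ} (u : En n → ℝ) (x y : En n) : ℝ := u (x + y) + u (x - y) - 2 * u x

/-- the radial kernel -/
def JJ (n : ℕ) (s : ℝ) (y : En n) : ℝ := (‖y‖ ^ ((n : ℝ) + 2 * s))⁻¹

theorem Lintegrand_eq {n : ℕ} {s : ℝ} (a u : En n → ℝ) (x y : En n) :
    Lintegrand n s a u x y = DD u x y * a (‖y‖⁻¹ • y) * JJ n s y := by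
  simp [Lintegrand, DD, JJ, div_eq_mul_inv]

theorem JJ_nonneg {n : ℕ} {s : ℝ} (y : En n) : 0 ≤ JJ n s y := by unfold JJ; positivity

theorem measurable_JJ {n : ℕ} {s : ℝ} : Measurable (JJ n s) := by
  unfold JJ; fun_prop

theorem DD_zero {n : ℕ} (u : En n → ℝ) (x : En n) : DD u x 0 = 0 := by simp [DD]; ring

theorem continuous_DD {n : ℕ} {u : En n → ℝ} (hu : Continuous u) (x : En n) :
    Continuous (DD u x) := by unfold DD; fun_prop

theorem DD_neg {n : ℕ} (u : En n → ℝ) (x y : En n) : DD u x (-y) = DD u x y := by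
  simp [DD, sub_eq_add_neg]; ring

/-- bounds on a away from zero -/
theorem KB {n : ℕ} {lam Lam : ℝ} {a : En n → ℝ} (ha : KernelBounds lam Lam a) {y : En n}
    (hy : y ≠ 0) : lam ≤ a (‖y‖⁻¹ • y) ∧ a (‖y‖⁻¹ • y) ≤ Lam := by
  apply ha
  rw [norm_smul, norm_inv, norm_norm, inv_mul_cancel₀ (norm_ne_zero_iff.mpr hy)]

/-- the radial dominating profile -/
def mm (σ : ℝ) (r : ℝ) : ℝ := min (2 * r ^ 2) (2 * (1 + r) ^ σ)

theorem mm_nonneg {σ r : ℝ} (hr : 0 ≤ r) : 0 ≤ mm σ r := by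
  unfold mm; apply le_min <;> positivity

theorem mm_meas {σ : ℝ} : Measurable (mm σ) := by unfold mm; fun_prop

theorem mm_int1 {s σ : ℝ} (hs : s ∈ Ioo (0 : ℝ) 1) (hσ0 : 0 < σ) (hσ : σ < 2 * s) :
    IntegrableOn (fun r : ℝ => mm σ r * r ^ (-1 - 2 * s)) (Ioi 0) := by
  have h1 : IntegrableOn (fun r : ℝ => mm σ r * r ^ (-1 - 2 * s)) (Ioc 0 1) := by
    have h : IntegrableOn (fun r : ℝ => 2 * r ^ (1 - 2 * s)) (Ioc 0 1) := by
      apply Integrable.const_mul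
      have := (intervalIntegral.intervalIntegrable_rpow' (a := 0) (b := 1) (r := 1 - 2 * s)
        (by linarith [hs.2]))
      rwa [intervalIntegrable_iff_integrableOn_Ioc_of_le zero_le_one] at this
    refine Integrable.mono' h ?_ ?_
    · exact (mm_meas.mul (by fun_prop)).aestronglyMeasurable
    · filter_upwards [ae_restrict_mem measurableSet_Ioc] with r hr
      have hr0 : 0 < r := hr.1
      rw [Real.norm_of_nonneg (mul_nonneg (mm_nonneg hr0.le) (by positivity))]
      calc mm σ r * r ^ (-1 - 2 * s) ≤ (2 * r ^ 2) * r ^ (-1 - 2 * s) := by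
            gcongr; exact min_le_left _ _
        _ = 2 * r ^ (1 - 2 * s) := by
            rw [mul_assoc, ← Real.rpow_natCast, ← Real.rpow_add hr0]; congr 2; push_cast; ring
  have h2 : IntegrableOn (fun r : ℝ => mm σ r * r ^ (-1 - 2 * s)) (Ioi 1) := by
    have h : IntegrableOn (fun r : ℝ => 2 * 2 ^ σ * r ^ (σ - 1 - 2 * s)) (Ioi 1) := by
      apply Integrable.const_mul
      exact integrableOn_Ioi_rpow_of_lt (by linarith) one_pos
    refine Integrable.mono' h ?_ ?_
    · exact (mm_meas.mul (by fun_prop)).aestronglyMeasurable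
    · filter_upwards [ae_restrict_mem measurableSet_Ioi] with r hr
      have hr1 : 1 < r := hr
      have hr0 : 0 < r := by linarith
      rw [Real.norm_of_nonneg (mul_nonneg (mm_nonneg hr0.le) (by positivity))]
      calc mm σ r * r ^ (-1 - 2 * s) ≤ (2 * (2 * r) ^ σ) * r ^ (-1 - 2 * s) := by
            gcongr
            refine (min_le_right _ _).trans ?_
            gcongr; linarith
        _ = 2 * 2 ^ σ * r ^ (σ - 1 - 2 * s) := by
            rw [Real.mul_rpow (by norm_num) hr0.le,
              show σ - 1 - 2 * s = σ + (-1 - 2 * s) by ring, Real.rpow_add hr0]; ring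
  have : Ioi (0 : ℝ) = Ioc 0 1 ∪ Ioi 1 := by rw [Ioc_union_Ioi_eq_Ioi zero_le_one]
  rw [this]; exact h1.union h2

theorem mm_int {n : ℕ} {s σ : ℝ} (hn : 0 < n) (hs : s ∈ Ioo (0 : ℝ) 1) (hσ0 : 0 < σ)
    (hσ : σ < 2 * s) : Integrable (fun y : En n => mm σ ‖y‖ * JJ n s y) := by
  have : Nonempty (Fin n) := ⟨⟨0, hn⟩⟩
  have key := (integrable_fun_norm_addHaar (E := En n) (volume : Measure (En n))
    (f := fun r : ℝ => mm σ r * (r ^ ((n : ℝ) + 2 * s))⁻¹)).2 ?_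
  · simpa [JJ] using key
  · refine (mm_int1 hs hσ0 hσ).congr_fun ?_ measurableSet_Ioi
    intro r hr
    have hr0 : (0 : ℝ) < r := hr
    simp only [finrank_euclideanSpace, Fintype.card_fin, smul_eq_mul]
    rw [← Real.rpow_neg hr0.le, ← Real.rpow_natCast, mul_left_comm, ← Real.rpow_add hr0]
    congr 2
    rw [Nat.cast_sub (by omega)]; push_cast; ring

/-- the constant `C1` -/
def C1 (n : ℕ) (s σ : ℝ) : ℝ := ∫ y : En n, mm σ ‖y‖ * JJ n s y

theorem C1_nonneg {n : ℕ} {s σ : ℝ} : 0 ≤ C1 n s σ :=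
  integral_nonneg fun _ => mul_nonneg (mm_nonneg (norm_nonneg _)) (JJ_nonneg _)

theorem JJ_smul {n : ℕ} {s : ℝ} {c : ℝ} (hc : 0 < c) (y : En n) :
    JJ n s (c • y) = c ^ (-((n : ℝ) + 2 * s)) * JJ n s y := by
  unfold JJ
  rw [norm_smul, Real.norm_of_nonneg hc.le, Real.mul_rpow hc.le (norm_nonneg _), mul_inv,
    Real.rpow_neg hc.le]

theorem mmR_int {n : ℕ} {s σ R : ℝ} (hn : 0 < n) (hs : s ∈ Ioo (0 : ℝ) 1) (hσ0 : 0 < σ)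
    (hσ : σ < 2 * s) (hR : 0 < R) :
    Integrable (fun y : En n => mm σ (‖y‖ / R) * JJ n s y) ∧
    ∫ y : En n, mm σ (‖y‖ / R) * JJ n s y = C1 n s σ * R ^ (-(2 * s)) := by
  have hRi : 0 < R⁻¹ := inv_pos.2 hR
  have heq : (fun y : En n => mm σ (‖y‖ / R) * JJ n s y) =
      fun y => R ^ (-((n : ℝ) + 2 * s)) * (fun z : En n => mm σ ‖z‖ * JJ n s z) (R⁻¹ • y) := by
    funext y
    simp only
    rw [JJ_smul hRi, norm_smul, Real.norm_of_nonneg hRi.le, Real.inv_rpow hR.le,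
      Real.rpow_neg hR.le, inv_inv, div_eq_inv_mul]
    have : R ^ ((n : ℝ) + 2 * s) ≠ 0 := by positivity
    field_simp
  constructor
  · rw [heq]
    exact ((mm_int hn hs hσ0 hσ).comp_smul hRi.ne').const_mul _
  · rw [heq, integral_const_mul, Measure.integral_comp_inv_smul_of_nonneg (volume : Measure (En n))
      (fun z : En n => mm σ ‖z‖ * JJ n s z) hR.le]
    simp only [finrank_euclideanSpace, Fintype.card_fin, smul_eq_mul]
    rw [show -((n : ℝ) + 2 * s) = -(n : ℝ) + -(2 * s) by ring, Real.rpow_add hR,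
      Real.rpow_neg hR.le, Real.rpow_natCast, C1]
    have : R ^ n ≠ 0 := by positivity
    field_simp

/-- the weight -/
def psi (σ : ℝ) (r : ℝ) : ℝ := min (r ^ 2) (r ^ σ)

theorem psi_nonneg {σ r : ℝ} (hr : 0 ≤ r) : 0 ≤ psi σ r := by
  unfold psi; apply le_min <;> positivity

theorem psi_zero {σ : ℝ} (hσ0 : 0 < σ) : psi σ 0 = 0 := by
  simp [psi, Real.zero_rpow hσ0.ne']

theorem psi_cont {σ : ℝ} (hσ0 : 0 < σ) : Continuous (psi σ) := by
  unfold psi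
  exact (continuous_pow 2).min (Real.continuous_rpow_const hσ0.le)

theorem psi_mono {σ : ℝ} (hσ0 : 0 < σ) {r r' : ℝ} (hr : 0 ≤ r) (h : r ≤ r') :
    psi σ r ≤ psi σ r' := by
  unfold psi
  exact min_le_min (by gcongr) (by gcongr)

theorem psi_of_le_one {σ : ℝ} (hσ : σ ≤ 2) {r : ℝ} (hr : 0 ≤ r) (h : r ≤ 1) :
    psi σ r = r ^ 2 := by
  unfold psi
  apply min_eq_left
  rcases hr.eq_or_lt with h0 | h0
  · subst h0; simp [Real.rpow_nonneg]
  · rw [← Real.rpow_natCast]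
    exact Real.rpow_le_rpow_of_exponent_ge h0 h (by exact_mod_cast hσ)

theorem psi_of_ge_one {σ : ℝ} (hσ : σ ≤ 2) {r : ℝ} (h : 1 ≤ r) : psi σ r = r ^ σ := by
  unfold psi
  apply min_eq_right
  rw [← Real.rpow_natCast]
  exact Real.rpow_le_rpow_of_exponent_le h (by exact_mod_cast hσ)

theorem DD_psi {n : ℕ} {σ R : ℝ} (hσ0 : 0 < σ) (hσ : σ ≤ 2) (hR : 0 < R) (x0 x y : En n)
    (hx : ‖x - x0‖ ≤ R) :
    psi σ (‖x + y - x0‖ / R) + psi σ (‖x - y - x0‖ / R) - 2 * psi σ (‖x - x0‖ / R)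
      ≤ mm σ (‖y‖ / R) := by
  set X := x - x0 with hX
  have e1 : x + y - x0 = X + y := by rw [hX]; abel
  have e2 : x - y - x0 = X - y := by rw [hX]; abel
  rw [e1, e2]
  unfold mm
  apply le_min
  · rw [psi_of_le_one hσ (r := ‖X‖ / R) (by positivity) ((div_le_one hR).2 hx)]
    have a1 : psi σ (‖X + y‖ / R) ≤ (‖X + y‖ / R) ^ 2 := min_le_left _ _
    have a2 : psi σ (‖X - y‖ / R) ≤ (‖X - y‖ / R) ^ 2 := min_le_left _ _
    have par := parallelogram_law_with_norm ℝ X y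
    have : (‖X + y‖ / R) ^ 2 + (‖X - y‖ / R) ^ 2 - 2 * (‖X‖ / R) ^ 2 = 2 * (‖y‖ / R) ^ 2 := by
      field_simp; nlinarith [par]
    linarith
  · have h0 := psi_nonneg (σ := σ) (r := ‖X‖ / R) (by positivity)
    have a1 : psi σ (‖X + y‖ / R) ≤ (1 + ‖y‖ / R) ^ σ := by
      refine (min_le_right _ _).trans ?_
      gcongr
      have := norm_add_le X y
      rw [div_le_iff₀ hR]; field_simp; linarith
    have a2 : psi σ (‖X - y‖ / R) ≤ (1 + ‖y‖ / R) ^ σ := by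
      refine (min_le_right _ _).trans ?_
      gcongr
      have := norm_sub_le X y
      rw [div_le_iff₀ hR]; field_simp; linarith
    linarith

/-- parabolic maximum principle skeleton -/
theorem MAX {Y : Type*} [TopologicalSpace Y] (V : ℝ → Y → ℝ) (b : Y → ℝ) (t0 t1 c : ℝ)
    (Y0 Kc : Set Y) (hK : IsCompact Kc) (hKY : Kc ⊆ Y0)
    (hV : ContinuousOn (fun p : ℝ × Y => V p.1 p.2) (Icc t0 t1 ×ˢ univ))
    (hb : Continuous b)
    (hout : ∀ t ∈ Icc t0 t1, ∀ y ∈ Y0, y ∉ Kc → V t y - b y - c * (t - t0) ≤ 0)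
    (hini : ∀ y ∈ Y0, V t0 y - b y ≤ 0)
    (hmax : ∀ t ∈ Ioc t0 t1, ∀ y ∈ Kc, 0 < V t y - b y - c * (t - t0) →
      (∀ y' ∈ Y0, V t y' - b y' ≤ V t y - b y) →
      ∃ d < c, HasDerivAt (fun τ => V τ y) d t) :
    ∀ t ∈ Icc t0 t1, ∀ y ∈ Y0, V t y - b y - c * (t - t0) ≤ 0 := by
  by_contra hcon
  push Not at hcon
  obtain ⟨ts, hts, ys, hys, hpos⟩ := hcon
  have hysK : ys ∈ Kc := by
    by_contra h; exact absurd (hout ts hts ys hys h) (not_le.2 hpos)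
  have hcomp : IsCompact (Icc t0 t1 ×ˢ Kc) := isCompact_Icc.prod hK
  have hcont : ContinuousOn (fun p : ℝ × Y => V p.1 p.2 - b p.2 - c * (p.1 - t0))
      (Icc t0 t1 ×ˢ Kc) := by
    refine ContinuousOn.sub (ContinuousOn.sub (hV.mono ?_) ?_) ?_
    · exact prod_mono le_rfl (subset_univ _)
    · exact (hb.comp continuous_snd).continuousOn
    · fun_prop
  obtain ⟨⟨th, yh⟩, hmem, hmx⟩ := hcomp.exists_isMaxOn ⟨(ts, ys), hts, hysK⟩ hcont
  have hmx' : ∀ t ∈ Icc t0 t1, ∀ y ∈ Kc, V t y - b y - c * (t - t0) ≤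
      V th yh - b yh - c * (th - t0) := fun t ht y hy => hmx (show (t, y) ∈ _ from ⟨ht, hy⟩)
  have hth : th ∈ Icc t0 t1 := hmem.1
  have hyh : yh ∈ Kc := hmem.2
  have hp : 0 < V th yh - b yh - c * (th - t0) := hpos.trans_le (hmx' ts hts ys hysK)
  have hne : t0 < th := by
    rcases hth.1.eq_or_lt with h | h
    · subst h
      have := hini yh (hKY hyh); simp at hp; linarith
    · exact h
  obtain ⟨d, hd, hder⟩ := hmax th ⟨hne, hth.2⟩ yh hyh hp (by
    intro y' hy'
    by_cases hk : y' ∈ Kc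
    · linarith [hmx' th hth y' hk]
    · linarith [hout th hth y' hy' hk])
  rw [hasDerivAt_iff_tendsto_slope] at hder
  have hev : ∀ᶠ t in 𝓝[<] th, slope (fun τ => V τ yh) th t < c := by
    have := hder.eventually (gt_mem_nhds hd)
    exact this.filter_mono (nhdsWithin_mono _ (fun x hx => ne_of_lt hx))
  have hev2 : ∀ᶠ t in 𝓝[<] th, t ∈ Ioo t0 th := Ioo_mem_nhdsLT hne
  obtain ⟨t, ht1, ht2⟩ := (hev.and hev2).exists
  have hm := hmx' t ⟨ht2.1.le, ht2.2.le.trans hth.2⟩ yh hyh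
  rw [slope_def_field, div_lt_iff_of_neg (by linarith [ht2.2])] at ht1
  nlinarith



theorem pc0 {ε : ℝ} (hε : ε ∈ Ioo (0 : ℝ) 1) :
    ∃ c0 > 0, ∀ ξ ∈ Icc (1 / 4 : ℝ) (1 / 2), (1 + ξ) ^ ε + (1 - ξ) ^ ε - 2 ≤ -c0 := by
  have hc : ContinuousOn (fun ξ : ℝ => (1 + ξ) ^ ε + (1 - ξ) ^ ε - 2) (Icc (1 / 4 : ℝ) (1 / 2)) := by
    have h1 : Continuous (fun x : ℝ => x ^ ε) := Real.continuous_rpow_const hε.1.le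
    fun_prop
  obtain ⟨ξ, hξ, hm⟩ := isCompact_Icc.exists_isMaxOn ⟨1 / 4, by norm_num⟩ hc
  refine ⟨-((1 + ξ) ^ ε + (1 - ξ) ^ ε - 2), ?_, fun x hx => ?_⟩
  · have h1 := rpow_one_add_lt_one_add_mul_self (s := ξ) (by linarith [hξ.1])
      (by intro h; linarith [hξ.1]) hε.1 hε.2
    have h2 := rpow_one_add_lt_one_add_mul_self (s := -ξ) (by linarith [hξ.2])
      (by intro h; linarith [hξ.1]) hε.1 hε.2
    rw [← sub_eq_add_neg] at h2
    linarith
  · have := hm hx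
    simp only at this
    rw [neg_neg]; exact this

theorem pneg {ε : ℝ} (hε : ε ∈ Ioo (0 : ℝ) 1) {ξ : ℝ} (h1 : -1 ≤ ξ) (h2 : ξ ≤ 1) :
    (1 + ξ) ^ ε + (1 - ξ) ^ ε - 2 ≤ 0 := by
  have h1 := rpow_one_add_le_one_add_mul_self (s := ξ) h1 hε.1.le hε.2.le
  have h2 := rpow_one_add_le_one_add_mul_self (s := -ξ) (by linarith) hε.1.le hε.2.le
  rw [← sub_eq_add_neg] at h2
  linarith

theorem DDk_int {n : ℕ} {s lam Lam : ℝ} (hlam : 0 < lam)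
    {a f : En n → ℝ} (ha : KernelBounds lam Lam a)
    (hf : Continuous f) {x : En n} (hi : Integrable (Lintegrand n s a f x)) :
    Integrable (fun y => DD f x y * JJ n s y) := by
  refine Integrable.mono' (hi.norm.const_mul lam⁻¹) ?_ ?_
  · exact ((continuous_DD hf x).measurable.mul measurable_JJ).aestronglyMeasurable
  · filter_upwards with y
    by_cases hy : y = 0
    · subst hy; simp [DD_zero]; positivity
    have hk := (KB ha hy).1
    have ha0 : 0 < a (‖y‖⁻¹ • y) := by linarith
    rw [Lintegrand_eq, norm_mul, norm_mul, norm_mul, Real.norm_of_nonneg ha0.le]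
    have h1 : 1 ≤ lam⁻¹ * a (‖y‖⁻¹ • y) := by
      rw [inv_mul_eq_div, le_div_iff₀ hlam]; linarith
    have h2 : 0 ≤ ‖DD f x y‖ * ‖JJ n s y‖ := by positivity
    nlinarith

set_option maxHeartbeats 2000000 in
theorem DLcore {n : ℕ} {s σ ε lam : ℝ} (hn : 0 < n) (hs : s ∈ Ioo (0 : ℝ) 1) (hσ0 : 0 < σ)
    (hσ : σ < 2 * s) (hε : ε ∈ Ioo (0 : ℝ) 1) (hlam : 0 < lam) :
    ∃ c1 > 0, ∀ (Lam : ℝ) (a : En n → ℝ), KernelBounds lam Lam a →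
    ∀ (f : En n → ℝ), Continuous f → ∀ (x0 x h : En n) (R A B : ℝ), 0 < R → 0 ≤ A → 0 ≤ B →
      h ≠ 0 → 4 * ‖h‖ ≤ R → ‖x - x0‖ ≤ R →
      Integrable (Lintegrand n s a f x) → Integrable (Lintegrand n s a f (x + h)) →
      (∀ x' h' : En n, ‖h'‖ ≤ R / 2 →
        f (x' + h') - f x' - (A * ‖h'‖ ^ ε + B * psi σ (‖x' - x0‖ / R)) ≤
        f (x + h) - f x - (A * ‖h‖ ^ ε + B * psi σ (‖x - x0‖ / R))) →
      Lop n s a f (x + h) - Lop n s a f x ≤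
        B * Lam * C1 n s σ * R ^ (-(2 * s)) - c1 * A * ‖h‖ ^ (ε - 2 * s) := by
  obtain ⟨c0, hc0, hp⟩ := pc0 hε
  have : Nonempty (Fin n) := ⟨⟨0, hn⟩⟩
  have hvol : 0 < (volume (ball (0 : En n) 1)).toReal :=
    ENNReal.toReal_pos (measure_ball_pos _ _ one_pos).ne' measure_ball_lt_top.ne
  refine ⟨c0 * lam * (volume (ball (0 : En n) 1)).toReal * (4 ^ n)⁻¹ * 4 ^ (2 * s),
    by positivity, ?_⟩
  intro Lam a ha f hf x0 x h R A B hR hA hB hh0 hhR hxR hix hiz hmax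
  have hh : 0 < ‖h‖ := norm_pos_iff.2 hh0
  set r : ℝ := ‖h‖ / 4 with hr
  have hr0 : 0 < r := by positivity
  have hσ2 : σ ≤ 2 := by linarith [hs.2]
  set S := (Submodule.span ℝ {h}).reflection with hS
  set ξ : En n → ℝ := fun y => 2 * (inner ℝ h y / ‖h‖ ^ 2) with hξ
  have hSy : ∀ y, S y = (ξ y) • h - y := by
    intro y
    rw [hS, Submodule.reflection_singleton_apply, hξ]
    simp only [RCLike.ofReal_real_eq_id, id, two_smul, ← add_smul]
    congr 2; ring
  set k : En n → ℝ := fun y => if ‖y‖ < r then lam else 0 with hk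
  have hkm : Measurable k := by
    apply Measurable.ite _ measurable_const measurable_const
    exact measurableSet_lt measurable_norm measurable_const
  set I0 : En n → ℝ := fun y => DD f x y * JJ n s y * k y with hI0
  have hI0i : Integrable I0 := by
    refine Integrable.mono' ((DDk_int hlam ha hf hix).norm.const_mul lam) ?_ ?_
    · exact ((((continuous_DD hf x).measurable.mul measurable_JJ).mul hkm)).aestronglyMeasurable
    · filter_upwards with y
      rw [hI0, norm_mul, mul_comm]
      gcongr
      simp only [hk]
      split_ifs
      · rw [Real.norm_of_nonneg hlam.le]
      · simpa using hlam.le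
  have hmp : MeasurePreserving S volume volume := S.measurePreserving
  have hI0S : Integrable (fun y => I0 (S y)) :=
    (hmp.integrable_comp_emb S.toHomeomorph.measurableEmbedding).2 hI0i
  have hI0e : ∫ y, I0 (S y) = ∫ y, I0 y :=
    hmp.integral_comp S.toHomeomorph.measurableEmbedding I0
  -- the ball
  set y0 : En n := (3 / 4 * r / ‖h‖) • h with hy0
  set Bl : Set (En n) := ball y0 (r / 4) with hBl
  have hsum : Lop n s a f (x + h) - Lop n s a f x =
      ∫ y, (Lintegrand n s a f (x + h) y - Lintegrand n s a f x y + I0 y - I0 (S y)) := by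
    have z1 := integral_sub ((hiz.sub hix).add hI0i) hI0S
    have z2 := integral_add (hiz.sub hix) hI0i
    have z3 := integral_sub hiz hix
    simp only [Pi.add_apply, Pi.sub_apply] at z1 z2 z3
    rw [z1, z2, z3, hI0e, Lop, Lop]; ring
  obtain ⟨hmi, hme⟩ := mmR_int (R := R) hn hs hσ0 hσ hR
  set q : ℝ := A * ‖h‖ ^ ε * c0 * lam * r ^ (-((n : ℝ) + 2 * s)) with hq
  have hq0 : 0 ≤ q := by positivity
  have hindi : Integrable (Bl.indicator (fun _ => q)) := by
    rw [integrable_indicator_iff measurableSet_ball]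
    exact integrableOn_const measure_ball_lt_top.ne
  have hbound : ∫ y, (Lintegrand n s a f (x + h) y - Lintegrand n s a f x y + I0 y - I0 (S y))
      ≤ ∫ y, (B * Lam * (mm σ (‖y‖ / R) * JJ n s y) - Bl.indicator (fun _ => q) y) := by
    apply integral_mono (((hiz.sub hix).add hI0i).sub hI0S)
    · exact (hmi.const_mul _).sub hindi
    intro y
    simp only [Pi.add_apply, Pi.sub_apply]
    by_cases hy : y = 0
    · subst hy
      have : (0 : En n) ∉ Bl := by
        rw [hBl, mem_ball, dist_eq_norm, zero_sub, norm_neg, hy0, norm_smul, Real.norm_of_nonneg (by positivity), div_mul_cancel₀ _ hh.ne']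
        linarith
      have h00 : mm σ 0 = 0 := by simp [mm]
      simp [Lintegrand_eq, hI0, DD_zero, indicator_of_notMem this, h00]
    obtain ⟨ha1, ha2⟩ := KB ha hy
    set a0 := a (‖y‖⁻¹ • y) with ha0
    set Jy := JJ n s y with hJy
    have hJ0 : 0 ≤ Jy := JJ_nonneg y
    have hyn : 0 < ‖y‖ := norm_pos_iff.2 hy
    have hm0 : 0 ≤ mm σ (‖y‖ / R) := mm_nonneg (by positivity)
    set m := mm σ (‖y‖ / R) with hm
    have hLam : 0 ≤ Lam := by linarith
    rw [Lintegrand_eq, Lintegrand_eq]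
    have d1 : DD f (x + h) y - DD f x y ≤ B * m := by
      have q1 := hmax (x + y) h (by linarith)
      have q2 := hmax (x - y) h (by linarith)
      have q3 := DD_psi hσ0 hσ2 hR x0 x y hxR
      have q4 := mul_le_mul_of_nonneg_left q3 hB
      rw [show x + y + h = x + h + y by abel] at q1
      rw [show x - y + h = x + h - y by abel] at q2
      simp only [DD]
      linarith
    have hSn : ‖S y‖ = ‖y‖ := S.norm_map y
    have hJS : JJ n s (S y) = Jy := by rw [hJy, JJ, JJ, hSn]
    have hkS : k (S y) = k y := by simp only [hk, hSn]
    simp only [hI0]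
    rw [hJS, hkS]
    by_cases hyr : ‖y‖ < r
    · have hky : k y = lam := by simp [hk, hyr]
      rw [hky]
      have hxi : |ξ y| ≤ 1 / 2 := by
        have := abs_real_inner_le_norm h y
        simp only [hξ]
        rw [abs_mul, abs_div, abs_of_pos (by positivity : (0 : ℝ) < ‖h‖ ^ 2), abs_two]
        rw [← mul_div_assoc, div_le_iff₀ (by positivity)]
        nlinarith
      have hxi' := abs_le.1 hxi
      have d2 : DD f (x + h) y - DD f x (S y) ≤
          A * ‖h‖ ^ ε * ((1 + ξ y) ^ ε + (1 - ξ y) ^ ε - 2) + B * m := by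
        have n1 : ‖(1 + ξ y) • h‖ = (1 + ξ y) * ‖h‖ := by
          rw [norm_smul, Real.norm_of_nonneg (by linarith)]
        have n2 : ‖(1 - ξ y) • h‖ = (1 - ξ y) * ‖h‖ := by
          rw [norm_smul, Real.norm_of_nonneg (by linarith)]
        have q1 := hmax (x - S y) ((1 + ξ y) • h) (by rw [n1]; nlinarith [mul_le_mul_of_nonneg_right hxi'.2 hh.le])
        have q2 := hmax (x + S y) ((1 - ξ y) • h) (by rw [n2]; nlinarith [mul_le_mul_of_nonneg_right hxi'.1 hh.le])
        have q3 := DD_psi hσ0 hσ2 hR x0 x (S y) hxR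
        rw [hSn] at q3
        have q4 := mul_le_mul_of_nonneg_left q3 hB
        rw [n1, Real.mul_rpow (by linarith) hh.le] at q1
        rw [n2, Real.mul_rpow (by linarith) hh.le] at q2
        rw [show x - S y + (1 + ξ y) • h = x + h + y by rw [hSy, add_smul, one_smul]; abel] at q1
        rw [show x + S y + (1 - ξ y) • h = x + h - y by rw [hSy, sub_smul, one_smul]; abel] at q2
        simp only [DD]
        linarith
      have e1 : (DD f (x + h) y - DD f x y) * ((a0 - lam) * Jy) ≤ B * m * ((a0 - lam) * Jy) :=
        mul_le_mul_of_nonneg_right d1 (mul_nonneg (by linarith) hJ0)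
      have e2 := mul_le_mul_of_nonneg_right d2 (mul_nonneg hlam.le hJ0)
      have e3 : B * m * (a0 * Jy) ≤ B * m * (Lam * Jy) := by gcongr
      have e4 : A * ‖h‖ ^ ε * ((1 + ξ y) ^ ε + (1 - ξ y) ^ ε - 2) * (lam * Jy) ≤
          - Bl.indicator (fun _ => q) y := by
        by_cases hyB : y ∈ Bl
        · rw [indicator_of_mem hyB, hq]
          have hxi2 : 1 / 4 ≤ ξ y := by
            have hd : ‖y - y0‖ < r / 4 := by rw [← dist_eq_norm]; exact hyB
            have i1 := abs_real_inner_le_norm h (y - y0)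
            have i2 : inner ℝ h y = inner ℝ h (y - y0) + 3 / 4 * r * ‖h‖ := by
              rw [inner_sub_right, hy0, inner_smul_right, real_inner_self_eq_norm_sq]
              field_simp; ring
            have i3 := (abs_le.1 i1).1
            have i4 : ‖h‖ * ‖y - y0‖ ≤ ‖h‖ * (r / 4) := by gcongr
            simp only [hξ]
            rw [← mul_div_assoc, le_div_iff₀ (by positivity)]
            nlinarith
          have hpp := hp (ξ y) ⟨hxi2, hxi'.2⟩
          have hJr : r ^ (-((n : ℝ) + 2 * s)) ≤ Jy := by
            rw [hJy, JJ, Real.rpow_neg hr0.le]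
            have : 0 ≤ (n : ℝ) + 2 * s := by have := hs.1; positivity
            gcongr
          have : A * ‖h‖ ^ ε * ((1 + ξ y) ^ ε + (1 - ξ y) ^ ε - 2) * (lam * Jy) ≤
            A * ‖h‖ ^ ε * (-c0) * (lam * Jy) := by gcongr
          have g2 : A * ‖h‖ ^ ε * c0 * lam * r ^ (-((n : ℝ) + 2 * s)) ≤
            A * ‖h‖ ^ ε * c0 * lam * Jy := by gcongr
          linarith
        · rw [indicator_of_notMem hyB]
          have := pneg hε (ξ := ξ y) (by linarith) (by linarith)
          have h3 : 0 ≤ A * ‖h‖ ^ ε * (lam * Jy) := by positivity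
          nlinarith
      linarith
    · have hky : k y = 0 := by simp [hk, hyr]
      have hyB : y ∉ Bl := by
        intro hyB
        apply hyr
        have hd : ‖y - y0‖ < r / 4 := by rw [← dist_eq_norm]; exact hyB
        have hy0n : ‖y0‖ = 3 / 4 * r := by
          rw [hy0, norm_smul, Real.norm_of_nonneg (by positivity), div_mul_cancel₀ _ hh.ne']
        have := norm_add_le (y - y0) y0
        rw [sub_add_cancel] at this
        linarith
      rw [hky, indicator_of_notMem hyB]
      have e1 : (DD f (x + h) y - DD f x y) * (a0 * Jy) ≤ B * m * (a0 * Jy) :=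
        mul_le_mul_of_nonneg_right d1 (mul_nonneg (by linarith) hJ0)
      have e3 : B * m * (a0 * Jy) ≤ B * m * (Lam * Jy) := by gcongr
      linarith
  rw [hsum]
  refine hbound.trans (le_of_eq ?_)
  rw [integral_sub (hmi.const_mul _) hindi,
    integral_const_mul, hme, integral_indicator measurableSet_ball, setIntegral_const,
    measureReal_def, Measure.addHaar_ball _ _ (by positivity), ENNReal.toReal_mul,
    ENNReal.toReal_ofReal (by positivity), hq]
  simp only [finrank_euclideanSpace, Fintype.card_fin, smul_eq_mul]
  have : r ^ (-((n : ℝ) + 2 * s)) = (r ^ n)⁻¹ * (4 ^ (2 * s) * ‖h‖ ^ (-(2 * s))) := by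
    rw [show -((n : ℝ) + 2 * s) = -(n : ℝ) + -(2 * s) by ring, Real.rpow_add hr0,
      Real.rpow_neg hr0.le, Real.rpow_natCast]
    congr 1
    rw [hr, Real.div_rpow hh.le (by norm_num), Real.rpow_neg (by norm_num : (0:ℝ) ≤ 4)]
    field_simp
  rw [this, show ε - 2 * s = ε + -(2 * s) by ring, Real.rpow_add hh]
  have hrn : r ^ n ≠ 0 := by positivity
  rw [div_pow]
  field_simp


theorem SolvesAt.neg' {n : ℕ} {s : ℝ} {a : En n → ℝ} {u : ℝ → En n → ℝ} {t : ℝ} {x : En n}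
    (h : SolvesAt n s a u (fun _ _ => 0) t x) :
    SolvesAt n s a (fun t x => - u t x) (fun _ _ => 0) t x := by
  obtain ⟨h1, h2⟩ := h
  have e : Lintegrand n s a (fun x => - u t x) x = fun y => - Lintegrand n s a (u t) x y := by
    funext y; simp only [Lintegrand_eq, DD]; ring
  refine ⟨by rw [e]; exact h1.neg, ?_⟩
  have : Lop n s a (fun x => - u t x) x = - Lop n s a (u t) x := by
    rw [Lop, e, integral_neg, Lop]
  rw [this]
  have := h2.neg
  simp only [add_zero] at this ⊢
  exact this

theorem SolvesAt.sub' {n : ℕ} {s : ℝ} {a : En n → ℝ} {u v : ℝ → En n → ℝ} {t : ℝ} {x : En n}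
    (h : SolvesAt n s a u (fun _ _ => 0) t x) (h' : SolvesAt n s a v (fun _ _ => 0) t x) :
    SolvesAt n s a (fun t x => u t x - v t x) (fun _ _ => 0) t x := by
  obtain ⟨h1, h2⟩ := h
  obtain ⟨h1', h2'⟩ := h'
  have e : Lintegrand n s a (fun x => u t x - v t x) x =
      fun y => Lintegrand n s a (u t) x y - Lintegrand n s a (v t) x y := by
    funext y; simp only [Lintegrand_eq, DD]; ring
  refine ⟨by rw [e]; exact h1.sub h1', ?_⟩
  have : Lop n s a (fun x => u t x - v t x) x = Lop n s a (u t) x - Lop n s a (v t) x := by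
    rw [Lop, e, integral_sub h1 h1', Lop, Lop]
  rw [this]
  have := h2.sub h2'
  simp only [add_zero] at this ⊢
  exact this

theorem cont_slice {n : ℕ} {u : ℝ → En n → ℝ} {I : Set ℝ}
    (hu : ContinuousOn (fun p : ℝ × En n => u p.1 p.2) (I ×ˢ univ)) {t : ℝ} (ht : t ∈ I) :
    Continuous (u t) := by
  have : ContinuousOn (fun x : En n => (fun p : ℝ × En n => u p.1 p.2) (t, x)) univ :=
    hu.comp (by fun_prop) (fun x _ => ⟨ht, mem_univ _⟩)
  rw [← continuousOn_univ]; exact this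

theorem rpow_sigma_le {σ : ℝ} (hσ0 : 0 < σ) (hσ : σ ≤ 2) {k X : ℝ} (hk : 1 ≤ k) (hX : 0 ≤ X) :
    (k * X) ^ σ ≤ k ^ 2 * X ^ σ := by
  rw [Real.mul_rpow (by linarith) hX]
  gcongr
  rw [← Real.rpow_natCast]
  exact Real.rpow_le_rpow_of_exponent_le hk (by exact_mod_cast hσ)

set_option maxHeartbeats 1000000 in
theorem DL1 {n : ℕ} {s σ ε lam Lam : ℝ} (hn : 0 < n) (hs : s ∈ Ioo (0 : ℝ) 1) (hσ0 : 0 < σ)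
    (hσ : σ < 2 * s) (hε : ε ∈ Ioo (0 : ℝ) 1) (hε2 : ε ≤ 2 * s) (hlam : 0 < lam)
    (hlL : lam ≤ Lam) :
    ∃ A > 0, ∀ (a : En n → ℝ), KernelBounds lam Lam a →
    ∀ (u : ℝ → En n → ℝ) (x0 : En n) (R M tb : ℝ), 0 < R → 0 < M →
    ContinuousOn (fun p : ℝ × En n => u p.1 p.2) (Icc (tb - R ^ (2 * s)) tb ×ˢ univ) →
    (∀ t ∈ Icc (tb - R ^ (2 * s)) tb, ∀ x, |u t x| ≤ M * (R + ‖x - x0‖) ^ σ) →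
    (∀ t ∈ Icc (tb - R ^ (2 * s)) tb, ∀ x z, ‖x - x0‖ ≤ R / 2 → ‖z - x0‖ ≤ R / 2 →
      (SolvesAt n s a u (fun _ _ => 0) t x ∧ SolvesAt n s a u (fun _ _ => 0) t z) ∨
      |u t x - u t z| ≤ M * R ^ (σ - ε) * ‖x - z‖ ^ ε) →
    ∀ h : En n, ‖h‖ ≤ R / 4 → u tb (x0 + h) - u tb x0 ≤ A * M * R ^ (σ - ε) * ‖h‖ ^ ε := by
  obtain ⟨c1, hc1, hcore⟩ := DLcore (n := n) hn hs hσ0 hσ hε hlam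
  have hC1 := C1_nonneg (n := n) (s := s) (σ := σ)
  have hσ2 : σ ≤ 2 := by linarith [hs.2]
  set A : ℝ := 72 + 2592 * (Lam * C1 n s σ + 1) / c1 with hA
  have hLam : 0 < Lam := by linarith
  have hA72 : 72 ≤ A := by rw [hA]; have : 0 ≤ 2592 * (Lam * C1 n s σ + 1) / c1 := by positivity
                           linarith
  refine ⟨A, by linarith, ?_⟩
  intro a ha u x0 R M tb hR hM hu hbd halt h hh
  set A' : ℝ := A * M * R ^ (σ - ε) with hA'
  set B' : ℝ := 2592 * M * R ^ σ with hB'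
  have hB'0 : 0 < B' := by positivity
  have hA'0 : 0 < A' := by have : 0 < A := by linarith
                           positivity
  have hR2 : 0 < R ^ (2 * s) := by positivity
  set t0 := tb - R ^ (2 * s) with ht0
  have hAR : A * M * R ^ σ ≤ 4 * (A' * (R / 4) ^ ε) := by
    have e : R ^ σ = R ^ (σ - ε) * R ^ ε := by rw [← Real.rpow_add hR]; congr 1; ring
    have e2 : R ^ ε ≤ 4 * (R / 4) ^ ε := by
      rw [Real.div_rpow hR.le (by norm_num)]
      have : (4 : ℝ) ^ ε ≤ 4 := by
        simpa using Real.rpow_le_rpow_of_exponent_le (by norm_num : (1:ℝ) ≤ 4) hε.2.le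
      rw [← mul_div_assoc, le_div_iff₀ (by positivity)]
      nlinarith [Real.rpow_nonneg hR.le ε]
    rw [e, hA']
    have : 0 ≤ A * M * R ^ (σ - ε) := by rw [← hA']; exact hA'0.le
    nlinarith
  have hVb : ∀ t ∈ Icc t0 tb, ∀ x h : En n, ‖h‖ ≤ R / 2 →
      u t (x + h) - u t x ≤ 2 * M * (2 * R + ‖x - x0‖) ^ σ := by
    intro t ht x h hh
    have b1 := (abs_le.1 (hbd t ht (x + h))).2
    have b2 := (abs_le.1 (hbd t ht x)).1
    have b3 : (R + ‖x + h - x0‖) ^ σ ≤ (2 * R + ‖x - x0‖) ^ σ := by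
      refine Real.rpow_le_rpow (by positivity) ?_ hσ0.le
      have := norm_add_le (x - x0) h
      rw [show x - x0 + h = x + h - x0 by abel] at this
      linarith
    have b4 : (R + ‖x - x0‖) ^ σ ≤ (2 * R + ‖x - x0‖) ^ σ := by
      gcongr; linarith
    nlinarith
  have hfar : ∀ t ∈ Icc t0 tb, ∀ x h : En n, ‖h‖ ≤ R / 2 → (R / 4 < ‖x - x0‖ ∨ R / 4 < ‖h‖) →
      u t (x + h) - u t x ≤ A' * ‖h‖ ^ ε + B' * psi σ (‖x - x0‖ / R) := by
    intro t ht x h hh hc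
    have hv := hVb t ht x h hh
    have hps := psi_nonneg (σ := σ) (r := ‖x - x0‖ / R) (by positivity)
    by_cases hX : R / 4 < ‖x - x0‖
    · have b1 : (2 * R + ‖x - x0‖) ^ σ ≤ 9 ^ 2 * ‖x - x0‖ ^ σ := by
        refine le_trans ?_ (rpow_sigma_le hσ0 hσ2 (by norm_num) (norm_nonneg _))
        gcongr; linarith
      have b2 : M * (R ^ σ * (‖x - x0‖ / R) ^ σ) = M * ‖x - x0‖ ^ σ := by
        rw [← Real.mul_rpow hR.le (by positivity)]; congr 2; field_simp
      have b3 : (‖x - x0‖ / R) ^ σ ≤ 16 * psi σ (‖x - x0‖ / R) := by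
        have hx0 : 0 ≤ ‖x - x0‖ / R := by positivity
        rcases le_total (‖x - x0‖ / R) 1 with h1 | h1
        · rw [psi_of_le_one hσ2 hx0 h1]
          have i1 : (‖x - x0‖ / R) ^ σ ≤ 1 := Real.rpow_le_one hx0 h1 hσ0.le
          have i2 : 1 / 4 ≤ ‖x - x0‖ / R := by rw [le_div_iff₀ hR]; linarith
          nlinarith
        · rw [psi_of_ge_one hσ2 h1]
          have := Real.rpow_nonneg hx0 σ
          linarith
      have b4 : M * R ^ σ * (‖x - x0‖ / R) ^ σ ≤ M * R ^ σ * (16 * psi σ (‖x - x0‖ / R)) := by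
        gcongr
      have b5 : 0 ≤ A' * ‖h‖ ^ ε := by positivity
      have b6 := mul_le_mul_of_nonneg_left b1 hM.le
      rw [hB']; linarith
    · have hh4 : R / 4 < ‖h‖ := by tauto
      have b1 : (2 * R + ‖x - x0‖) ^ σ ≤ 3 ^ 2 * R ^ σ := by
        refine le_trans ?_ (rpow_sigma_le hσ0 hσ2 (by norm_num) hR.le)
        gcongr; linarith
      have b2 : A' * (R / 4) ^ ε ≤ A' * ‖h‖ ^ ε := by gcongr; exact hε.1.le
      have b6 := mul_le_mul_of_nonneg_left b1 hM.le
      have b7 : 72 * M * R ^ σ ≤ A * M * R ^ σ := by gcongr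
      have b8 : 0 ≤ B' * psi σ (‖x - x0‖ / R) := by positivity
      linarith
  have hcen : ∀ t ∈ Icc t0 tb, ∀ x h : En n, ‖h‖ ≤ R / 4 → ‖x - x0‖ ≤ R / 4 →
      u t (x + h) - u t x ≤ B' := by
    intro t ht x h hh hX
    have hv := hVb t ht x h (by linarith)
    have b1 : (2 * R + ‖x - x0‖) ^ σ ≤ 3 ^ 2 * R ^ σ := by
      refine le_trans ?_ (rpow_sigma_le hσ0 hσ2 (by norm_num) hR.le)
      gcongr; linarith
    have b6 := mul_le_mul_of_nonneg_left b1 hM.le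
    have : 0 < M * R ^ σ := by positivity
    rw [hB']; linarith
  have hmain := MAX (Y := En n × En n) (fun t p => u t (p.1 + p.2) - u t p.1)
    (fun p => A' * ‖p.2‖ ^ ε + B' * psi σ (‖p.1 - x0‖ / R) + B') t0 tb (-(B' / R ^ (2 * s)))
    {p | ‖p.2‖ ≤ R / 2} (closedBall x0 (R / 4) ×ˢ closedBall 0 (R / 4))
    ((isCompact_closedBall _ _).prod (isCompact_closedBall _ _)) ?_ ?_ ?_ ?_ ?_ ?_
  · have hf := hmain tb ⟨by rw [ht0]; linarith, le_rfl⟩ (x0, h) (by simp only [mem_ofPred_eq]; linarith)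
    simp only [sub_self, norm_zero, zero_div, psi_zero hσ0] at hf
    have : B' / R ^ (2 * s) * (tb - t0) = B' := by rw [ht0]; field_simp; ring
    linarith
  · rintro ⟨x, h⟩ ⟨_, h2⟩
    simp only [mem_closedBall, dist_zero_right] at h2
    simp only [mem_ofPred_eq]; linarith
  · refine ContinuousOn.sub ?_ ?_
    · exact hu.comp (f := fun p : ℝ × En n × En n => (p.1, p.2.1 + p.2.2))
        (by fun_prop) (fun p hp => ⟨hp.1, mem_univ _⟩)
    · exact hu.comp (f := fun p : ℝ × En n × En n => (p.1, p.2.1))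
        (by fun_prop) (fun p hp => ⟨hp.1, mem_univ _⟩)
  · have h1 := psi_cont hσ0
    have h2 : Continuous (fun x : ℝ => x ^ ε) := Real.continuous_rpow_const hε.1.le
    fun_prop
  · rintro t ht ⟨x, h⟩ hh hK
    simp only [mem_ofPred_eq] at hh
    have hc : R / 4 < ‖x - x0‖ ∨ R / 4 < ‖h‖ := by
      by_contra hcon
      push Not at hcon
      exact hK ⟨by simpa [dist_eq_norm] using hcon.1, by simpa using hcon.2⟩
    have := hfar t ht x h hh hc
    have h3 : B' / R ^ (2 * s) * (t - t0) ≤ B' := by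
      rw [div_mul_eq_mul_div, div_le_iff₀ hR2]
      gcongr; rw [ht0]; linarith [ht.2]
    simp only
    linarith
  · rintro ⟨x, h⟩ hh
    simp only [mem_ofPred_eq] at hh
    have ht : t0 ∈ Icc t0 tb := ⟨le_rfl, by rw [ht0]; linarith⟩
    simp only
    have hps : 0 ≤ B' * psi σ (‖x - x0‖ / R) := mul_nonneg hB'0.le (psi_nonneg (by positivity))
    by_cases hc : R / 4 < ‖x - x0‖ ∨ R / 4 < ‖h‖
    · have := hfar t0 ht x h hh hc
      linarith
    · push Not at hc
      have := hcen t0 ht x h hc.2 hc.1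
      have : 0 ≤ A' * ‖h‖ ^ ε := by positivity
      linarith
  · rintro t ht ⟨x, h⟩ ⟨hxK, hhK⟩ hpos hmx
    simp only [mem_closedBall, dist_eq_norm, sub_zero] at hxK hhK
    simp only at hpos hmx
    have htI : t ∈ Icc t0 tb := ⟨ht.1.le, ht.2⟩
    have h3 : B' / R ^ (2 * s) * (t - t0) ≤ B' := by
      rw [div_mul_eq_mul_div, div_le_iff₀ hR2]
      gcongr; rw [ht0]; linarith [ht.2]
    have hps : 0 ≤ B' * psi σ (‖x - x0‖ / R) := mul_nonneg hB'0.le (psi_nonneg (by positivity))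
    have hVpos : A' * ‖h‖ ^ ε < u t (x + h) - u t x := by linarith
    have hh0 : h ≠ 0 := by
      rintro rfl
      simp only [add_zero, sub_self] at hVpos
      have : 0 ≤ A' * ‖(0 : En n)‖ ^ ε := by positivity
      linarith
    have hhp : 0 < ‖h‖ := norm_pos_iff.2 hh0
    have hz : ‖x + h - x0‖ ≤ R / 2 := by
      have := norm_add_le (x - x0) h
      rw [show x - x0 + h = x + h - x0 by abel] at this
      linarith
    rcases halt t htI (x + h) x hz (by linarith) with ⟨hs1, hs2⟩ | hb
    · refine ⟨Lop n s a (u t) (x + h) - Lop n s a (u t) x, ?_, ?_⟩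
      · have := hcore Lam a ha (u t) (cont_slice hu htI) x0 x h R A' B' hR hA'0.le hB'0.le hh0
          (by linarith) (by linarith) hs2.1 hs1.1 (by
            intro x' h' hh'
            have := hmx (x', h') hh'
            simp only at this
            linarith)
        refine this.trans_lt ?_
        have g1 : R ^ (ε - 2 * s) ≤ ‖h‖ ^ (ε - 2 * s) :=
          Real.rpow_le_rpow_of_nonpos hhp (by linarith) (by linarith)
        have g2 : c1 * A' * R ^ (ε - 2 * s) ≤ c1 * A' * ‖h‖ ^ (ε - 2 * s) := by gcongr
        have g3 : c1 * A' * R ^ (ε - 2 * s) = c1 * A * M * (R ^ σ * R ^ (-(2 * s))) := by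
          rw [hA', ← Real.rpow_add hR, show σ + -(2 * s) = (σ - ε) + (ε - 2 * s) by ring,
            Real.rpow_add hR]; ring
        have g4 : B' / R ^ (2 * s) = 2592 * M * (R ^ σ * R ^ (-(2 * s))) := by
          rw [hB', Real.rpow_neg hR.le]; field_simp
        rw [g4]
        have g5 : c1 * A = 72 * c1 + 2592 * (Lam * C1 n s σ + 1) := by rw [hA]; field_simp
        have g6 : 0 < M * (R ^ σ * R ^ (-(2 * s))) := by positivity
        have g7 : c1 * A * (M * (R ^ σ * R ^ (-(2 * s)))) =
          (72 * c1 + 2592 * (Lam * C1 n s σ + 1)) * (M * (R ^ σ * R ^ (-(2 * s)))) := by rw [g5]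
        have g8 : 0 < 72 * c1 * (M * (R ^ σ * R ^ (-(2 * s)))) := by positivity
        rw [hB']
        nlinarith
      · have := hs1.2.sub hs2.2
        simp only [add_zero] at this
        exact this
    · exfalso
      have b1 := (abs_le.1 hb).2
      rw [show x + h - x = h by abel] at b1
      have : M * R ^ (σ - ε) * ‖h‖ ^ ε ≤ A' * ‖h‖ ^ ε := by
        rw [hA']
        gcongr
        have : M * 1 ≤ M * A := by gcongr; linarith
        linarith
      linarith

theorem DL {n : ℕ} {s σ ε lam Lam : ℝ} (hn : 0 < n) (hs : s ∈ Ioo (0 : ℝ) 1) (hσ0 : 0 < σ)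
    (hσ : σ < 2 * s) (hε : ε ∈ Ioo (0 : ℝ) 1) (hε2 : ε ≤ 2 * s) (hlam : 0 < lam)
    (hlL : lam ≤ Lam) :
    ∃ A > 0, ∀ (a : En n → ℝ), KernelBounds lam Lam a →
    ∀ (u : ℝ → En n → ℝ) (x0 : En n) (R M tb : ℝ), 0 < R → 0 < M →
    ContinuousOn (fun p : ℝ × En n => u p.1 p.2) (Icc (tb - R ^ (2 * s)) tb ×ˢ univ) →
    (∀ t ∈ Icc (tb - R ^ (2 * s)) tb, ∀ x, |u t x| ≤ M * (R + ‖x - x0‖) ^ σ) →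
    (∀ t ∈ Icc (tb - R ^ (2 * s)) tb, ∀ x z, ‖x - x0‖ ≤ R / 2 → ‖z - x0‖ ≤ R / 2 →
      (SolvesAt n s a u (fun _ _ => 0) t x ∧ SolvesAt n s a u (fun _ _ => 0) t z) ∨
      |u t x - u t z| ≤ M * R ^ (σ - ε) * ‖x - z‖ ^ ε) →
    ∀ h : En n, ‖h‖ ≤ R / 4 → |u tb (x0 + h) - u tb x0| ≤ A * M * R ^ (σ - ε) * ‖h‖ ^ ε := by
  obtain ⟨A, hA, H⟩ := DL1 (n := n) hn hs hσ0 hσ hε hε2 hlam hlL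
  refine ⟨A, hA, ?_⟩
  intro a ha u x0 R M tb hR hM hu hbd halt h hh
  have h1 := H a ha u x0 R M tb hR hM hu hbd halt h hh
  have h2 := H a ha (fun t x => - u t x) x0 R M tb hR hM hu.neg
    (fun t ht x => by rw [abs_neg]; exact hbd t ht x) (by
      intro t ht x z hx hz
      rcases halt t ht x z hx hz with ⟨k1, k2⟩ | k
      · exact Or.inl ⟨k1.neg', k2.neg'⟩
      · right
        rw [show - u t x - - u t z = -(u t x - u t z) by ring, abs_neg]; exact k) h hh
  rw [abs_le]; constructor <;> linarith

theorem Ltouch {n : ℕ} {s σ lam Lam : ℝ} (hn : 0 < n) (hs : s ∈ Ioo (0 : ℝ) 1) (hσ0 : 0 < σ)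
    (hσ : σ < 2 * s) (hlam : 0 < lam) {a : En n → ℝ} (ha : KernelBounds lam Lam a)
    {f : En n → ℝ} {x : En n} {R B : ℝ} (hR : 0 < R) (hB : 0 ≤ B)
    (hi : Integrable (Lintegrand n s a f x))
    (h : ∀ y, DD f x y ≤ B * mm σ (‖y‖ / R)) :
    Lop n s a f x ≤ B * Lam * C1 n s σ * R ^ (-(2 * s)) := by
  obtain ⟨hmi, hme⟩ := mmR_int (n := n) (R := R) hn hs hσ0 hσ hR
  have : Lop n s a f x ≤ ∫ y, B * Lam * (mm σ (‖y‖ / R) * JJ n s y) := by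
    apply integral_mono hi (hmi.const_mul _)
    intro y
    simp only
    by_cases hy : y = 0
    · subst hy
      have h00 : mm σ 0 = 0 := by simp [mm]
      simp [Lintegrand_eq, DD_zero, h00]
    obtain ⟨ha1, ha2⟩ := KB ha hy
    have hm0 : 0 ≤ mm σ (‖y‖ / R) := mm_nonneg (by positivity)
    have hJ := JJ_nonneg (n := n) (s := s) y
    rw [Lintegrand_eq]
    calc DD f x y * a (‖y‖⁻¹ • y) * JJ n s y
        ≤ (B * mm σ (‖y‖ / R)) * a (‖y‖⁻¹ • y) * JJ n s y := by
          have : 0 ≤ a (‖y‖⁻¹ • y) := by linarith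
          gcongr; exact h y
      _ ≤ (B * mm σ (‖y‖ / R)) * Lam * JJ n s y := by gcongr
      _ = _ := by ring
  rw [integral_const_mul, hme] at this
  linarith

theorem TL {n : ℕ} {s σ ε lam Lam : ℝ} (hn : 0 < n) (hs : s ∈ Ioo (0 : ℝ) 1) (hσ0 : 0 < σ)
    (hσ : σ < 2 * s) (hε : 0 < ε) (hεσ : ε ≤ σ) (hlam : 0 < lam) (hlL : lam ≤ Lam)
    {a : En n → ℝ} (ha : KernelBounds lam Lam a)
    (u : ℝ → En n → ℝ) (x0 : En n) (R H M t0 t1 : ℝ) (hR : 1 ≤ R) (hH : 0 ≤ H) (hM : 0 < M)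
    (ht : t0 ≤ t1) (ht' : t1 ≤ t0 + 1)
    (hu : ContinuousOn (fun p : ℝ × En n => u p.1 p.2) (Icc t0 t1 ×ˢ univ))
    (hbd : ∀ t ∈ Icc t0 t1, ∀ x, |u t x| ≤ M * (R + ‖x - x0‖) ^ σ)
    (hhol : ∀ t ∈ Icc t0 t1, ∀ x, ‖x - x0‖ ≤ R / 4 → |u t x - u t x0| ≤ H * ‖x - x0‖ ^ ε)
    (hbdry : ∀ t ∈ Icc t0 t1, ∀ x, lastC x ≤ 0 → u t x = 0)
    (hsol : ∀ t ∈ Icc t0 t1, ∀ x, 0 < lastC x → SolvesAt n s a u (fun _ _ => 0) t x) :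
    u t1 x0 - u t0 x0 ≤ (Lam * C1 n s σ + 2) * (H + 50 * M) := by
  have hC1 := C1_nonneg (n := n) (s := s) (σ := σ)
  have hσ2 : σ ≤ 2 := by linarith [hs.2]
  have hLam : 0 < Lam := by linarith
  set H' := H + 50 * M with hH'
  have hH'0 : 0 < H' := by positivity
  have hpsX : ∀ X : ℝ, 0 ≤ X → X ^ σ ≤ 1 + psi σ X := by
    intro X hX
    rcases le_total X 1 with h1 | h1
    · have := psi_nonneg (σ := σ) hX
      have := Real.rpow_le_one hX h1 hσ0.le
      linarith
    · rw [psi_of_ge_one hσ2 h1]; linarith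
  have hpsE : ∀ X : ℝ, 0 ≤ X → X ^ ε ≤ 1 + psi σ X := by
    intro X hX
    rcases le_total X 1 with h1 | h1
    · have := psi_nonneg (σ := σ) hX
      have := Real.rpow_le_one hX h1 hε.le
      linarith
    · rw [psi_of_ge_one hσ2 h1]
      have := Real.rpow_le_rpow_of_exponent_le h1 hεσ
      linarith
  have ht0m : t0 ∈ Icc t0 t1 := ⟨le_rfl, ht⟩
  have hfar : ∀ t ∈ Icc t0 t1, ∀ x, R / 4 < ‖x - x0‖ → u t x - u t0 x0 ≤
      H' * (1 + psi σ (‖x - x0‖)) := by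
    intro t htt x hx
    have b1 := (abs_le.1 (hbd t htt x)).2
    have b2 := (abs_le.1 (hbd t0 ht0m x0)).1
    rw [sub_self, norm_zero, add_zero] at b2
    have b3 : (R + ‖x - x0‖) ^ σ ≤ 5 ^ 2 * ‖x - x0‖ ^ σ := by
      refine le_trans ?_ (rpow_sigma_le hσ0 hσ2 (by norm_num) (norm_nonneg _))
      gcongr; linarith
    have b4 : R ^ σ ≤ 5 ^ 2 * ‖x - x0‖ ^ σ := by
      refine le_trans ?_ (rpow_sigma_le hσ0 hσ2 (by norm_num) (norm_nonneg _))
      gcongr; linarith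
    have b5 := mul_le_mul_of_nonneg_left b3 hM.le
    have b6 := mul_le_mul_of_nonneg_left b4 hM.le
    have b7 := mul_le_mul_of_nonneg_left (hpsX _ (norm_nonneg (x - x0))) hM.le
    have b8 := mul_nonneg hH (add_nonneg zero_le_one (psi_nonneg (σ := σ) (norm_nonneg (x - x0))))
    rw [hH']; linarith
  have hini : ∀ x, u t0 x - u t0 x0 ≤ H' * (1 + psi σ (‖x - x0‖)) := by
    intro x
    by_cases hx : R / 4 < ‖x - x0‖
    · exact hfar t0 ht0m x hx
    · push Not at hx
      have b1 := (abs_le.1 (hhol t0 ht0m x hx)).2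
      have b2 := mul_le_mul_of_nonneg_left (hpsE _ (norm_nonneg (x - x0))) hH
      have b8 := mul_nonneg hM.le (add_nonneg zero_le_one (psi_nonneg (σ := σ) (norm_nonneg (x - x0))))
      rw [hH']; linarith
  set c := H' * (Lam * C1 n s σ + 1) with hc
  have hc0 : 0 < c := by positivity
  have hmain := MAX (Y := En n) u (fun x => u t0 x0 + H' * (1 + psi σ (‖x - x0‖))) t0 t1 c
    univ (closedBall x0 (R / 4)) (isCompact_closedBall _ _) (subset_univ _) hu ?_ ?_ ?_ ?_
  · have := hmain t1 ⟨ht, le_rfl⟩ x0 (mem_univ _)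
    simp only [sub_self, norm_zero, psi_zero hσ0] at this
    have h2 : c * (t1 - t0) ≤ c * 1 := by gcongr; linarith
    rw [hc] at h2 this
    linarith
  · have h1 := psi_cont hσ0
    fun_prop
  · intro t htt x _ hx
    have := hfar t htt x (by simpa [dist_eq_norm] using hx)
    have h3 : 0 ≤ c * (t - t0) := mul_nonneg hc0.le (by linarith [htt.1])
    linarith
  · intro x _
    have := hini x
    linarith
  · intro t htt x hxK hpos hmx
    simp only [mem_closedBall, dist_eq_norm] at hxK
    have htI : t ∈ Icc t0 t1 := ⟨htt.1.le, htt.2⟩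
    have h3 : 0 ≤ c * (t - t0) := mul_nonneg hc0.le (by linarith [htt.1])
    have hX1 : ‖x - x0‖ ≤ 1 := by
      by_contra hcon
      push Not at hcon
      have k1 := hmx x0 (mem_univ _)
      simp only [sub_self, norm_zero, psi_zero hσ0] at k1
      rw [psi_of_ge_one hσ2 hcon.le] at k1
      have k2 := (abs_le.1 (hhol t htI x hxK)).2
      have k3 := Real.rpow_le_rpow_of_exponent_le hcon.le hεσ
      have k4 : 0 < ‖x - x0‖ ^ σ := Real.rpow_pos_of_pos (by linarith) _
      have k5 := mul_le_mul_of_nonneg_left k3 hH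
      have k6 : 0 < M * ‖x - x0‖ ^ σ := by positivity
      rw [hH'] at k1
      linarith
    have hxn : 0 < lastC x := by
      by_contra hcon
      push Not at hcon
      have := hini x
      rw [hbdry t0 ht0m x hcon] at this
      rw [hbdry t htI x hcon] at hpos
      linarith
    obtain ⟨hi, hd⟩ := hsol t htI x hxn
    rw [add_zero] at hd
    refine ⟨_, ?_, hd⟩
    have := Ltouch (R := 1) (B := H') hn hs hσ0 hσ hlam ha one_pos hH'0.le hi (by
      intro y
      have q1 := hmx (x + y) (mem_univ _)
      have q2 := hmx (x - y) (mem_univ _)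
      have q3 := DD_psi hσ0 hσ2 one_pos x0 x y hX1
      simp only [div_one] at q3 ⊢
      have q4 := mul_le_mul_of_nonneg_left q3 hH'0.le
      simp only [DD]
      linarith)
    rw [Real.one_rpow] at this
    rw [hc]; linarith


/-- power with cut-off -/
def pw (s x : ℝ) : ℝ := if 0 < x then x ^ (s - 1) else 0

theorem pw_meas {s : ℝ} : Measurable (pw s) := by
  unfold pw
  exact Measurable.ite measurableSet_Ioi (by fun_prop) measurable_const

theorem pw_nonneg {s x : ℝ} : 0 ≤ pw s x := by
  unfold pw; split_ifs with h
  · exact Real.rpow_nonneg h.le _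
  · exact le_rfl

/-- the odd difference of `x_+^{s-1}` -/
def ee (s X ρ : ℝ) : ℝ := pw s (X + ρ) - pw s (X - ρ)

theorem ee_meas {s X : ℝ} : Measurable (ee s X) := by
  unfold ee
  exact (pw_meas.comp (by fun_prop)).sub (pw_meas.comp (by fun_prop))

theorem ee_small {s ρ : ℝ} (hs : s ∈ Ioo (0 : ℝ) 1) (h0 : 0 < ρ) (h1 : ρ ≤ 1 / 2) :
    |ee s 1 ρ| ≤ 3 * ρ := by
  unfold ee pw
  rw [if_pos (by linarith), if_pos (by linarith)]
  have a1 : 1 - ρ ≤ (1 + ρ) ^ (s - 1) := by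
    calc 1 - ρ ≤ (1 + ρ) ^ (-1 : ℝ) := by
          rw [Real.rpow_neg_one, inv_eq_one_div, le_div_iff₀ (by linarith)]; nlinarith
      _ ≤ _ := Real.rpow_le_rpow_of_exponent_le (by linarith) (by linarith [hs.1])
  have a2 : (1 + ρ) ^ (s - 1) ≤ 1 := Real.rpow_le_one_of_one_le_of_nonpos (by linarith) (by linarith [hs.2])
  have a3 : (1 - ρ) ^ (s - 1) ≤ 1 + 2 * ρ := by
    calc (1 - ρ) ^ (s - 1) ≤ (1 - ρ) ^ (-1 : ℝ) :=
          Real.rpow_le_rpow_of_exponent_ge (by linarith) (by linarith) (by linarith [hs.1])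
      _ ≤ _ := by
          rw [Real.rpow_neg_one, inv_eq_one_div, div_le_iff₀ (by linarith)]; nlinarith
  have a4 : 1 ≤ (1 - ρ) ^ (s - 1) := Real.one_le_rpow_of_pos_of_le_one_of_nonpos (by linarith) (by linarith) (by linarith [hs.2])
  rw [abs_le]; constructor <;> linarith

theorem pw_int {s : ℝ} (hs : s ∈ Ioo (0 : ℝ) 1) {δ : ℝ} (hδ : 0 < δ) :
    IntegrableOn (fun ρ => pw s (1 - ρ) * ρ ^ (-2 * s)) (Ioi δ) := by
  have h1 : IntegrableOn (fun ρ : ℝ => pw s (1 - ρ)) (Ioi δ) := by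
    have h2 : IntegrableOn (fun x : ℝ => x ^ (s - 1)) (Ioc 0 1) := by
      have := (intervalIntegral.intervalIntegrable_rpow' (a := 0) (b := 1) (r := s - 1)
        (by linarith [hs.1]))
      rwa [intervalIntegrable_iff_integrableOn_Ioc_of_le zero_le_one] at this
    have h3 : Integrable ((Ioc (0 : ℝ) 1).indicator (fun x : ℝ => x ^ (s - 1))) :=
      h2.integrable_indicator measurableSet_Ioc
    have h4 := (h3.comp_sub_left 1).integrableOn (s := Ioi δ)
    refine h4.congr_fun ?_ measurableSet_Ioi
    intro ρ hρ
    have hρ' : δ < ρ := hρ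
    simp only [pw, indicator]
    by_cases h : 0 < 1 - ρ
    · rw [if_pos ⟨h, by linarith⟩, if_pos h]
    · rw [if_neg (fun hh => h hh.1), if_neg h]
  refine Integrable.mono' (h1.norm.const_mul (δ ^ (-2 * s))) ?_ ?_
  · exact ((pw_meas.comp (by fun_prop)).mul (by fun_prop)).aestronglyMeasurable
  · filter_upwards [ae_restrict_mem measurableSet_Ioi] with ρ hρ
    have hρ' : δ < ρ := hρ
    rw [norm_mul, mul_comm]
    gcongr
    rw [Real.norm_of_nonneg (by have : 0 < ρ := by linarith
                                positivity)]
    exact Real.rpow_le_rpow_of_nonpos hδ hρ'.le (by linarith [hs.1])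

theorem pwp_int {s : ℝ} (hs : s ∈ Ioo (0 : ℝ) 1) {δ : ℝ} (hδ : 0 < δ) :
    IntegrableOn (fun ρ => pw s (1 + ρ) * ρ ^ (-2 * s)) (Ioi δ) := by
  have h : IntegrableOn (fun r : ℝ => r ^ (- 1 - s)) (Ioi δ) :=
    integrableOn_Ioi_rpow_of_lt (by linarith [hs.1]) hδ
  refine Integrable.mono' h ?_ ?_
  · exact ((pw_meas.comp (by fun_prop)).mul (by fun_prop)).aestronglyMeasurable
  · filter_upwards [ae_restrict_mem measurableSet_Ioi] with ρ hρ
    have hρ' : 0 < ρ := hδ.trans hρ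
    rw [norm_mul, Real.norm_of_nonneg pw_nonneg, Real.norm_of_nonneg (by positivity), pw,
      if_pos (show (0:ℝ) < 1 + ρ by linarith)]
    calc (1 + ρ) ^ (s - 1) * ρ ^ (-2 * s) ≤ ρ ^ (s - 1) * ρ ^ (-2 * s) := by
          refine mul_le_mul_of_nonneg_right ?_ (Real.rpow_nonneg hρ'.le _)
          exact Real.rpow_le_rpow_of_nonpos hρ' (by linarith) (by linarith [hs.2])
      _ = _ := by rw [← Real.rpow_add hρ']; congr 1; ring

theorem ee_int {s : ℝ} (hs : s ∈ Ioo (0 : ℝ) 1) :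
    IntegrableOn (fun ρ => ee s 1 ρ * ρ ^ (-2 * s)) (Ioi 0) := by
  have h1 : IntegrableOn (fun ρ => ee s 1 ρ * ρ ^ (-2 * s)) (Ioc 0 (1 / 2)) := by
    have h : IntegrableOn (fun r : ℝ => 3 * r ^ (1 - 2 * s)) (Ioc 0 (1 / 2)) := by
      apply Integrable.const_mul
      have := (intervalIntegral.intervalIntegrable_rpow' (a := 0) (b := 1 / 2) (r := 1 - 2 * s)
        (by linarith [hs.2]))
      rwa [intervalIntegrable_iff_integrableOn_Ioc_of_le (by norm_num)] at this
    refine Integrable.mono' h ?_ ?_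
    · exact (ee_meas.mul (by fun_prop)).aestronglyMeasurable
    · filter_upwards [ae_restrict_mem measurableSet_Ioc] with r hr
      have hr0 : 0 < r := hr.1
      rw [norm_mul, Real.norm_of_nonneg (Real.rpow_nonneg hr0.le _), Real.norm_eq_abs]
      calc |ee s 1 r| * r ^ (-2 * s) ≤ (3 * r) * r ^ (-2 * s) := by
            gcongr; exact ee_small hs hr0 hr.2
        _ = 3 * r ^ (1 - 2 * s) := by
            rw [mul_assoc]; nth_rw 1 [← Real.rpow_one r]; rw [← Real.rpow_add hr0]; congr 2; ring
  have h2 : IntegrableOn (fun ρ => ee s 1 ρ * ρ ^ (-2 * s)) (Ioi (1 / 2)) := by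
    have := (pwp_int hs (δ := 1 / 2) (by norm_num)).sub (pw_int hs (δ := 1 / 2) (by norm_num))
    refine this.congr_fun (fun ρ _ => ?_) measurableSet_Ioi
    simp only [ee, Pi.sub_apply]; ring
  have : Ioi (0 : ℝ) = Ioc 0 (1 / 2) ∪ Ioi (1 / 2) := by
    rw [Ioc_union_Ioi_eq_Ioi (by norm_num)]
  rw [this]; exact h1.union h2

/-- the inversion substitution -/
theorem subst_C {s : ℝ} {δ : ℝ} (hδ : 0 < δ) :
    ∫ ρ in Ioi δ, pw s (1 + ρ) * ρ ^ (-2 * s) =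
    ∫ u in Ioi (δ / (1 + δ)), pw s (1 - u) * u ^ (-2 * s) := by
  have himg : (fun ρ : ℝ => ρ / (1 + ρ)) '' Ioi δ = Ioo (δ / (1 + δ)) 1 := by
    ext u
    simp only [mem_image, mem_Ioi, mem_Ioo]
    constructor
    · rintro ⟨ρ, hρ, rfl⟩
      refine ⟨?_, ?_⟩
      · rw [div_lt_div_iff₀ (by linarith) (by linarith)]; nlinarith
      · rw [div_lt_one (by linarith)]; linarith
    · rintro ⟨h1, h2⟩
      refine ⟨u / (1 - u), ?_, ?_⟩
      · rw [lt_div_iff₀ (by linarith)]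
        rw [div_lt_iff₀ (by linarith)] at h1; nlinarith
      · have : 1 - u ≠ 0 := by linarith
        have : 1 + u / (1 - u) = 1 / (1 - u) := by field_simp; ring
        rw [this]; field_simp
  have hcv := integral_image_eq_integral_abs_deriv_smul (s := Ioi δ)
    (f := fun ρ : ℝ => ρ / (1 + ρ)) (f' := fun ρ => 1 / (1 + ρ) ^ 2) measurableSet_Ioi
    (by
      intro x hx
      have hx' : δ < x := hx
      have h1 := (hasDerivAt_id x).div ((hasDerivAt_id x).const_add 1) (by simp only [id]; linarith)
      have : (1 * (1 + id x) - id x * 1) / (1 + id x) ^ 2 = 1 / (1 + x) ^ 2 := by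
        simp only [id]; ring
      rw [this] at h1
      exact h1.hasDerivWithinAt)
    (by
      intro x hx y hy hxy
      have hx' : δ < x := hx
      have hy' : δ < y := hy
      simp only at hxy
      rw [div_eq_div_iff (by linarith) (by linarith)] at hxy
      linarith)
    (fun u => pw s (1 - u) * u ^ (-2 * s))
  rw [himg] at hcv
  have e1 : ∫ u in Ioi (δ / (1 + δ)), pw s (1 - u) * u ^ (-2 * s) =
      ∫ u in Ioo (δ / (1 + δ)) 1, pw s (1 - u) * u ^ (-2 * s) := by
    refine setIntegral_eq_of_subset_of_forall_sdiff_eq_zero measurableSet_Ioi Ioo_subset_Ioi_self ?_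
    rintro u ⟨hu1, hu2⟩
    have hu : ¬ (0 < 1 - u) := fun h => hu2 ⟨hu1, by linarith⟩
    simp [pw, hu]
  rw [e1, hcv]
  refine setIntegral_congr_fun measurableSet_Ioi ?_
  intro ρ hρ
  have hρ0 : 0 < ρ := hδ.trans hρ
  have h1 : 0 < 1 + ρ := by linarith
  have e : 1 - ρ / (1 + ρ) = (1 + ρ)⁻¹ := by field_simp; ring
  simp only [smul_eq_mul]
  rw [e, pw, pw, if_pos h1, if_pos (by positivity), abs_of_pos (by positivity),
    Real.inv_rpow h1.le, ← Real.rpow_neg h1.le, Real.div_rpow hρ0.le h1.le, one_div,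
    ← Real.rpow_natCast, ← Real.rpow_neg h1.le, div_eq_mul_inv, ← Real.rpow_neg h1.le]
  have : (1 + ρ) ^ (s - 1) = (1 + ρ) ^ (-((2 : ℕ) : ℝ)) * ((1 + ρ) ^ (-(s - 1)) * (1 + ρ) ^ (-(-2 * s))) := by
    rw [← Real.rpow_add h1, ← Real.rpow_add h1]; congr 1; push_cast; ring
  rw [this]; ring

theorem factC1 {s : ℝ} (hs : s ∈ Ioo (0 : ℝ) 1) :
    ∫ ρ in Ioi 0, ee s 1 ρ * ρ ^ (-2 * s) = 0 := by
  set δ : ℕ → ℝ := fun m => 1 / ((m : ℝ) + 2) with hδ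
  have hδ0 : ∀ m, 0 < δ m := fun m => by simp only [hδ]; positivity
  have hδ2 : ∀ m, δ m ≤ 1 / 2 := fun m => by
    simp only [hδ]
    exact one_div_le_one_div_of_le (by norm_num) (by have : (0:ℝ) ≤ m := by positivity
                                                     linarith)
  have hδt : Tendsto δ atTop (𝓝 0) := by
    have := tendsto_one_div_add_atTop_nhds_zero_nat (𝕜 := ℝ)
    have h2 := (tendsto_add_atTop_iff_nat 1).2 this
    refine h2.congr (fun m => ?_)
    simp only [hδ]; push_cast; ring
  have hcov : AECover (volume.restrict (Ioi (0 : ℝ))) atTop (fun m => Ioi (δ m)) :=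
    aecover_Ioi_of_Ioi hδt
  have hlim := hcov.integral_tendsto_of_countably_generated (ee_int hs)
  have hval : ∀ m, ‖∫ ρ in Ioi (δ m), ee s 1 ρ * ρ ^ (-2 * s) ∂(volume.restrict (Ioi 0))‖ ≤
      (4 * 4) * (δ m) ^ (2 - 2 * s) := by
    intro m
    have d0 := hδ0 m
    have d2 := hδ2 m
    set d := δ m with hd
    have hss : Ioi d ⊆ Ioi 0 := Ioi_subset_Ioi d0.le
    rw [Measure.restrict_restrict measurableSet_Ioi, inter_eq_left.2 hss]
    have e1 : ∫ ρ in Ioi d, ee s 1 ρ * ρ ^ (-2 * s) =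
        ∫ ρ in Ioc (d / (1 + d)) d, pw s (1 - ρ) * ρ ^ (-2 * s) := by
      have i1 : ∫ ρ in Ioi d, ee s 1 ρ * ρ ^ (-2 * s) =
          ∫ ρ in Ioi d, (pw s (1 + ρ) * ρ ^ (-2 * s) - pw s (1 - ρ) * ρ ^ (-2 * s)) := by
        congr 1; funext ρ; simp only [ee]; ring
      have hle : d / (1 + d) ≤ d := by rw [div_le_iff₀ (by linarith)]; nlinarith
      have hd' : 0 < d / (1 + d) := by positivity
      rw [i1, integral_sub (pwp_int hs d0) (pw_int hs d0), subst_C d0,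
        ← Ioc_union_Ioi_eq_Ioi hle, setIntegral_union (Ioc_disjoint_Ioi le_rfl) measurableSet_Ioi
          ((pw_int hs hd').mono_set Ioc_subset_Ioi_self) (pw_int hs d0)]
      ring
    rw [e1]
    have hd' : 0 < d / (1 + d) := by positivity
    have hhalf : d / 2 ≤ d / (1 + d) := by gcongr; linarith
    have hb : ∀ ρ ∈ Ioc (d / (1 + d)) d, ‖pw s (1 - ρ) * ρ ^ (-2 * s)‖ ≤ 4 * (4 * d ^ (-2 * s)) := by
      intro ρ hρ
      have hρ0 : 0 < ρ := hd'.trans hρ.1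
      rw [norm_mul, Real.norm_of_nonneg pw_nonneg, Real.norm_of_nonneg (by positivity)]
      have g1 : pw s (1 - ρ) ≤ 4 := by
        rw [pw, if_pos (by linarith [hρ.2])]
        calc (1 - ρ) ^ (s - 1) ≤ (1 - ρ) ^ (-1 : ℝ) :=
              Real.rpow_le_rpow_of_exponent_ge (by linarith [hρ.2]) (by linarith) (by linarith [hs.1])
          _ ≤ _ := by
              rw [Real.rpow_neg_one, inv_eq_one_div, div_le_iff₀ (by linarith [hρ.2])]
              linarith [hρ.2]
      have g2 : ρ ^ (-2 * s) ≤ 4 * d ^ (-2 * s) := by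
        calc ρ ^ (-2 * s) ≤ (d / 2) ^ (-2 * s) :=
              Real.rpow_le_rpow_of_nonpos (by linarith) (by linarith [hρ.1]) (by linarith [hs.1])
          _ = (2 : ℝ) ^ (2 * s) * d ^ (-2 * s) := by
              rw [Real.div_rpow d0.le (by norm_num), div_eq_mul_inv, ← Real.rpow_neg (by norm_num)]
              rw [mul_comm]; congr 2; ring
          _ ≤ _ := by
              gcongr
              have := Real.rpow_le_rpow_of_exponent_le (by norm_num : (1:ℝ) ≤ 2) (by push_cast; linarith [hs.2] : 2 * s ≤ (2:ℕ))
              rw [Real.rpow_natCast] at this; linarith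
      gcongr
    have := norm_setIntegral_le_of_norm_le_const (μ := volume) (s := Ioc (d / (1 + d)) d)
      (by simp) hb
    refine this.trans ?_
    rw [Real.volume_real_Ioc_of_le (by rw [div_le_iff₀ (by linarith)]; nlinarith)]
    have g3 : d - d / (1 + d) ≤ d ^ 2 := by
      have : d - d / (1 + d) = d ^ 2 / (1 + d) := by field_simp; ring
      rw [this, div_le_iff₀ (by linarith)]; nlinarith [sq_nonneg d, d0]
    calc 4 * (4 * d ^ (-2 * s)) * (d - d / (1 + d)) ≤ 4 * (4 * d ^ (-2 * s)) * d ^ 2 := by gcongr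
      _ = _ := by
        rw [show 2 - 2 * s = -2 * s + (2 : ℕ) by push_cast; ring, Real.rpow_add d0, Real.rpow_natCast]
        ring
  have hz : Tendsto (fun m => (4 * 4) * (δ m) ^ (2 - 2 * s)) atTop (𝓝 0) := by
    have h1 : Tendsto (fun x : ℝ => x ^ (2 - 2 * s)) (𝓝 0) (𝓝 0) := by
      have := (Real.continuous_rpow_const (by linarith [hs.2] : 0 ≤ 2 - 2 * s)).tendsto 0
      rwa [Real.zero_rpow (by linarith [hs.2])] at this
    simpa using (h1.comp hδt).const_mul (4 * 4)
  exact tendsto_nhds_unique hlim (squeeze_zero_norm hval hz)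

theorem ee_scale {s X ρ : ℝ} (hX : 0 < X) : ee s X (X * ρ) = X ^ (s - 1) * ee s 1 ρ := by
  have key : ∀ z, pw s (X * z) = X ^ (s - 1) * pw s z := by
    intro z
    unfold pw
    by_cases hz : 0 < z
    · rw [if_pos hz, if_pos (by positivity), Real.mul_rpow hX.le hz.le]
    · rw [if_neg hz, if_neg (by rw [mul_pos_iff_of_pos_left hX]; exact hz), mul_zero]
  unfold ee
  rw [show X + X * ρ = X * (1 + ρ) by ring, show X - X * ρ = X * (1 - ρ) by ring, key, key]; ring

theorem ee_scale' {s X ρ : ℝ} (hX : 0 < X) (hρ : 0 < ρ) :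
    ee s X (X * ρ) * (X * ρ) ^ (-2 * s) = X ^ (-1 - s) * (ee s 1 ρ * ρ ^ (-2 * s)) := by
  rw [ee_scale hX, Real.mul_rpow hX.le hρ.le,
    show (-1 - s) = (s - 1) + (-2 * s) by ring, Real.rpow_add hX]; ring

theorem ee_scale_int {s : ℝ} (hs : s ∈ Ioo (0 : ℝ) 1) {X : ℝ} (hX : 0 < X) :
    IntegrableOn (fun ρ => ee s X ρ * ρ ^ (-2 * s)) (Ioi 0) := by
  have := (integrableOn_Ioi_comp_mul_left_iff (fun ρ => ee s X ρ * ρ ^ (-2 * s)) 0 hX)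
  rw [mul_zero] at this
  rw [← this]
  refine IntegrableOn.congr_fun ((ee_int hs).const_mul (X ^ (-1 - s))) ?_ measurableSet_Ioi
  intro ρ hρ
  exact (ee_scale' hX hρ).symm

theorem factC {s : ℝ} (hs : s ∈ Ioo (0 : ℝ) 1) {X : ℝ} (hX : 0 < X) :
    ∫ ρ in Ioi 0, ee s X ρ * ρ ^ (-2 * s) = 0 := by
  have := integral_comp_mul_left_Ioi (fun ρ => ee s X ρ * ρ ^ (-2 * s)) 0 hX
  rw [mul_zero, setIntegral_congr_fun measurableSet_Ioi
    (fun ρ hρ => ee_scale' hX hρ), integral_const_mul, factC1 hs, mul_zero] at this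
  have hXi : X⁻¹ ≠ 0 := by positivity
  rw [smul_eq_mul] at this
  exact (mul_eq_zero.1 this.symm).resolve_left hXi

theorem factC_norm {s : ℝ} {X : ℝ} (hX : 0 < X) :
    ∫ ρ in Ioi 0, ‖ee s X ρ * ρ ^ (-2 * s)‖ =
      X ^ (-s) * ∫ ρ in Ioi 0, ‖ee s 1 ρ * ρ ^ (-2 * s)‖ := by
  have := integral_comp_mul_left_Ioi (fun ρ => ‖ee s X ρ * ρ ^ (-2 * s)‖) 0 hX
  have h2 : ∀ ρ ∈ Ioi (0:ℝ), ‖ee s X (X * ρ) * (X * ρ) ^ (-2 * s)‖ = X ^ (-1 - s) * ‖ee s 1 ρ * ρ ^ (-2 * s)‖ := by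
    intro ρ hρ
    rw [ee_scale' hX hρ, norm_mul (X ^ (-1 - s)), Real.norm_of_nonneg (by positivity)]
  rw [mul_zero, setIntegral_congr_fun measurableSet_Ioi h2, integral_const_mul, smul_eq_mul] at this
  rw [show -s = 1 + (-1 - s) by ring, Real.rpow_add hX, Real.rpow_one, mul_assoc, this]
  field_simp


/-- positive part power -/
def gs (s x : ℝ) : ℝ := max x 0 ^ s

theorem gs_cont {s : ℝ} (hs : 0 < s) : Continuous (gs s) := by
  unfold gs
  exact (by fun_prop : Continuous fun x : ℝ => max x 0).rpow_const (fun x => Or.inr hs.le)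

theorem gs_nonneg {s x : ℝ} : 0 ≤ gs s x := Real.rpow_nonneg (le_max_right _ _) _

theorem gs_pos {s x : ℝ} (hx : 0 ≤ x) : gs s x = x ^ s := by rw [gs, max_eq_left hx]

theorem gs_neg {s x : ℝ} (hs : 0 < s) (hx : x ≤ 0) : gs s x = 0 := by
  rw [gs, max_eq_right hx, Real.zero_rpow hs.ne']

theorem gs_mono {s x y : ℝ} (hs : 0 < s) (h : x ≤ y) : gs s x ≤ gs s y :=
  Real.rpow_le_rpow (le_max_right _ _) (max_le_max_right _ h) hs.le

theorem pw_ii {s : ℝ} (hs : 0 < s) (a b : ℝ) : IntervalIntegrable (pw s) volume a b := by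
  have h := (intervalIntegral.intervalIntegrable_rpow' (a := a) (b := b) (r := s - 1)
        (by linarith))
  rw [intervalIntegrable_iff] at h ⊢
  have h2 := Integrable.indicator h (measurableSet_Ioi (a := (0:ℝ)))
  refine h2.congr (Eventually.of_forall fun x => ?_)
  simp only [indicator, pw, mem_Ioi]

theorem gs_ftc {s : ℝ} (hs : 0 < s) (a b : ℝ) :
    ∫ x in a..b, s * pw s x = gs s b - gs s a := by
  refine integral_eq_of_hasDerivAt_off_countable (gs s) _ (countable_singleton (0:ℝ))
    (gs_cont hs).continuousOn ?_ ((pw_ii hs a b).const_mul s)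
  rintro x ⟨_, hx0⟩
  have hx0 : x ≠ 0 := hx0
  rcases lt_or_gt_of_ne hx0 with h | h
  · have : pw s x = 0 := by simp [pw, not_lt.2 h.le]
    rw [this, mul_zero]
    refine (hasDerivAt_const x (0:ℝ)).congr_of_eventuallyEq ?_
    filter_upwards [Iio_mem_nhds h] with y hy
    exact gs_neg hs (le_of_lt hy)
  · have : pw s x = x ^ (s - 1) := by simp [pw, h]
    rw [this]
    refine (Real.hasDerivAt_rpow_const (Or.inl hx0)).congr_of_eventuallyEq ?_
    filter_upwards [Ioi_mem_nhds h] with y hy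
    exact gs_pos (le_of_lt hy)

theorem FUB {s : ℝ} (hs : 0 < s) (e : ℝ → ℝ) (he : Measurable e)
    (hi : IntegrableOn (fun u => e u * u ^ (-2 * s)) (Ioi 0)) :
    IntegrableOn (fun ρ => (∫ u in Ioo 0 ρ, e u) * ρ ^ (-1 - 2 * s)) (Ioi 0) ∧
    ∫ ρ in Ioi 0, (∫ u in Ioo 0 ρ, e u) * ρ ^ (-1 - 2 * s) =
      (2 * s)⁻¹ * ∫ u in Ioi 0, e u * u ^ (-2 * s) := by
  set μ : Measure ℝ := volume.restrict (Ioi 0) with hμ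
  set F : ℝ × ℝ → ℝ := fun p => if p.1 < p.2 then e p.1 * p.2 ^ (-1 - 2 * s) else 0 with hF
  have hFm : Measurable F :=
    Measurable.ite (measurableSet_lt measurable_fst measurable_snd)
      ((he.comp measurable_fst).mul (by fun_prop)) measurable_const
  have sl : ∀ u > 0, ∀ c : ℝ, ∫ ρ, (if u < ρ then c * ρ ^ (-1 - 2 * s) else 0) ∂μ = (2 * s)⁻¹ * (c * u ^ (-2 * s)) ∧
      Integrable (fun ρ => if u < ρ then c * ρ ^ (-1 - 2 * s) else 0) μ := by
    intro u hu c
    have e0 : (fun ρ : ℝ => if u < ρ then c * ρ ^ (-1 - 2 * s) else 0) =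
      (Ioi u).indicator (fun ρ => c * ρ ^ (-1 - 2 * s)) := by
      funext ρ; simp only [indicator, mem_Ioi]
    have hii : IntegrableOn (fun ρ : ℝ => c * ρ ^ (-1 - 2 * s)) (Ioi u) :=
      (integrableOn_Ioi_rpow_of_lt (by linarith) hu).const_mul c
    rw [e0]
    constructor
    · rw [hμ, setIntegral_indicator measurableSet_Ioi, inter_eq_right.2 (Ioi_subset_Ioi hu.le),
        integral_const_mul, integral_Ioi_rpow_of_lt (by linarith) hu]
      rw [show -1 - 2 * s + 1 = -2 * s by ring]
      field_simp
    · exact (hii.integrable_indicator measurableSet_Ioi).mono_measure Measure.restrict_le_self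
  have hFi : Integrable F (μ.prod μ) := by
    rw [integrable_prod_iff hFm.aestronglyMeasurable]
    constructor
    · filter_upwards [ae_restrict_mem measurableSet_Ioi] with u hu
      exact (sl u hu (e u)).2
    · refine (hi.norm.const_mul ((2 * s)⁻¹)).congr ?_
      filter_upwards [ae_restrict_mem measurableSet_Ioi] with u hu
      have hu0 : 0 < u := hu
      have h1 := (sl u hu ‖e u‖).1
      rw [norm_mul, Real.norm_of_nonneg (Real.rpow_nonneg hu0.le _), ← h1]
      refine setIntegral_congr_fun measurableSet_Ioi fun ρ hρ => ?_
      have hρ0 : 0 < ρ := hρ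
      simp only [hF]
      split_ifs
      · rw [norm_mul, Real.norm_of_nonneg (Real.rpow_nonneg hρ0.le (-1 - 2 * s))]
      · simp
  have e2 : ∀ ρ ∈ Ioi (0:ℝ), ∫ u, F (u, ρ) ∂μ = (∫ u in Ioo 0 ρ, e u) * ρ ^ (-1 - 2 * s) := by
    intro ρ hρ
    rw [← integral_mul_const]
    have e0 : (fun u : ℝ => F (u, ρ)) =
      (Iio ρ).indicator (fun u => e u * ρ ^ (-1 - 2 * s)) := by
      funext u; simp only [hF, indicator, mem_Iio]
    rw [e0, hμ, setIntegral_indicator measurableSet_Iio]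
    rfl
  constructor
  · refine hFi.integral_prod_right.congr ?_
    filter_upwards [ae_restrict_mem measurableSet_Ioi] with ρ hρ
    exact e2 ρ hρ
  · rw [← setIntegral_congr_fun measurableSet_Ioi e2]
    have := integral_integral_swap (f := fun u ρ => F (u, ρ)) hFi
    rw [hμ] at this ⊢
    rw [← this, ← integral_const_mul]
    refine setIntegral_congr_fun measurableSet_Ioi fun u hu => ?_
    exact (sl u hu (e u)).1

/-- one-dimensional second difference -/
def d1 (g : ℝ → ℝ) (X ρ : ℝ) : ℝ := g (X + ρ) + g (X - ρ) - 2 * g X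
/-- integrability of the one-dimensional fractional operator -/
def Int1 (s : ℝ) (g : ℝ → ℝ) (X : ℝ) : Prop := IntegrableOn (fun ρ => d1 g X ρ * ρ ^ (-1 - 2 * s)) (Ioi 0)
/-- the one-dimensional fractional operator -/
def L1 (s : ℝ) (g : ℝ → ℝ) (X : ℝ) : ℝ := ∫ ρ in Ioi 0, d1 g X ρ * ρ ^ (-1 - 2 * s)

theorem d1_gs {s : ℝ} (hs : 0 < s) {X ρ : ℝ} (hρ : 0 < ρ) :
    ∫ u in Ioo 0 ρ, s * ee s X u = d1 (gs s) X ρ := by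
  rw [← integral_Ioc_eq_integral_Ioo, ← intervalIntegral.integral_of_le hρ.le]
  have h1 := intervalIntegral.integral_comp_add_left (a := 0) (b := ρ) (fun x => s * pw s x) X
  have h2 := intervalIntegral.integral_comp_sub_left (a := 0) (b := ρ) (fun x => s * pw s x) X
  rw [gs_ftc hs] at h1 h2
  have i1 : IntervalIntegrable (fun u => s * pw s (X + u)) volume 0 ρ := by
    have := ((pw_ii hs (X + 0) (X + ρ)).const_mul s).comp_add_left X
    simpa using this
  have i2 : IntervalIntegrable (fun u => s * pw s (X - u)) volume 0 ρ := by
    have := ((pw_ii hs (X - 0) (X - ρ)).const_mul s).comp_sub_left X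
    simpa using this
  have h3 := intervalIntegral.integral_sub i1 i2
  simp only [ee, mul_sub]
  rw [h3, h1, h2, d1]
  simp only [add_zero, sub_zero]; ring

theorem factA {s : ℝ} (hs : s ∈ Ioo (0:ℝ) 1) {X : ℝ} (hX : 0 < X) :
    Int1 s (gs s) X ∧ L1 s (gs s) X = 0 := by
  have h := FUB hs.1 (fun u => s * ee s X u) (ee_meas.const_mul s)
    (by have := (ee_scale_int hs hX).const_mul s
        refine this.congr (Eventually.of_forall fun u => ?_)
        simp only; ring)
  have e2 : ∀ ρ ∈ Ioi (0:ℝ), (∫ u in Ioo 0 ρ, s * ee s X u) * ρ ^ (-1 - 2 * s) =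
      d1 (gs s) X ρ * ρ ^ (-1 - 2 * s) := fun ρ hρ => by rw [d1_gs hs.1 hρ]
  constructor
  · exact h.1.congr_fun e2 measurableSet_Ioi
  · rw [L1, ← setIntegral_congr_fun measurableSet_Ioi e2, h.2]
    simp only [mul_assoc]
    rw [integral_const_mul, factC hs hX]; simp

/-- increments of `gs` -/
def qk (s k x : ℝ) : ℝ := gs s (x + k) - gs s x

theorem qk_cont {s k : ℝ} (hs : 0 < s) : Continuous (qk s k) := by
  unfold qk
  exact ((gs_cont hs).comp (by fun_prop)).sub (gs_cont hs)

theorem qk_nonneg {s k x : ℝ} (hs : 0 < s) (hk : 0 ≤ k) : 0 ≤ qk s k x := by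
  have := gs_mono hs (by linarith : x ≤ x + k)
  unfold qk; linarith

theorem Int1.comb {s X : ℝ} {g f : ℝ → ℝ} (c d : ℝ) (hg : Int1 s g X) (hf : Int1 s f X) :
    Int1 s (fun x => c * g x + d * f x) X ∧ L1 s (fun x => c * g x + d * f x) X = c * L1 s g X + d * L1 s f X := by
  have e : (fun ρ => d1 (fun x => c * g x + d * f x) X ρ * ρ ^ (-1 - 2 * s)) =
    fun ρ => c * (d1 g X ρ * ρ ^ (-1 - 2 * s)) + d * (d1 f X ρ * ρ ^ (-1 - 2 * s)) := by
    funext ρ; simp only [d1]; ring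
  unfold Int1 L1
  rw [e]
  refine ⟨(hg.const_mul c).add (hf.const_mul d), ?_⟩
  rw [integral_add (hg.const_mul c) (hf.const_mul d), integral_const_mul, integral_const_mul]

theorem Int1.shift {s X k : ℝ} {g : ℝ → ℝ} (hg : Int1 s g (X + k)) :
    Int1 s (fun x => g (x + k)) X ∧ L1 s (fun x => g (x + k)) X = L1 s g (X + k) := by
  have e : (fun ρ => d1 (fun x => g (x + k)) X ρ * ρ ^ (-1 - 2 * s)) =
    fun ρ => (d1 g (X + k) ρ * ρ ^ (-1 - 2 * s)) := by
    funext ρ; simp only [d1]; rw [show X + ρ + k = X + k + ρ by ring, show X - ρ + k = X + k - ρ by ring]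
  unfold Int1 L1
  rw [e]; exact ⟨hg, rfl⟩

theorem factAq {s : ℝ} (hs : s ∈ Ioo (0:ℝ) 1) {X k : ℝ} (hX : 0 < X) (hk : 0 ≤ k) :
    Int1 s (qk s k) X ∧ L1 s (qk s k) X = 0 := by
  have h1 := factA hs (by linarith : 0 < X + k)
  have h2 := h1.1.shift
  have h3 := factA hs hX
  have h4 := h2.1.comb 1 (-1) h3.1
  have : (fun x => 1 * gs s (x + k) + -1 * gs s x) = qk s k := by funext x; simp only [qk]; ring
  rw [this] at h4
  refine ⟨h4.1, ?_⟩
  rw [h4.2, h2.2, h1.2, h3.2]; ring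

theorem qk_int {s k : ℝ} (hs : 0 < s) (hk : 0 ≤ k) (Z : ℝ) :
    ∫ κ in Ioc 0 k, s * pw s (Z + κ) = qk s k Z := by
  rw [← intervalIntegral.integral_of_le hk,
    intervalIntegral.integral_comp_add_left (fun x => s * pw s x) Z, gs_ftc hs, add_zero, qk]

theorem pw_shift_int {s k : ℝ} (hs : 0 < s) (hk : 0 ≤ k) (Z : ℝ) :
    IntegrableOn (fun κ => s * pw s (Z + κ)) (Ioc 0 k) := by
  have := ((pw_ii hs (Z + 0) (Z + k)).const_mul s).comp_add_left Z
  simp only [add_sub_cancel_left] at this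
  rwa [intervalIntegrable_iff_integrableOn_Ioc_of_le hk] at this

theorem factB {s : ℝ} (hs : s ∈ Ioo (0:ℝ) 1) {X k : ℝ} (hX : 0 < X) (hk : 0 ≤ k) :
    IntegrableOn (fun ρ => (qk s k (X + ρ) - qk s k (X - ρ)) * ρ ^ (-2 * s)) (Ioi 0) ∧
    ∫ ρ in Ioi 0, (qk s k (X + ρ) - qk s k (X - ρ)) * ρ ^ (-2 * s) = 0 := by
  set μ : Measure ℝ := volume.restrict (Ioi 0) with hμ
  set ν : Measure ℝ := volume.restrict (Ioc 0 k) with hν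
  set F : ℝ × ℝ → ℝ := fun p => s * (ee s (X + p.1) p.2 * p.2 ^ (-2 * s)) with hF
  have hFm : Measurable F := by
    refine Measurable.const_mul (Measurable.mul ?_ (by fun_prop)) s
    unfold ee
    exact (pw_meas.comp (by fun_prop)).sub (pw_meas.comp (by fun_prop))
  have hFi : Integrable F (ν.prod μ) := by
    rw [integrable_prod_iff hFm.aestronglyMeasurable]
    constructor
    · filter_upwards [ae_restrict_mem measurableSet_Ioc] with κ hκ
      exact (ee_scale_int hs (by linarith [hκ.1] : 0 < X + κ)).const_mul s
    · have hc : IntegrableOn (fun κ : ℝ => s * ((X + κ) ^ (-s) * ∫ ρ in Ioi 0, ‖ee s 1 ρ * ρ ^ (-2 * s)‖)) (Ioc 0 k) := by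
        apply (ContinuousOn.integrableOn_Icc (a := 0) (b := k) ?_).mono_set Ioc_subset_Icc_self
        apply ContinuousOn.mul continuousOn_const
        apply ContinuousOn.mul _ continuousOn_const
        apply ContinuousOn.rpow_const (by fun_prop)
        intro κ hκ; left; linarith [hκ.1]
      refine hc.congr ?_
      filter_upwards [ae_restrict_mem measurableSet_Ioc] with κ hκ
      rw [← factC_norm (by linarith [hκ.1] : 0 < X + κ), ← integral_const_mul]
      simp only [hF]
      congr 1; funext ρ
      rw [norm_mul s, Real.norm_of_nonneg hs.1.le]
  have e2 : ∀ ρ : ℝ, ∫ κ, F (κ, ρ) ∂ν = (qk s k (X + ρ) - qk s k (X - ρ)) * ρ ^ (-2 * s) := by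
    intro ρ
    rw [← qk_int hs.1 hk, ← qk_int hs.1 hk, ← integral_sub (pw_shift_int hs.1 hk _) (pw_shift_int hs.1 hk _),
      ← integral_mul_const]
    congr 1; funext κ
    simp only [hF, ee]
    rw [show X + κ + ρ = X + ρ + κ by ring, show X + κ - ρ = X - ρ + κ by ring]; ring
  constructor
  · have := hFi.integral_prod_right
    simp only [e2] at this
    exact this
  · simp only [← e2]
    have := integral_integral_swap (f := fun u ρ => F (u, ρ)) hFi
    rw [← this]
    have h0 : ∀ κ ∈ Ioc 0 k, ∫ ρ, F (κ, ρ) ∂μ = 0 := by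
      intro κ hκ
      simp only [hF]
      rw [integral_const_mul, hμ, factC hs (by linarith [hκ.1] : 0 < X + κ), mul_zero]
    rw [hν, setIntegral_congr_fun measurableSet_Ioc h0]; simp


/-- unit sphere -/
abbrev Sp (n : ℕ) := sphere (0 : En n) 1
/-- surface measure -/
def sm (n : ℕ) : Measure (Sp n) := (volume : Measure (En n)).toSphere

instance (n : ℕ) : IsFiniteMeasure (sm n) := by unfold sm; infer_instance

/-- product polar measure -/
def pm (n : ℕ) : Measure (Sp n × ℝ) := (sm n).prod (volume.restrict (Ioi 0))

theorem POL {n : ℕ} (hn : 0 < n) (F : En n → ℝ) :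
    (Integrable F ↔ Integrable (fun p : Sp n × ℝ => p.2 ^ (n - 1) * F (p.2 • (p.1 : En n))) (pm n)) ∧
    ∫ y, F y = ∫ p, p.2 ^ (n - 1) * F (p.2 • (p.1 : En n)) ∂(pm n) := by
  have : Nontrivial (En n) := by
    have : Nonempty (Fin n) := ⟨⟨0, hn⟩⟩
    infer_instance
  set ν : Measure (Ioi (0:ℝ)) := .comap Subtype.val volume with hν
  have : SFinite ν := by
    have : ν = Measure.volumeIoiPow 0 := by
      rw [Measure.volumeIoiPow]; simp [hν]
    rw [this]; infer_instance
  set κ : Sp n × Ioi (0:ℝ) → Sp n × ℝ := Prod.map id Subtype.val with hκ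
  have hκe : MeasurableEmbedding κ := MeasurableEmbedding.id.prodMap (MeasurableEmbedding.subtype_coe measurableSet_Ioi)
  have hmap : ((sm n).prod ν).map κ = pm n := by
    rw [hκ, ← Measure.map_prod_map _ _ measurable_id measurable_subtype_coe, Measure.map_id, hν,
      map_comap_subtype_coe measurableSet_Ioi]
    rfl
  have hdim : Module.finrank ℝ (En n) = n := by simp
  have hmp := (volume : Measure (En n)).measurePreserving_homeomorphUnitSphereProd
  rw [hdim] at hmp
  have he := (homeomorphUnitSphereProd (En n)).measurableEmbedding
  have hm0 : MeasurableSet ({0}ᶜ : Set (En n)) := (measurableSet_singleton _).compl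
  have hden : (sm n).prod (Measure.volumeIoiPow (n - 1)) =
      ((sm n).prod ν).withDensity (fun p => ENNReal.ofReal (p.2.1 ^ (n - 1))) := by
    rw [Measure.volumeIoiPow, prod_withDensity_right (by fun_prop)]
  have hF : ∀ y : ({0}ᶜ : Set (En n)), F y = F ((homeomorphUnitSphereProd (En n) y).2.1 •
      ((homeomorphUnitSphereProd (En n) y).1 : En n)) := by
    intro y
    congr 1
    have : ((homeomorphUnitSphereProd (En n)).symm (homeomorphUnitSphereProd (En n) y)) = y := by simp
    conv_lhs => rw [← this]
    rw [homeomorphUnitSphereProd_symm_apply_coe]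
  set G : Sp n × Ioi (0:ℝ) → ℝ := fun p => F (p.2.1 • (p.1 : En n)) with hG
  have hFG : (fun y : ({0}ᶜ : Set (En n)) => F y) = G ∘ homeomorphUnitSphereProd (En n) := by
    funext y; exact hF y
  have hr : (volume : Measure (En n)).restrict {0}ᶜ = volume := by
    rw [Measure.restrict_eq_self_of_ae_mem]
    simp [ae_iff]
  have hmapv : (Measure.comap (Subtype.val : ({0}ᶜ : Set (En n)) → En n) volume).map Subtype.val = volume := by
    rw [map_comap_subtype_coe hm0, hr]
  have hve := MeasurableEmbedding.subtype_coe hm0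
  constructor
  · rw [← hmapv, hve.integrable_map_iff, ← hmap, hκe.integrable_map_iff]
    have : (F ∘ Subtype.val : ({0}ᶜ : Set (En n)) → ℝ) = G ∘ homeomorphUnitSphereProd (En n) := hFG
    rw [this, hmp.integrable_comp_emb he]
    change Integrable G ((sm n).prod (Measure.volumeIoiPow (n - 1))) ↔ _
    rw [hden, integrable_withDensity_iff_integrable_smul' (by fun_prop) (by simp)]
    apply iff_of_eq; congr 1
    funext p
    simp only [hκ, hG, Function.comp, Prod.map, id, smul_eq_mul]
    rw [ENNReal.toReal_ofReal (pow_nonneg (le_of_lt p.2.2) _)]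
  · rw [← hmapv, hve.integral_map, ← hmap, hκe.integral_map, hFG]
    have e := hmp.integral_comp he G
    simp only [Function.comp_def]
    rw [e]
    change ∫ p, G p ∂((sm n).prod (Measure.volumeIoiPow (n - 1))) = _
    rw [hden, integral_withDensity_eq_integral_toReal_smul (by fun_prop) (by simp)]
    congr 1
    funext p
    simp only [hκ, hG, Prod.map, id, smul_eq_mul]
    rw [ENNReal.toReal_ofReal (pow_nonneg (le_of_lt p.2.2) _)]


theorem pm_ae {n : ℕ} : ∀ᵐ p ∂(pm n), 0 < p.2 := by
  have : ∀ᵐ r ∂(volume.restrict (Ioi (0:ℝ))), 0 < r := ae_restrict_mem measurableSet_Ioi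
  exact Measure.quasiMeasurePreserving_snd.ae this

theorem Sp_norm {n : ℕ} (θ : Sp n) : ‖(θ : En n)‖ = 1 := by simp

theorem polar_pt {n : ℕ} (hn : 0 < n) {s r : ℝ} (hr : 0 < r) (f a : En n → ℝ) (θ : Sp n) :
    r ^ (n - 1) * (f (r • (θ : En n)) * a (‖r • (θ : En n)‖⁻¹ • r • (θ : En n)) * JJ n s (r • (θ : En n))) =
    f (r • (θ : En n)) * a θ * r ^ (-1 - 2 * s) := by
  have h1 : ‖r • (θ : En n)‖ = r := by rw [norm_smul, Sp_norm, mul_one, Real.norm_of_nonneg hr.le]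
  have h2 : r⁻¹ • r • (θ : En n) = θ := by rw [smul_smul, inv_mul_cancel₀ hr.ne', one_smul]
  unfold JJ
  rw [h1, h2, ← Real.rpow_neg hr.le, ← Real.rpow_natCast r (n - 1), Nat.cast_sub hn, Nat.cast_one,
    show -1 - 2 * s = ((n:ℝ) - 1) + -((n:ℝ) + 2 * s) by ring, Real.rpow_add hr]
  ring

theorem POLK {n : ℕ} (hn : 0 < n) {s : ℝ} (f a : En n → ℝ) :
    (Integrable (fun y => f y * a (‖y‖⁻¹ • y) * JJ n s y) ↔
      Integrable (fun p : Sp n × ℝ => f (p.2 • (p.1 : En n)) * a p.1 * p.2 ^ (-1 - 2 * s)) (pm n)) ∧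
    ∫ y, f y * a (‖y‖⁻¹ • y) * JJ n s y =
      ∫ p, f (p.2 • (p.1 : En n)) * a p.1 * p.2 ^ (-1 - 2 * s) ∂(pm n) := by
  have h := POL hn (fun y => f y * a (‖y‖⁻¹ • y) * JJ n s y)
  have e : (fun p : Sp n × ℝ => p.2 ^ (n - 1) * (f (p.2 • (p.1 : En n)) *
      a (‖p.2 • (p.1 : En n)‖⁻¹ • p.2 • (p.1 : En n)) * JJ n s (p.2 • (p.1 : En n)))) =ᵐ[pm n]
      fun p => f (p.2 • (p.1 : En n)) * a p.1 * p.2 ^ (-1 - 2 * s) := by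
    filter_upwards [pm_ae] with p hp
    exact polar_pt hn hp f a p.1
  rw [integrable_congr e, integral_congr_ae e] at h
  exact h

theorem RAD {s : ℝ} (hs : 0 < s) (φ : ℝ → ℝ) (hev : ∀ r, φ (-r) = φ r) (h0 : φ 0 = 0)
    (hi : IntegrableOn (fun ρ => φ ρ * ρ ^ (-1 - 2 * s)) (Ioi 0)) (c : ℝ) :
    IntegrableOn (fun r => φ (r * c) * r ^ (-1 - 2 * s)) (Ioi 0) ∧
    ∫ r in Ioi 0, φ (r * c) * r ^ (-1 - 2 * s) = |c| ^ (2 * s) * ∫ ρ in Ioi 0, φ ρ * ρ ^ (-1 - 2 * s) := by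
  rcases eq_or_ne c 0 with rfl | hc
  · simp only [mul_zero, h0, zero_mul, abs_zero]
    rw [Real.zero_rpow (by linarith)]; simp
  have hc' : 0 < |c| := abs_pos.2 hc
  have e : ∀ r ∈ Ioi (0:ℝ), φ (r * c) * r ^ (-1 - 2 * s) =
      |c| ^ (1 + 2 * s) * (φ (|c| * r) * (|c| * r) ^ (-1 - 2 * s)) := by
    intro r hr
    have hr0 : 0 < r := hr
    have h1 : φ (|c| * r) = φ (r * c) := by
      rcases abs_choice c with h | h <;> rw [h]
      · rw [mul_comm]
      · rw [← hev]; congr 1; ring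
    rw [h1, Real.mul_rpow hc'.le hr0.le]
    have : |c| ^ (1 + 2 * s) * |c| ^ (-1 - 2 * s) = 1 := by
      rw [← Real.rpow_add hc']; norm_num
    linear_combination (-(φ (r * c) * r ^ (-1 - 2 * s))) * this
  have i1 := (integrableOn_Ioi_comp_mul_left_iff (fun ρ => φ ρ * ρ ^ (-1 - 2 * s)) 0 hc')
  rw [mul_zero] at i1
  have i2 := integral_comp_mul_left_Ioi (fun ρ => φ ρ * ρ ^ (-1 - 2 * s)) 0 hc'
  rw [mul_zero] at i2
  constructor
  · refine IntegrableOn.congr_fun ((i1.2 hi).const_mul (|c| ^ (1 + 2 * s))) (fun r hr => (e r hr).symm) measurableSet_Ioi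
  · rw [setIntegral_congr_fun measurableSet_Ioi e, integral_const_mul, i2, smul_eq_mul, ← mul_assoc]
    congr 1
    rw [Real.rpow_add hc', Real.rpow_one]; field_simp

theorem lastC_smul_sp {n : ℕ} (r : ℝ) (θ : En n) : lastC (r • θ) = r * lastC θ := by
  rw [lastC_smul]

/-- the angular constant -/
def ca (n : ℕ) (s : ℝ) (a : En n → ℝ) : ℝ := ∫ θ : Sp n, a θ * |lastC (θ : En n)| ^ (2 * s) ∂(sm n)

/-- angular measurability -/
def AM (n : ℕ) (a : En n → ℝ) : Prop := AEStronglyMeasurable (fun θ : Sp n => a θ) (sm n)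

theorem SLG {n : ℕ} (hn : 0 < n) {s lam Lam : ℝ} (hs : 0 < s) {a : En n → ℝ} (hlam : 0 < lam) (ha : KernelBounds lam Lam a)
    (ham : AM n a) (φ : ℝ → ℝ) (hφ : Measurable φ) (hev : ∀ r, φ (-r) = φ r) (h0 : φ 0 = 0)
    (hi : IntegrableOn (fun ρ => φ ρ * ρ ^ (-1 - 2 * s)) (Ioi 0)) :
    Integrable (fun y => φ (lastC y) * a (‖y‖⁻¹ • y) * JJ n s y) ∧
    ∫ y, φ (lastC y) * a (‖y‖⁻¹ • y) * JJ n s y = ca n s a * ∫ ρ in Ioi 0, φ ρ * ρ ^ (-1 - 2 * s) := by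
  have h := POLK hn (s := s) (fun y => φ (lastC y)) a
  have hr : ∀ θ : Sp n, _ := fun θ => RAD hs φ hev h0 hi (lastC (θ : En n))
  have hi' : IntegrableOn (fun ρ => |φ ρ| * ρ ^ (-1 - 2 * s)) (Ioi 0) := by
    refine IntegrableOn.congr_fun hi.norm (fun r hr => ?_) measurableSet_Ioi
    have hr0 : 0 < r := hr
    simp only [norm_mul, Real.norm_eq_abs]
    rw [abs_of_nonneg (Real.rpow_nonneg hr0.le _)]
  have hr2 : ∀ θ : Sp n, _ := fun θ => RAD hs (fun r => |φ r|) (fun r => by simp only [hev]) (by simp only [h0, abs_zero]) hi' (lastC (θ : En n))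
  have hlm : Measurable (fun θ : Sp n => lastC (θ : En n)) := (continuous_lastC.comp continuous_subtype_val).measurable
  have hIntg : Integrable (fun p : Sp n × ℝ => φ (lastC (p.2 • (p.1 : En n))) * a p.1 * p.2 ^ (-1 - 2 * s)) (pm n) := by
    have hmeas : AEStronglyMeasurable (fun p : Sp n × ℝ => φ (lastC (p.2 • (p.1 : En n))) * a p.1 * p.2 ^ (-1 - 2 * s)) (pm n) := by
      refine AEStronglyMeasurable.mul (AEStronglyMeasurable.mul ?_ ?_) ?_
      · refine (hφ.comp ?_).aestronglyMeasurable
        simp only [lastC_smul]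
        exact measurable_snd.mul (hlm.comp measurable_fst)
      · exact ham.comp_quasiMeasurePreserving Measure.quasiMeasurePreserving_fst
      · exact (by fun_prop : Measurable fun p : Sp n × ℝ => p.2 ^ (-1 - 2 * s)).aestronglyMeasurable
    rw [pm, integrable_prod_iff hmeas]
    constructor
    · refine Eventually.of_forall fun θ => ?_
      have := (hr θ).1.const_mul (a θ)
      refine this.congr (Eventually.of_forall fun r => ?_)
      simp only [lastC_smul]; ring
    · have hb : Integrable (fun θ : Sp n => |a θ| * |lastC (θ : En n)| ^ (2 * s) * ∫ ρ in Ioi 0, |φ ρ| * ρ ^ (-1 - 2 * s)) (sm n) := by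
        apply Integrable.mul_const
        refine Integrable.mono' (integrable_const (Lam)) ?_ ?_
        · exact (ham.norm).mul ((hlm.abs.pow_const _).aestronglyMeasurable)
        · refine Eventually.of_forall fun θ => ?_
          have h1 := ha θ (Sp_norm θ)
          have h2 : |lastC (θ : En n)| ≤ 1 := (abs_lastC_le _).trans (Sp_norm θ).le
          have h3 : |lastC (θ : En n)| ^ (2 * s) ≤ 1 := Real.rpow_le_one (abs_nonneg _) h2 (by linarith)
          have h4 : 0 ≤ |lastC (θ : En n)| ^ (2 * s) := Real.rpow_nonneg (abs_nonneg _) _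
          rw [Real.norm_of_nonneg (by positivity), abs_of_pos (by linarith)]
          nlinarith
      refine hb.congr (Eventually.of_forall fun θ => ?_)
      simp only
      rw [mul_assoc, ← (hr2 θ).2, ← integral_const_mul]
      refine setIntegral_congr_fun measurableSet_Ioi fun r hr => ?_
      have hr0 : 0 < r := hr
      simp only [norm_mul, Real.norm_eq_abs, lastC_smul]
      rw [abs_of_nonneg (Real.rpow_nonneg hr0.le _)]; ring
  refine ⟨h.1.2 hIntg, ?_⟩
  rw [h.2, pm, integral_prod _ hIntg, ca, ← integral_mul_const]
  congr 1; funext θ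
  rw [mul_assoc, ← (hr θ).2, ← integral_const_mul]
  congr 1; funext r
  simp only [lastC_smul]; ring

theorem d1_even {g : ℝ → ℝ} {X : ℝ} (r : ℝ) : d1 g X (-r) = d1 g X r := by
  unfold d1; rw [← sub_eq_add_neg, sub_neg_eq_add]; ring

theorem SLI {n : ℕ} (hn : 0 < n) {s lam Lam : ℝ} (hs : 0 < s) {a : En n → ℝ} (hlam : 0 < lam) (ha : KernelBounds lam Lam a)
    (ham : AM n a) (g : ℝ → ℝ) (hg : Measurable g) (x : En n) (hi : Int1 s g (lastC x)) :
    Integrable (Lintegrand n s a (fun z => g (lastC z)) x) ∧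
    Lop n s a (fun z => g (lastC z)) x = ca n s a * L1 s g (lastC x) := by
  have h := SLG hn hs hlam ha ham (d1 g (lastC x)) (by
    unfold d1
    exact ((hg.comp (by fun_prop)).add (hg.comp (by fun_prop))).sub_const _) d1_even
    (by simp [d1]; ring) hi
  have e : Lintegrand n s a (fun z => g (lastC z)) x = fun y => d1 g (lastC x) (lastC y) * a (‖y‖⁻¹ • y) * JJ n s y := by
    funext y; rw [Lintegrand_eq]; simp only [DD, d1, lastC_add, lastC_sub]
  unfold Lop
  rw [e]; exact h

theorem sm_pos {n : ℕ} (hn : 0 < n) : 0 < sm n {θ : Sp n | lastC (θ : En n) ≠ 0} := by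
  have : IsOpen {θ : Sp n | lastC (θ : En n) ≠ 0} :=
    isOpen_ne_fun (continuous_lastC.comp continuous_subtype_val) continuous_const
  unfold sm
  refine this.measure_pos _ ⟨⟨eLast n, by simp [norm_eLast hn]⟩, ?_⟩
  simp [lastC_eLast hn]

theorem ca_pos {n : ℕ} (hn : 0 < n) {s lam Lam : ℝ} (hs : 0 < s) {a : En n → ℝ} (hlam : 0 < lam) (ha : KernelBounds lam Lam a)
    (ham : AM n a) : 0 < ca n s a := by
  have hlm : Measurable (fun θ : Sp n => lastC (θ : En n)) := (continuous_lastC.comp continuous_subtype_val).measurable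
  have hpos : ∀ θ : Sp n, 0 < a θ := fun θ => hlam.trans_le (ha θ (Sp_norm θ)).1
  unfold ca
  rw [integral_pos_iff_support_of_nonneg]
  · refine (sm_pos hn).trans_le (measure_mono fun θ hθ => ?_)
    have hθ : lastC (θ : En n) ≠ 0 := hθ
    have := hpos θ
    have h2 := abs_pos.2 hθ
    simp only [Function.mem_support]; positivity
  · intro θ
    have := hpos θ
    simp only [Pi.zero_apply]; positivity
  · refine Integrable.mono' (integrable_const (Lam)) ?_ ?_
    · exact (ham).mul ((hlm.abs.pow_const _).aestronglyMeasurable)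
    · refine Eventually.of_forall fun θ => ?_
      have h1 := ha θ (Sp_norm θ)
      have h2 : |lastC (θ : En n)| ≤ 1 := (abs_lastC_le _).trans (Sp_norm θ).le
      have h3 : |lastC (θ : En n)| ^ (2 * s) ≤ 1 := Real.rpow_le_one (abs_nonneg _) h2 (by linarith)
      have h4 : 0 ≤ |lastC (θ : En n)| ^ (2 * s) := Real.rpow_nonneg (abs_nonneg _) _
      have := hpos θ
      rw [Real.norm_of_nonneg (by positivity)]
      nlinarith


theorem AMEAS1 {n : ℕ} (hn : 0 < n) {s : ℝ} {a f : En n → ℝ} (hf : Continuous f)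
    (hi : Integrable (fun y => f y * a (‖y‖⁻¹ • y) * JJ n s y)) (θ0 : Sp n) (r0 : ℝ) (hr0 : 0 < r0)
    (hne : f (r0 • (θ0 : En n)) ≠ 0) :
    ∃ U : Set (Sp n), IsOpen U ∧ θ0 ∈ U ∧ AEStronglyMeasurable (fun θ : Sp n => a θ) ((sm n).restrict U) := by
  have h := (POLK hn f a).1.1 hi
  have hs := Integrable.prod_left_ae h
  have hs2 : ∀ᵐ r ∂(volume : Measure ℝ), r ∈ Ioi (0:ℝ) → Integrable (fun θ : Sp n => f (r • (θ : En n)) * a θ * r ^ (-1 - 2 * s)) (sm n) :=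
    (ae_restrict_iff' measurableSet_Ioi).1 hs
  have hopen : IsOpen {r : ℝ | 0 < r ∧ f (r • (θ0 : En n)) ≠ 0} := by
    refine IsOpen.inter (isOpen_lt continuous_const continuous_id) ?_
    exact isOpen_ne_fun (hf.comp (by fun_prop)) continuous_const
  have hpos : volume {r : ℝ | 0 < r ∧ f (r • (θ0 : En n)) ≠ 0} ≠ 0 :=
    (hopen.measure_pos _ ⟨r0, hr0, hne⟩).ne'
  obtain ⟨r, ⟨hr, hfr⟩, hri⟩ : ∃ r, r ∈ {r : ℝ | 0 < r ∧ f (r • (θ0 : En n)) ≠ 0} ∧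
      (r ∈ Ioi (0:ℝ) → Integrable (fun θ : Sp n => f (r • (θ : En n)) * a θ * r ^ (-1 - 2 * s)) (sm n)) := by
    by_contra hcon
    push Not at hcon
    apply hpos
    refine measure_mono_null ?_ hs2
    intro r hr
    have := hcon r hr
    simp only [mem_compl_iff]
    intro hh
    exact this.2 (hh this.1)
  have hri := hri hr
  have hfc : Continuous (fun θ : Sp n => f (r • (θ : En n))) := hf.comp (by fun_prop)
  refine ⟨{θ : Sp n | f (r • (θ : En n)) ≠ 0}, isOpen_ne_fun hfc continuous_const, hfr, ?_⟩
  have hm : AEStronglyMeasurable (fun θ : Sp n => (f (r • (θ : En n)) * r ^ (-1 - 2 * s))⁻¹ *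
      (f (r • (θ : En n)) * a θ * r ^ (-1 - 2 * s))) (sm n) :=
    AEStronglyMeasurable.mul ((hfc.mul continuous_const).measurable.inv.aestronglyMeasurable) hri.1
  refine hm.restrict.congr ?_
  filter_upwards [ae_restrict_mem (isOpen_ne_fun hfc continuous_const).measurableSet] with θ hθ
  have hθ : f (r • (θ : En n)) ≠ 0 := hθ
  have : r ^ (-1 - 2 * s) ≠ 0 := (Real.rpow_pos_of_pos hr _).ne'
  field_simp

theorem AMEAS {n : ℕ} (hn : 0 < n) {s lam Lam : ℝ} {a : En n → ℝ} (hlL : lam ≤ Lam) (ha : KernelBounds lam Lam a) :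
    ∃ a', KernelBounds lam Lam a' ∧ AM n a' ∧ ∀ u x, Continuous u → Integrable (Lintegrand n s a u x) →
      Lintegrand n s a' u x = Lintegrand n s a u x := by
  classical
  set 𝓤 : Set (Set (Sp n)) := {U | IsOpen U ∧ AEStronglyMeasurable (fun θ : Sp n => a θ) ((sm n).restrict U)} with h𝓤
  obtain ⟨T, hTc, hTs, hTu⟩ := TopologicalSpace.isOpen_sUnion_countable 𝓤 (fun U hU => hU.1)
  set O := ⋃₀ 𝓤 with hO
  have hOo : IsOpen O := isOpen_sUnion fun U hU => hU.1
  have hOm : AEStronglyMeasurable (fun θ : Sp n => a θ) ((sm n).restrict O) := by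
    have hc : Countable T := hTc.to_subtype
    rw [← hTu, sUnion_eq_iUnion, aestronglyMeasurable_iUnion_iff]
    exact fun U => (hTs U.2).2
  set a' : En n → ℝ := fun y => if h : y ∈ (Subtype.val '' O) then a y else lam with ha'
  have haO : ∀ θ : Sp n, θ ∈ O → a' θ = a θ := fun θ hθ => by
    simp only [ha']; rw [dif_pos (mem_image_of_mem _ hθ)]
  have haO' : ∀ θ : Sp n, θ ∉ O → a' θ = lam := fun θ hθ => by
    simp only [ha']; rw [dif_neg]
    rintro ⟨θ', h1, h2⟩
    exact hθ (Subtype.ext h2 ▸ h1)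
  refine ⟨a', ?_, ?_, ?_⟩
  · intro y hy
    simp only [ha']; split_ifs
    · exact ha y hy
    · exact ⟨le_rfl, hlL⟩
  · have : AEStronglyMeasurable (O.indicator (fun θ : Sp n => a θ) + Oᶜ.indicator (fun _ => lam)) (sm n) := by
      refine AEStronglyMeasurable.add ?_ ?_
      · rw [aestronglyMeasurable_indicator_iff hOo.measurableSet]; exact hOm
      · exact aestronglyMeasurable_const.indicator hOo.measurableSet.compl
    refine this.congr (Eventually.of_forall fun θ => ?_)
    by_cases h : θ ∈ O
    · simp [h, haO θ h]
    · simp [h, haO' θ h]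
  · intro u x hu hi
    funext y
    rw [Lintegrand_eq, Lintegrand_eq]
    rcases eq_or_ne y 0 with rfl | hy
    · simp [DD_zero]
    have hy' : 0 < ‖y‖ := norm_pos_iff.2 hy
    set θ : Sp n := ⟨‖y‖⁻¹ • y, by simp [norm_smul, hy'.ne']⟩ with hθ
    have hyθ : ‖y‖ • (θ : En n) = y := by
      simp only [hθ]; rw [smul_smul, mul_inv_cancel₀ hy'.ne', one_smul]
    by_cases h : DD u x y = 0
    · rw [h]; ring
    · have hD : Continuous (DD u x) := by
        unfold DD; exact ((hu.comp (by fun_prop)).add (hu.comp (by fun_prop))).sub continuous_const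
      have e : Lintegrand n s a u x = fun y => DD u x y * a (‖y‖⁻¹ • y) * JJ n s y := by
        funext y; rw [Lintegrand_eq]
      rw [e] at hi
      obtain ⟨U, hU1, hU2, hU3⟩ := AMEAS1 hn hD hi θ ‖y‖ hy' (by rw [hyθ]; exact h)
      have : a' θ = a θ := haO θ ⟨U, ⟨hU1, hU3⟩, hU2⟩
      simp only [hθ] at this
      rw [this]


theorem GR {n : ℕ} {s σ M : ℝ} (hs : 0 < s) (hσ : 0 ≤ σ) (hM : 0 < M) :
    ∃ M' > 0, ∀ U : ℝ → En n → ℝ, (∀ R, 1 ≤ R → ∀ t x, -(R ^ (2 * s)) < t → t < 0 → ‖x‖ < R → |U t x| ≤ M * R ^ σ) →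
      ∀ x0 : En n, ∀ tb R, tb < 0 → 1 ≤ R → ‖x0‖ ≤ R → -(R ^ (2 * s)) ≤ tb →
        ∀ t ∈ Icc (tb - R ^ (2 * s)) tb, ∀ x, |U t x| ≤ M' * (R + ‖x - x0‖) ^ σ := by
  set c0 : ℝ := max 2 (3 ^ (1 / (2 * s))) with hc0
  have hc2 : 2 ≤ c0 := le_max_left _ _
  have hc3 : 3 ≤ c0 ^ (2 * s) := by
    have h1 : ((3:ℝ) ^ (1 / (2 * s))) ^ (2 * s) = 3 := by
      rw [← Real.rpow_mul (by norm_num), one_div, inv_mul_cancel₀ (by positivity), Real.rpow_one]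
    calc (3:ℝ) = ((3:ℝ) ^ (1 / (2 * s))) ^ (2 * s) := h1.symm
      _ ≤ _ := Real.rpow_le_rpow (by positivity) (le_max_right _ _) (by positivity)
  refine ⟨M * c0 ^ σ, by positivity, ?_⟩
  intro U hU x0 tb R htb hR hx0 htR t ht x
  have hx := norm_nonneg (x - x0)
  have hR0 : 0 < R := by linarith
  have e : M * c0 ^ σ * (R + ‖x - x0‖) ^ σ = M * (c0 * (R + ‖x - x0‖)) ^ σ := by
    rw [Real.mul_rpow (by linarith) (by linarith), mul_assoc]
  rw [e]
  apply hU
  · nlinarith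
  · have h1 : (c0 * (R + ‖x - x0‖)) ^ (2 * s) ≥ 3 * R ^ (2 * s) := by
      rw [Real.mul_rpow (by linarith) (by linarith)]
      have h2 : R ^ (2 * s) ≤ (R + ‖x - x0‖) ^ (2 * s) := Real.rpow_le_rpow hR0.le (by linarith) (by positivity)
      have h3 : 0 < R ^ (2 * s) := by positivity
      nlinarith
    have h3 : 0 < R ^ (2 * s) := by positivity
    linarith [ht.1]
  · linarith [ht.2]
  · calc ‖x‖ = ‖(x - x0) + x0‖ := by congr 1; abel
      _ ≤ ‖x - x0‖ + ‖x0‖ := norm_add_le _ _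
      _ < c0 * (R + ‖x - x0‖) := by nlinarith

/-- the one-dimensional barrier bound -/
def kap (s κ X ρ : ℝ) : ℝ :=
  X ^ κ * ((κ / s) * X ^ (-s) * d1 (gs s) X ρ - (1 - κ / s) * (if X ≤ |ρ| then 1 else 0))

theorem gs_kap {s κ X z : ℝ} (hs : 0 < s) (hκ : 0 < κ) (hκs : κ < s) (hX : 0 < X) :
    gs κ z ≤ X ^ κ * ((κ / s) * X ^ (-s) * gs s z + (1 - κ / s) * (if 0 < z then 1 else 0)) := by
  by_cases hz : 0 < z
  · rw [if_pos hz, gs_pos hz.le, gs_pos hz.le]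
    have hq : κ / s < 1 := (div_lt_one hs).2 hκs
    have h := Real.geom_mean_le_arith_mean2_weighted (w₁ := κ / s) (w₂ := 1 - κ / s) (p₁ := (z / X) ^ s) (p₂ := 1)
      (by positivity) (by linarith) (by positivity) (by norm_num) (by ring)
    rw [Real.one_rpow, mul_one, ← Real.rpow_mul (by positivity), mul_div_cancel₀ _ hs.ne', Real.div_rpow hz.le hX.le,
      Real.div_rpow hz.le hX.le, div_le_iff₀ (by positivity)] at h
    rw [Real.rpow_neg hX.le]
    calc z ^ κ ≤ _ := h
      _ = _ := by rw [div_eq_mul_inv (z ^ s)]; ring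
  · rw [if_neg hz, gs_neg hκ (not_lt.1 hz), gs_neg hs (not_lt.1 hz)]; simp

theorem d1_kap {s κ X ρ : ℝ} (hs : 0 < s) (hκ : 0 < κ) (hκs : κ < s) (hX : 0 < X) :
    d1 (gs κ) X ρ ≤ kap s κ X ρ := by
  have h1 := gs_kap (z := X + ρ) hs hκ hκs hX
  have h2 := gs_kap (z := X - ρ) hs hκ hκs hX
  have h3 : gs κ X = X ^ κ * ((κ / s) * X ^ (-s) * gs s X + (1 - κ / s)) := by
    rw [gs_pos hX.le, gs_pos hX.le, Real.rpow_neg hX.le]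
    have : X ^ s ≠ 0 := by positivity
    field_simp; ring
  have h4 : (if 0 < X + ρ then (1:ℝ) else 0) + (if 0 < X - ρ then (1:ℝ) else 0) - 2 = - (if X ≤ |ρ| then 1 else 0) := by
    rcases le_total 0 ρ with hρ | hρ
    · rw [abs_of_nonneg hρ, if_pos (by linarith)]
      by_cases h : X ≤ ρ
      · rw [if_pos h, if_neg (by linarith)]; norm_num
      · rw [if_neg h, if_pos (by linarith)]; norm_num
    · rw [abs_of_nonpos hρ, if_pos (show 0 < X - ρ by linarith)]
      by_cases h : X ≤ -ρ
      · rw [if_pos h, if_neg (by linarith)]; norm_num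
      · rw [if_neg h, if_pos (by linarith)]; norm_num
  unfold kap d1
  rw [h3]
  linear_combination h1 + h2 + X ^ κ * (1 - κ / s) * h4

theorem kap_int {s κ X : ℝ} (hs : s ∈ Ioo (0:ℝ) 1) (hX : 0 < X) :
    IntegrableOn (fun ρ => kap s κ X ρ * ρ ^ (-1 - 2 * s)) (Ioi 0) ∧
    ∫ ρ in Ioi 0, kap s κ X ρ * ρ ^ (-1 - 2 * s) = - ((1 - κ / s) / (2 * s) * X ^ (κ - 2 * s)) := by
  have hA := factA hs hX
  have hs0 := hs.1
  have e0 : ∀ ρ ∈ Ioi (0:ℝ), (if X ≤ |ρ| then (1:ℝ) else 0) * ρ ^ (-1 - 2 * s) = (Ici X).indicator (fun ρ => ρ ^ (-1 - 2 * s)) ρ := by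
    intro ρ hρ
    have hρ : 0 < ρ := hρ
    simp only [indicator, mem_Ici, abs_of_pos hρ]
    split_ifs <;> simp
  have i0 : IntegrableOn (fun ρ : ℝ => ρ ^ (-1 - 2 * s)) (Ici X) := by
    rw [integrableOn_Ici_iff_integrableOn_Ioi]
    exact integrableOn_Ioi_rpow_of_lt (by linarith) hX
  have i1 : IntegrableOn (fun ρ : ℝ => (if X ≤ |ρ| then (1:ℝ) else 0) * ρ ^ (-1 - 2 * s)) (Ioi 0) := by
    refine IntegrableOn.congr_fun ?_ (fun ρ hρ => (e0 ρ hρ).symm) measurableSet_Ioi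
    exact (i0.integrable_indicator measurableSet_Ici).integrableOn
  have v1 : ∫ ρ in Ioi 0, (if X ≤ |ρ| then (1:ℝ) else 0) * ρ ^ (-1 - 2 * s) = X ^ (-2 * s) / (2 * s) := by
    have hsub : Ici X ⊆ Ioi (0:ℝ) := fun z hz => hX.trans_le hz
    rw [setIntegral_congr_fun measurableSet_Ioi e0, setIntegral_indicator measurableSet_Ici,
      inter_eq_right.2 hsub, integral_Ici_eq_integral_Ioi, integral_Ioi_rpow_of_lt (by linarith) hX]
    rw [show -1 - 2 * s + 1 = -2 * s by ring]
    field_simp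
  have e : (fun ρ => kap s κ X ρ * ρ ^ (-1 - 2 * s)) = fun ρ => (X ^ κ * ((κ / s) * X ^ (-s))) * (d1 (gs s) X ρ * ρ ^ (-1 - 2 * s))
      - (X ^ κ * (1 - κ / s)) * ((if X ≤ |ρ| then (1:ℝ) else 0) * ρ ^ (-1 - 2 * s)) := by
    funext ρ; simp only [kap]; ring
  have hA1 := hA.1
  unfold Int1 at hA1
  have hA2 := hA.2
  unfold L1 at hA2
  rw [e]
  refine ⟨(hA1.const_mul _).sub (i1.const_mul _), ?_⟩
  rw [integral_sub (hA1.const_mul _) (i1.const_mul _), integral_const_mul, integral_const_mul, hA2, v1,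
    show κ - 2 * s = κ + (-2 * s) by ring, Real.rpow_add hX]
  ring

theorem LLtouch {n : ℕ} {s σ κ lam Lam A B R X : ℝ} (hn : 0 < n) (hs : s ∈ Ioo (0 : ℝ) 1) (hσ0 : 0 < σ)
    (hσ : σ < 2 * s) (hlam : 0 < lam) (hlL : lam ≤ Lam) {a : En n → ℝ} (ha : KernelBounds lam Lam a) (ham : AM n a)
    (hR0 : 0 < R) (hyp : 0 < X) (hA0 : 0 < A) (hB0 : 0 < B) {u : En n → ℝ} {y : En n}
    (hIntg : Integrable (Lintegrand n s a u y))
    (hDD : ∀ z, DD u y z ≤ A * kap s κ X (lastC z) + B * mm σ (‖z‖ / R)) :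
    Lop n s a u y ≤ A * (ca n s a * -((1 - κ / s) / (2 * s) * X ^ (κ - 2 * s))) + B * Lam * (C1 n s σ * R ^ (-(2 * s))) := by
  have hs0 := hs.1
  obtain ⟨hmi, hme⟩ := mmR_int (n := n) (R := R) hn hs hσ0 (by linarith : σ < 2 * s) hR0
  obtain ⟨hki, hkv⟩ := kap_int (κ := κ) hs hyp
  obtain ⟨hKi, hKv⟩ := SLG hn hs0 hlam ha ham (kap s κ X) (by
      unfold kap d1
      have hg : Measurable (gs s) := (gs_cont hs0).measurable
      refine Measurable.const_mul (Measurable.sub (Measurable.const_mul ?_ _) (Measurable.const_mul ?_ _)) _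
      · exact ((hg.comp (by fun_prop)).add (hg.comp (by fun_prop))).sub_const _
      · exact Measurable.ite (measurableSet_le measurable_const (by fun_prop)) measurable_const measurable_const)
    (fun r => by unfold kap; rw [d1_even, abs_neg])
    (by unfold kap; rw [abs_zero, if_neg (not_le.2 hyp)]; unfold d1; simp; right; right; ring) hki
  have hle : Lop n s a (u) y ≤ ∫ z, (A * (kap s κ X (lastC z) * a (‖z‖⁻¹ • z) * JJ n s z) + B * Lam * (mm σ (‖z‖ / R) * JJ n s z)) := by
    refine integral_mono hIntg ((hKi.const_mul A).add (hmi.const_mul _)) ?_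
    intro z
    simp only [Pi.add_apply]
    rw [Lintegrand_eq]
    by_cases hz : z = 0
    · subst hz
      have : JJ n s (0 : En n) = 0 := by
        unfold JJ; rw [norm_zero, Real.zero_rpow (by positivity), inv_zero]
      rw [this]; simp
    · have hk := KB ha hz
      have h1 := hDD z
      have hJ := JJ_nonneg (n := n) (s := s) z
      have hm := mm_nonneg (σ := σ) (r := ‖z‖ / R) (by positivity)
      have ha0 : 0 ≤ a (‖z‖⁻¹ • z) := by linarith
      calc DD (u) y z * a (‖z‖⁻¹ • z) * JJ n s z ≤ (A * kap s κ X (lastC z) + B * mm σ (‖z‖ / R)) * a (‖z‖⁻¹ • z) * JJ n s z := by gcongr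
        _ = A * (kap s κ X (lastC z) * a (‖z‖⁻¹ • z) * JJ n s z) + B * a (‖z‖⁻¹ • z) * (mm σ (‖z‖ / R) * JJ n s z) := by ring
        _ ≤ _ := by gcongr; exact hk.2
  have hval : ∫ z, (A * (kap s κ X (lastC z) * a (‖z‖⁻¹ • z) * JJ n s z) + B * Lam * (mm σ (‖z‖ / R) * JJ n s z)) =
      A * (ca n s a * -((1 - κ / s) / (2 * s) * X ^ (κ - 2 * s))) + B * Lam * (C1 n s σ * R ^ (-(2 * s))) := by
    have z := integral_add (hKi.const_mul A) (hmi.const_mul (B * Lam))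
    rw [z, integral_const_mul, integral_const_mul, hKv, hkv, hme]
  rw [hval] at hle
  exact hle

set_option maxHeartbeats 1000000 in
theorem LLcore {n : ℕ} {s σ lam Lam M : ℝ} (hn : 0 < n) (hs : s ∈ Ioo (0 : ℝ) 1) (hσ0 : 0 < σ)
    (hσ : σ < s) (hlam : 0 < lam) (hlL : lam ≤ Lam) {a : En n → ℝ} (ha : KernelBounds lam Lam a) (ham : AM n a)
    (hM : 0 < M) (U : ℝ → En n → ℝ) (hU : ContinuousOn (fun p : ℝ × En n => U p.1 p.2) (Iio 0 ×ˢ univ))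
    (hb : ∀ t < 0, ∀ x, lastC x ≤ 0 → U t x = 0)
    (hsol : ∀ t < 0, ∀ x, 0 < lastC x → SolvesAt n s a U (fun _ _ => 0) t x)
    (hgr : ∀ R, 1 ≤ R → ∀ t x, -(R ^ (2 * s)) < t → t < 0 → ‖x‖ < R → |U t x| ≤ M * R ^ σ)
    (tb : ℝ) (htb : tb < 0) (x0 : En n) (hx0 : 0 < lastC x0) : U tb x0 ≤ 0 := by
  have hs0 := hs.1
  set κ := (σ + s) / 2 with hκ
  have hκ0 : 0 < κ := by linarith
  have hκs : κ < s := by linarith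
  have hκσ : σ < κ := by linarith
  have hLam : 0 < Lam := by linarith
  obtain ⟨M', hM', hGR⟩ := GR (n := n) hs0 hσ0.le hM
  have hca := ca_pos hn hs0 hlam ha ham
  have hC1 := C1_nonneg (n := n) (s := s) (σ := σ)
  have hκq : 0 < 1 - κ / s := by rw [sub_pos, div_lt_one hs0]; exact hκs
  set c1 : ℝ := ca n s a * ((1 - κ / s) / (2 * s)) * 2 ^ (κ - 2 * s) with hc1
  have hc1p : 0 < c1 := by positivity
  set Q : ℝ := (Lam * C1 n s σ + 2) / c1 with hQ
  have hQp : 0 < Q := by positivity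
  have key : ∀ R : ℝ, 1 ≤ R → ‖x0‖ ≤ R → -(R ^ (2 * s)) ≤ tb →
      U tb x0 ≤ M' * 2 ^ σ * Q * (lastC x0) ^ κ * R ^ (σ - κ) := by
    intro R hR hxR htR
    have hR0 : 0 < R := by linarith
    have hbd := hGR U hgr x0 tb R htb hR hxR htR
    set T := R ^ (2 * s) with hT
    have hT0 : 0 < T := by positivity
    set B := M' * (2 * R) ^ σ with hB
    have hB0 : 0 < B := by positivity
    set A := B * Q * R ^ (-κ) with hA
    have hA0 : 0 < A := by positivity
    have htop : ∀ y : En n, R ≤ ‖y - x0‖ → M' * (R + ‖y - x0‖) ^ σ ≤ B * psi σ (‖y - x0‖ / R) := by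
      intro y hy
      rw [psi_of_ge_one (by linarith [hs.2]) ((one_le_div hR0).2 hy), hB, mul_assoc,
        Real.div_rpow (norm_nonneg _) hR0.le, Real.mul_rpow (by norm_num) hR0.le]
      have : (2:ℝ) ^ σ * R ^ σ * (‖y - x0‖ ^ σ / R ^ σ) = (2 * ‖y - x0‖) ^ σ := by
        rw [Real.mul_rpow (by norm_num) (norm_nonneg _)]; field_simp
      rw [this]
      gcongr
      linarith
    have hin : ∀ y : En n, ‖y - x0‖ ≤ R → M' * (R + ‖y - x0‖) ^ σ ≤ B := by
      intro y hy
      rw [hB]; gcongr; linarith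
    have hbf : Continuous (fun y : En n => A * gs κ (lastC y) + B * psi σ (‖y - x0‖ / R) + B) := by
      refine ((continuous_const.mul ((gs_cont hκ0).comp continuous_lastC)).add (continuous_const.mul
        ((psi_cont hσ0).comp (by fun_prop)))).add continuous_const
    have hpn : ∀ y : En n, 0 ≤ psi σ (‖y - x0‖ / R) := fun y => psi_nonneg (by positivity)
    have hAn : ∀ y : En n, 0 ≤ A * gs κ (lastC y) := fun y => mul_nonneg hA0.le gs_nonneg
    have hmax := MAX U (fun y : En n => A * gs κ (lastC y) + B * psi σ (‖y - x0‖ / R) + B) (tb - T) tb (-(B / T)) univ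
      (closedBall x0 R) (isCompact_closedBall _ _) (subset_univ _)
      (hU.mono (prod_mono (fun t ht => lt_of_le_of_lt ht.2 htb) le_rfl)) hbf
      (by
        intro t ht y _ hy
        have hy' : R ≤ ‖y - x0‖ := by
          rw [mem_closedBall, dist_eq_norm, not_le] at hy; exact hy.le
        have h1 := (le_abs_self _).trans (hbd t ht y)
        have h2 := htop y hy'
        have h3 : B / T * (t - (tb - T)) ≤ B := by
          rw [div_mul_eq_mul_div, div_le_iff₀ hT0]
          have : t - (tb - T) ≤ T := by linarith [ht.2]
          nlinarith
        have := hAn y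
        linarith)
      (by
        intro y _
        have h1 := (le_abs_self _).trans (hbd (tb - T) ⟨le_rfl, by linarith⟩ y)
        have := hAn y
        have hpy := hpn y
        rcases le_total R ‖y - x0‖ with h | h
        · have := htop y h; linarith
        · have := hin y h
          have : 0 ≤ B * psi σ (‖y - x0‖ / R) := by positivity
          linarith)
      (by
        intro t ht y hy hpos hmx
        have ht0 : t < 0 := lt_of_le_of_lt ht.2 htb
        have hyR : ‖y - x0‖ ≤ R := by rwa [mem_closedBall, dist_eq_norm] at hy
        have hcT : B / T * (t - (tb - T)) ≤ B := by
          rw [div_mul_eq_mul_div, div_le_iff₀ hT0]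
          have : t - (tb - T) ≤ T := by linarith [ht.2]
          nlinarith
        have hyp : 0 < lastC y := by
          by_contra hcon
          have h0 := hb t ht0 y (not_lt.1 hcon)
          have h1 := hAn y
          have h2 : 0 ≤ B * psi σ (‖y - x0‖ / R) := mul_nonneg hB0.le (hpn y)
          linarith
        set X := lastC y with hX
        have hX2 : X ≤ 2 * R := by
          have h1 : X ≤ ‖y‖ := (le_abs_self _).trans (abs_lastC_le y)
          have h2 : ‖y‖ ≤ ‖y - x0‖ + ‖x0‖ := by
            calc ‖y‖ = ‖(y - x0) + x0‖ := by congr 1; abel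
              _ ≤ _ := norm_add_le _ _
          linarith
        obtain ⟨hIntg, hder⟩ := hsol t ht0 y hyp
        refine ⟨_, ?_, hder⟩
        have hDD : ∀ z, DD (U t) y z ≤ A * kap s κ X (lastC z) + B * mm σ (‖z‖ / R) := by
          intro z
          have h1 := hmx (y + z) (mem_univ _)
          have h2 := hmx (y - z) (mem_univ _)
          have h3 := DD_psi hσ0 (by linarith [hs.2] : σ ≤ 2) hR0 x0 y z hyR
          have h4 := d1_kap (ρ := lastC z) hs0 hκ0 hκs hyp
          simp only [lastC_add, lastC_sub] at h1 h2
          unfold d1 at h4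
          have h5 := mul_le_mul_of_nonneg_left h4 hA0.le
          have h6 := mul_le_mul_of_nonneg_left h3 hB0.le
          unfold DD
          linarith
        have hle := LLtouch hn hs hσ0 (by linarith : σ < 2 * s) hlam hlL ha ham hR0 hyp hA0 hB0 hIntg hDD
        have hXp : 2 ^ (κ - 2 * s) * R ^ (κ - 2 * s) ≤ X ^ (κ - 2 * s) := by
          rw [← Real.mul_rpow (by norm_num) hR0.le]
          exact Real.rpow_le_rpow_of_nonpos hyp hX2 (by linarith)
        have hfin : A * (ca n s a * ((1 - κ / s) / (2 * s) * X ^ (κ - 2 * s))) ≥ B * (Lam * C1 n s σ + 2) * R ^ (-(2 * s)) := by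
          calc A * (ca n s a * ((1 - κ / s) / (2 * s) * X ^ (κ - 2 * s))) ≥
                A * (ca n s a * ((1 - κ / s) / (2 * s) * (2 ^ (κ - 2 * s) * R ^ (κ - 2 * s)))) := by gcongr
            _ = B * (Q * c1) * (R ^ (-κ) * R ^ (κ - 2 * s)) := by rw [hA, hc1]; ring
            _ = _ := by
              rw [← Real.rpow_add hR0, hQ, div_mul_cancel₀ _ hc1p.ne']; congr 2; ring
        have hRT : R ^ (-(2 * s)) = 1 / T := by rw [Real.rpow_neg hR0.le, hT, one_div]
        have hBT : 0 < B * R ^ (-(2 * s)) := by positivity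
        have : B / T = B * R ^ (-(2 * s)) := by rw [hRT]; ring
        rw [this]
        nlinarith)
    have h1 := hmax tb ⟨by linarith, le_rfl⟩ x0 (mem_univ _)
    simp only [sub_self, norm_zero, zero_div, psi_zero hσ0] at h1
    have h2 : B / T * (tb - (tb - T)) = B := by field_simp; ring
    rw [gs_pos hx0.le] at h1
    have h3 : U tb x0 ≤ A * lastC x0 ^ κ := by linarith
    refine h3.trans (le_of_eq ?_)
    rw [hA, hB, Real.mul_rpow (by norm_num) hR0.le, show σ - κ = σ + -κ by ring, Real.rpow_add hR0]; ring
  have hlim : Tendsto (fun R : ℝ => M' * 2 ^ σ * Q * (lastC x0) ^ κ * R ^ (σ - κ)) atTop (𝓝 0) := by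
    have := (tendsto_rpow_neg_atTop (by linarith : 0 < κ - σ)).const_mul (M' * 2 ^ σ * Q * (lastC x0) ^ κ)
    rw [mul_zero] at this
    simpa only [neg_sub] using this
  refine ge_of_tendsto hlim ?_
  have ht : ∀ᶠ R : ℝ in atTop, -tb ≤ R ^ (2 * s) := (tendsto_rpow_atTop (by linarith : 0 < 2 * s)).eventually_ge_atTop (-tb)
  filter_upwards [eventually_ge_atTop 1, eventually_ge_atTop ‖x0‖, ht] with R h1 h2 h3
  exact key R h1 h2 (by linarith)

theorem LL {n : ℕ} {s σ lam Lam M : ℝ} (hn : 0 < n) (hs : s ∈ Ioo (0 : ℝ) 1) (hσ0 : 0 < σ)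
    (hσ : σ < s) (hlam : 0 < lam) (hlL : lam ≤ Lam) {a : En n → ℝ} (ha : KernelBounds lam Lam a) (ham : AM n a)
    (hM : 0 < M) (U : ℝ → En n → ℝ) (hU : ContinuousOn (fun p : ℝ × En n => U p.1 p.2) (Iio 0 ×ˢ univ))
    (hb : ∀ t < 0, ∀ x, lastC x ≤ 0 → U t x = 0)
    (hsol : ∀ t < 0, ∀ x, 0 < lastC x → SolvesAt n s a U (fun _ _ => 0) t x)
    (hgr : ∀ R, 1 ≤ R → ∀ t x, -(R ^ (2 * s)) < t → t < 0 → ‖x‖ < R → |U t x| ≤ M * R ^ σ) :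
    ∀ t < 0, ∀ x, U t x = 0 := by
  intro t ht x
  rcases le_or_gt (lastC x) 0 with h | h
  · exact hb t ht x h
  have h1 := LLcore hn hs hσ0 hσ hlam hlL ha ham hM U hU hb hsol hgr t ht x h
  have h2 := LLcore hn hs hσ0 hσ hlam hlL ha ham hM (fun t x => - U t x) hU.neg
    (fun t ht x hx => by rw [hb t ht x hx, neg_zero]) (fun t ht x hx => (hsol t ht x hx).neg')
    (fun R hR t x h1 h2 h3 => by rw [abs_neg]; exact hgr R hR t x h1 h2 h3) t ht x h
  linarith


theorem SolvesAt.shift {n : ℕ} {s : ℝ} {a : En n → ℝ} {u : ℝ → En n → ℝ} {t τ : ℝ} {x h : En n}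
    (H : SolvesAt n s a u (fun _ _ => 0) (t + τ) (x + h)) :
    SolvesAt n s a (fun t x => u (t + τ) (x + h)) (fun _ _ => 0) t x := by
  obtain ⟨h1, h2⟩ := H
  have e : Lintegrand n s a (fun x => u (t + τ) (x + h)) x = Lintegrand n s a (u (t + τ)) (x + h) := by
    funext y
    simp only [Lintegrand_eq, DD]
    rw [show x + y + h = x + h + y by abel, show x - y + h = x + h - y by abel]
  refine ⟨by rw [e]; exact h1, ?_⟩
  have e2 : Lop n s a (fun x => u (t + τ) (x + h)) x = Lop n s a (u (t + τ)) (x + h) := by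
    unfold Lop; rw [e]
  rw [e2]
  exact h2.comp_add_const t τ

theorem cc_exists {s : ℝ} (hs : 0 < s) : ∃ c : ℝ, 3 ≤ c ∧ 3 ≤ c ^ (2 * s) := by
  refine ⟨max 3 (3 ^ (1 / (2 * s))), le_max_left _ _, ?_⟩
  have h1 : ((3:ℝ) ^ (1 / (2 * s))) ^ (2 * s) = 3 := by
    rw [← Real.rpow_mul (by norm_num), one_div, inv_mul_cancel₀ (by positivity), Real.rpow_one]
  calc (3:ℝ) = ((3:ℝ) ^ (1 / (2 * s))) ^ (2 * s) := h1.symm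
    _ ≤ _ := Real.rpow_le_rpow (by positivity) (le_max_right _ _) (by positivity)

/-- spatial Hölder bound for solutions vanishing like `x_n^s` -/
theorem SH {n : ℕ} {s α lam Lam M : ℝ} (hn : 0 < n) (hs : s ∈ Ioo (0 : ℝ) 1) (hα : α ∈ Ioo 0 s)
    (hlam : 0 < lam) (hlL : lam ≤ Lam) {a : En n → ℝ} (ha : KernelBounds lam Lam a)
    (hM : 0 < M) (U : ℝ → En n → ℝ) (hU : ContinuousOn (fun p : ℝ × En n => U p.1 p.2) (Iio 0 ×ˢ univ))
    (hb : ∀ t < 0, ∀ x, lastC x ≤ 0 → U t x = 0)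
    (hsol : ∀ t < 0, ∀ x, 0 < lastC x → SolvesAt n s a U (fun _ _ => 0) t x)
    (hgr : ∀ R, 1 ≤ R → ∀ t x, -(R ^ (2 * s)) < t → t < 0 → ‖x‖ < R → |U t x| ≤ M * gs s (lastC x) * R ^ α) :
    ∃ K > 0, (∀ x0 : En n, ∀ tb R, tb < 0 → 1 ≤ R → ‖x0‖ ≤ R → -(R ^ (2 * s)) ≤ tb →
        ∀ t ∈ Icc (tb - R ^ (2 * s)) tb, ∀ x, |U t x| ≤ K * (R + ‖x - x0‖) ^ (s + α)) ∧
      ∀ x0 : En n, ∀ tb R, tb < 0 → 1 ≤ R → ‖x0‖ ≤ R → -(R ^ (2 * s)) ≤ tb →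
        ∀ h : En n, ‖h‖ ≤ R / 4 → |U tb (x0 + h) - U tb x0| ≤ K * R ^ ((s + α) / 2) * ‖h‖ ^ ((s + α) / 2) := by
  have hs0 := hs.1
  have hα0 := hα.1
  have hαs := hα.2
  have hgr' : ∀ R, 1 ≤ R → ∀ t x, -(R ^ (2 * s)) < t → t < 0 → ‖x‖ < R → |U t x| ≤ M * R ^ (s + α) := by
    intro R hR t x h1 h2 h3
    have hR0 : 0 < R := by linarith
    refine (hgr R hR t x h1 h2 h3).trans ?_
    have : gs s (lastC x) ≤ R ^ s := by
      rw [← gs_pos hR0.le]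
      exact gs_mono hs0 ((le_abs_self _).trans ((abs_lastC_le x).trans h3.le))
    rw [Real.rpow_add hR0, ← mul_assoc]
    gcongr
  obtain ⟨M', hM', hGR⟩ := GR (n := n) hs0 (by linarith : 0 ≤ s + α) hM
  obtain ⟨c, hc3, hcs⟩ := cc_exists hs0
  obtain ⟨A, hA, hDL⟩ := DL (n := n) (σ := s + α) (ε := (s + α) / 2) hn hs (by linarith) (by linarith)
    ⟨by linarith, by linarith [hs.2]⟩ (by linarith) hlam hlL
  set M2 := max M' (M * 2 ^ (s - (s + α) / 2) * c ^ α) with hM2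
  have hM20 : 0 < M2 := lt_max_of_lt_left hM'
  refine ⟨max M' (A * M2), lt_max_of_lt_left hM', ?_, ?_⟩
  · intro x0 tb R h1 h2 h3 h4 t ht x
    refine (hGR U hgr' x0 tb R h1 h2 h3 h4 t ht x).trans ?_
    gcongr; exact le_max_left _ _
  intro x0 tb R htb hR hx0 htR h hh
  have hR0 : 0 < R := by linarith
  have hT : 0 < R ^ (2 * s) := by positivity
  have hone : ∀ t ∈ Icc (tb - R ^ (2 * s)) tb, ∀ x z : En n, ‖x - x0‖ ≤ R / 2 → ‖z - x0‖ ≤ R / 2 →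
      0 < lastC x → lastC z ≤ 0 → |U t x - U t z| ≤ M2 * R ^ ((s + α) - (s + α) / 2) * ‖x - z‖ ^ ((s + α) / 2) := by
    intro t ht x z hx hz hxp hzn
    have ht0 : t < 0 := by linarith [ht.2]
    rw [hb t ht0 z hzn, sub_zero]
    have hxR : ‖x‖ ≤ 3 / 2 * R := by
      have : ‖x‖ ≤ ‖x - x0‖ + ‖x0‖ := by
        calc ‖x‖ = ‖(x - x0) + x0‖ := by congr 1; abel
          _ ≤ _ := norm_add_le _ _
      linarith
    have h1 := hgr (c * R) (by nlinarith) t x (by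
      rw [Real.mul_rpow (by linarith) hR0.le]
      nlinarith [ht.1]) ht0 (by nlinarith)
    have hxz : lastC x ≤ ‖x - z‖ := by
      have := (le_abs_self _).trans (abs_lastC_le (x - z))
      rw [lastC_sub] at this; linarith
    have hx2 : lastC x ≤ 2 * R := ((le_abs_self _).trans (abs_lastC_le x)).trans (by linarith)
    refine h1.trans ?_
    rw [gs_pos hxp.le]
    have e1 : lastC x ^ s = lastC x ^ ((s + α) / 2) * lastC x ^ (s - (s + α) / 2) := by
      rw [← Real.rpow_add hxp]; congr 1; ring
    have e2 : lastC x ^ ((s + α) / 2) ≤ ‖x - z‖ ^ ((s + α) / 2) := Real.rpow_le_rpow hxp.le hxz (by linarith)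
    have e3 : lastC x ^ (s - (s + α) / 2) ≤ 2 ^ (s - (s + α) / 2) * R ^ (s - (s + α) / 2) := by
      rw [← Real.mul_rpow (by norm_num) hR0.le]
      exact Real.rpow_le_rpow hxp.le hx2 (by linarith)
    rw [e1, Real.mul_rpow (by linarith) hR0.le]
    calc M * (lastC x ^ ((s + α) / 2) * lastC x ^ (s - (s + α) / 2)) * (c ^ α * R ^ α)
        ≤ M * (‖x - z‖ ^ ((s + α) / 2) * (2 ^ (s - (s + α) / 2) * R ^ (s - (s + α) / 2))) * (c ^ α * R ^ α) := by
          have : 0 < c := by linarith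
          gcongr
      _ = (M * 2 ^ (s - (s + α) / 2) * c ^ α) * (R ^ (s - (s + α) / 2) * R ^ α) * ‖x - z‖ ^ ((s + α) / 2) := by ring
      _ ≤ M2 * (R ^ (s - (s + α) / 2) * R ^ α) * ‖x - z‖ ^ ((s + α) / 2) := by
          gcongr; exact le_max_right _ _
      _ = _ := by
          rw [← Real.rpow_add hR0, show s - (s + α) / 2 + α = s + α - (s + α) / 2 by ring]
  have := hDL a ha U x0 R M2 tb hR0 hM20 (hU.mono (prod_mono (fun t ht => lt_of_le_of_lt ht.2 htb) le_rfl))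
    (fun t ht x => (hGR U hgr' x0 tb R htb hR hx0 htR t ht x).trans (by gcongr; exact le_max_left _ _))
    (by
      intro t ht x z hx hz
      have ht0 : t < 0 := by linarith [ht.2]
      rcases le_or_gt (lastC x) 0 with h1 | h1 <;> rcases le_or_gt (lastC z) 0 with h2 | h2
      · right; rw [hb t ht0 x h1, hb t ht0 z h2, sub_zero, abs_zero]; positivity
      · right; rw [abs_sub_comm, norm_sub_rev]; exact hone t ht z x hz hx h2 h1
      · right; exact hone t ht x z hx hz h1 h2
      · left; exact ⟨hsol t ht0 x h1, hsol t ht0 z h2⟩) h hh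
  rw [show s + α - (s + α) / 2 = (s + α) / 2 by ring] at this
  refine this.trans ?_
  gcongr; exact le_max_right _ _

theorem RIG {n : ℕ} {s α lam Lam M : ℝ} (hn : 0 < n) (hs : s ∈ Ioo (0 : ℝ) 1) (hα : α ∈ Ioo 0 s)
    (hlam : 0 < lam) (hlL : lam ≤ Lam) {a : En n → ℝ} (ha : KernelBounds lam Lam a) (ham : AM n a)
    (hM : 0 < M) (U : ℝ → En n → ℝ) (hU : ContinuousOn (fun p : ℝ × En n => U p.1 p.2) (Iio 0 ×ˢ univ))
    (hb : ∀ t < 0, ∀ x, lastC x ≤ 0 → U t x = 0)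
    (hsol : ∀ t < 0, ∀ x, 0 < lastC x → SolvesAt n s a U (fun _ _ => 0) t x)
    (hgr : ∀ R, 1 ≤ R → ∀ t x, -(R ^ (2 * s)) < t → t < 0 → ‖x‖ < R → |U t x| ≤ M * gs s (lastC x) * R ^ α) :
    (∀ h, lastC h = 0 → ∀ t < 0, ∀ x, U t (x + h) = U t x) ∧
    (∀ t < 0, ∀ t' < 0, ∀ x, U t x = U t' x) := by
  have hs0 := hs.1
  have hα0 := hα.1
  have hαs := hα.2
  have hLam : 0 < Lam := by linarith
  obtain ⟨K, hK, hK1, hK2⟩ := SH hn hs hα hlam hlL ha hM U hU hb hsol hgr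
  set ε := (s + α) / 2 with hε
  have hε0 : 0 < ε := by linarith
  have hεs : ε < s := by linarith
  obtain ⟨c, hc3, hcs⟩ := cc_exists hs0
  constructor
  · intro h hh t ht x
    have := LL hn hs hε0 hεs hlam hlL ha ham (M := K * (1 + 4 * ‖h‖) ^ ε * ‖h‖ ^ ε + 1) (by positivity)
      (fun t x => U t (x + h) - U t x)
      ((hU.comp (f := fun p : ℝ × En n => (p.1, p.2 + h)) (by fun_prop) (fun p hp => ⟨hp.1, mem_univ _⟩)).sub hU)
      (fun t ht x hx => by rw [hb t ht _ (by rw [lastC_add, hh]; linarith), hb t ht x hx, sub_zero])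
      (fun t ht x hx => by
        have h1 := (hsol (t + 0) (by linarith) (x + h) (by rw [lastC_add, hh]; linarith)).shift
        simp only [add_zero] at h1
        exact h1.sub' (hsol t ht x hx))
      (by
        intro R hR t x h1 h2 h3
        have hn0 := norm_nonneg h
        have hR0 : 0 < R := by linarith
        have hR' : R ≤ (1 + 4 * ‖h‖) * R := by nlinarith
        have hR'' : R ^ (2 * s) ≤ ((1 + 4 * ‖h‖) * R) ^ (2 * s) := Real.rpow_le_rpow hR0.le hR' (by positivity)
        have := hK2 x t ((1 + 4 * ‖h‖) * R) h2 (by linarith) (by linarith) (by linarith) h (by nlinarith)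
        refine this.trans ?_
        rw [Real.mul_rpow (by positivity) hR0.le]
        have : 0 < R ^ ε := by positivity
        nlinarith)
      t ht x
    linarith
  · have hstep : ∀ τ ∈ Icc (-1 : ℝ) 0, ∀ t < 0, ∀ x, U (t + τ) x = U t x := by
      intro τ hτ t ht x
      have hC1 := C1_nonneg (n := n) (s := s) (σ := s + α)
      have hτ0 := hτ.2
      have hτ1 := hτ.1
      have hc0 : 0 < c := by linarith
      have := LL hn hs hε0 hεs hlam hlL ha ham (M := (Lam * C1 n s (s + α) + 2) * (K * c ^ ε + 50 * K)) (by positivity)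
        (fun t x => U (t + τ) x - U t x)
        ((hU.comp (f := fun p : ℝ × En n => (p.1 + τ, p.2)) (by fun_prop) (fun p hp => ⟨by
          have : p.1 < 0 := hp.1
          show p.1 + τ < 0
          linarith, mem_univ _⟩)).sub hU)
        (fun t ht x hx => by rw [hb (t + τ) (by linarith) _ hx, hb t ht x hx, sub_zero])
        (fun t ht x hx => by
          have h1 := (hsol (t + τ) (by linarith) (x + 0) (by rwa [add_zero])).shift
          simp only [add_zero] at h1
          exact h1.sub' (hsol t ht x hx))
        (by
          intro R hR t x h1 h2 h3
          have hR0 : 0 < R := by linarith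
          have hR1 : 1 ≤ R ^ ε := Real.one_le_rpow hR hε0.le
          have hR2 : 1 ≤ R ^ (2 * s) := Real.one_le_rpow hR (by positivity)
          have hcR : 1 ≤ c * R := by nlinarith
          have hcR2 : 3 * R ^ (2 * s) ≤ (c * R) ^ (2 * s) := by
            rw [Real.mul_rpow (by linarith) hR0.le]; gcongr
          have hxc : ‖x‖ ≤ c * R := by nlinarith
          have hbd : ∀ t' ∈ Icc (t + τ) t, ∀ y, |U t' y| ≤ K * (c * R + ‖y - x‖) ^ (s + α) := by
            intro t' ht' y
            exact hK1 x t (c * R) h2 hcR hxc (by linarith) t' ⟨by linarith [ht'.1], ht'.2⟩ y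
          have hhol : ∀ t' ∈ Icc (t + τ) t, ∀ y, ‖y - x‖ ≤ c * R / 4 → |U t' y - U t' x| ≤ (K * (c * R) ^ ε) * ‖y - x‖ ^ ε := by
            intro t' ht' y hy
            have := hK2 x t' (c * R) (by linarith [ht'.2]) hcR hxc (by linarith [ht'.1]) (y - x) hy
            rwa [add_sub_cancel] at this
          have hIc : ContinuousOn (fun p : ℝ × En n => U p.1 p.2) (Icc (t + τ) t ×ˢ univ) :=
            hU.mono (prod_mono (fun t' ht' => lt_of_le_of_lt ht'.2 h2) le_rfl)
          have hH0 : 0 ≤ K * (c * R) ^ ε := by positivity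
          have T1 := TL hn hs (by linarith : 0 < s + α) (by linarith) hε0 (by linarith : ε ≤ s + α) hlam hlL ha U x (c * R)
            (K * (c * R) ^ ε) K (t + τ) t hcR hH0 hK (by linarith) (by linarith) hIc hbd hhol
            (fun t' ht' => hb t' (lt_of_le_of_lt ht'.2 h2)) (fun t' ht' => hsol t' (lt_of_le_of_lt ht'.2 h2))
          have T2 := TL hn hs (by linarith : 0 < s + α) (by linarith) hε0 (by linarith : ε ≤ s + α) hlam hlL ha
            (fun t x => - U t x) x (c * R)
            (K * (c * R) ^ ε) K (t + τ) t hcR hH0 hK (by linarith) (by linarith) hIc.neg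
            (fun t' ht' y => by rw [abs_neg]; exact hbd t' ht' y)
            (fun t' ht' y hy => by rw [← neg_sub', abs_neg]; exact hhol t' ht' y hy)
            (fun t' ht' y hy => by rw [hb t' (lt_of_le_of_lt ht'.2 h2) y hy, neg_zero])
            (fun t' ht' y hy => (hsol t' (lt_of_le_of_lt ht'.2 h2) y hy).neg')
          have hfin : (Lam * C1 n s (s + α) + 2) * (K * (c * R) ^ ε + 50 * K) ≤
              (Lam * C1 n s (s + α) + 2) * (K * c ^ ε + 50 * K) * R ^ ε := by
            rw [mul_assoc]
            refine mul_le_mul_of_nonneg_left ?_ (by positivity)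
            rw [Real.mul_rpow hc0.le hR0.le]
            nlinarith
          rw [abs_le]; constructor <;> linarith)
        t ht x
      linarith
    have hN : ∀ m : ℕ, ∀ τ, -(m:ℝ) ≤ τ → τ ≤ 0 → ∀ t < 0, ∀ x, U (t + τ) x = U t x := by
      intro m
      induction m with
      | zero =>
        intro τ h1 h2 t ht x
        have : τ = 0 := le_antisymm h2 (by simpa using h1)
        rw [this, add_zero]
      | succ m ih =>
        intro τ h1 h2 t ht x
        push_cast at h1
        rcases le_or_gt (-1) τ with h | h
        · exact hstep τ ⟨h, h2⟩ t ht x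
        · have e1 := ih (τ + 1) (by linarith) (by linarith) (t + -1) (by linarith) x
          rw [show t + -1 + (τ + 1) = t + τ by ring] at e1
          rw [e1]
          exact hstep (-1) ⟨le_rfl, by norm_num⟩ t ht x
    have hle : ∀ t < 0, ∀ t' < 0, t' ≤ t → ∀ x, U t' x = U t x := by
      intro t ht t' ht' htt x
      obtain ⟨m, hm⟩ := exists_nat_ge (t - t')
      have := hN m (t' - t) (by linarith) (by linarith) t ht x
      rwa [add_sub_cancel] at this
    intro t ht t' ht' x
    rcases le_total t' t with h | h
    · exact (hle t ht t' ht' h x).symm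
    · exact hle t' ht' t ht h x


theorem cc_exists2 {s : ℝ} (hs : 0 < s) (A : ℝ) : ∃ c : ℝ, 1 ≤ c ∧ A ≤ c ∧ A ≤ c ^ (2 * s) := by
  have ht : ∀ᶠ R : ℝ in atTop, A ≤ R ^ (2 * s) := (tendsto_rpow_atTop (by linarith : 0 < 2 * s)).eventually_ge_atTop A
  obtain ⟨c, h1, h2, h3⟩ := ((eventually_ge_atTop 1).and ((eventually_ge_atTop A).and ht)).exists
  exact ⟨c, h1, h2, h3⟩

/-- sublinear multiples force vanishing -/
theorem sublin {E K θ : ℝ} (hθ : θ < 1) (h : ∀ m : ℕ, 1 ≤ m → m * |E| ≤ K * (m:ℝ) ^ θ) : E = 0 := by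
  have h1 : ∀ m : ℕ, 1 ≤ m → |E| ≤ K * (m:ℝ) ^ (-(1 - θ)) := by
    intro m hm
    have hm0 : (0:ℝ) < m := by exact_mod_cast hm
    have := h m hm
    rw [neg_sub, Real.rpow_sub_one hm0.ne', ← mul_div_assoc, le_div_iff₀ hm0]
    linarith
  have h2 : Tendsto (fun m : ℕ => K * (m:ℝ) ^ (-(1 - θ))) atTop (𝓝 (K * 0)) :=
    ((tendsto_rpow_neg_atTop (by linarith : 0 < 1 - θ)).comp tendsto_natCast_atTop_atTop).const_mul K
  rw [mul_zero] at h2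
  have h3 : |E| ≤ 0 := ge_of_tendsto h2 (by filter_upwards [eventually_ge_atTop 1] with m hm using h1 m hm)
  exact abs_eq_zero.1 (le_antisymm h3 (abs_nonneg _))

def WH {n : ℕ} (s β α C : ℝ) (W : ℝ → En n → ℝ) : Prop :=
  ∀ R : ℝ, 1 ≤ R → ∀ t x t' x', -(R ^ (2 * s)) < t → t < 0 → -(R ^ (2 * s)) < t' → t' < 0 →
    ‖x‖ < R → ‖x'‖ < R → 0 < lastC x → 0 < lastC x' →
    |W t x - W t' x'| ≤ C * R ^ α * (|t - t'| ^ (β / (2 * s)) + ‖x - x'‖ ^ β)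

theorem iterD {n : ℕ} {W : ℝ → En n → ℝ}
    (hinv : ∀ τ < 0, ∀ h, lastC h = 0 → ∀ t < 0, ∀ t' < 0, ∀ x x', 0 < lastC x → lastC x = lastC x' →
      W (t + τ) (x + h) - W t x = W (t' + τ) (x' + h) - W t' x')
    {τ : ℝ} (hτ : τ < 0) {h : En n} (hh : lastC h = 0) {t : ℝ} (ht : t < 0) {x : En n} (hx : 0 < lastC x) (m : ℕ) :
    W (t + m * τ) (x + (m:ℝ) • h) - W t x = m * (W (t + τ) (x + h) - W t x) := by
  induction m with
  | zero => simp
  | succ m ih =>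
    have hm : (m:ℝ) * τ ≤ 0 := mul_nonpos_of_nonneg_of_nonpos (by positivity) hτ.le
    have := hinv τ hτ h hh t ht (t + m * τ) (by linarith) x (x + (m:ℝ) • h) hx (by rw [lastC_add, lastC_smul, hh]; ring)
    push_cast
    rw [show t + (m + 1) * τ = t + m * τ + τ by ring, show x + ((m:ℝ) + 1) • h = x + (m:ℝ) • h + h by
      rw [add_smul, one_smul]; abel]
    linarith

theorem ST2a {n : ℕ} {s β α C : ℝ} (hs : s ∈ Ioo (0:ℝ) 1) (hα : α ∈ Ioo 0 s) (hβ : 0 < β) (hC : 0 < C)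
    {W : ℝ → En n → ℝ} (hW : WH s β α C W)
    (hinv : ∀ τ < 0, ∀ h, lastC h = 0 → ∀ t < 0, ∀ t' < 0, ∀ x x', 0 < lastC x → lastC x = lastC x' →
      W (t + τ) (x + h) - W t x = W (t' + τ) (x' + h) - W t' x')
    {τ : ℝ} (hτ : τ < 0) {h : En n} (hh : lastC h = 0) {t : ℝ} (ht : t < 0) {x x' : En n} (hx : 0 < lastC x)
    (hx' : 0 < lastC x') :
    W (t + τ) (x + h) - W t x = W (t + τ) (x' + h) - W t x' := by
  have hs0 := hs.1
  set μ := max 1 (1 / (2 * s)) with hμ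
  have hμ1 : 1 ≤ μ := le_max_left _ _
  have hμ2 : 1 ≤ 2 * s * μ := by
    have : 1 / (2 * s) ≤ μ := le_max_right _ _
    rw [div_le_iff₀ (by positivity)] at this; linarith
  have hαμ : α * μ < 1 := by
    rcases max_cases (1:ℝ) (1 / (2 * s)) with ⟨h1, _⟩ | ⟨h1, _⟩
    · rw [hμ, h1]; linarith [hα.2, hs.2]
    · rw [hμ, h1, mul_one_div, div_lt_one (by positivity)]; linarith [hα.2]
  obtain ⟨A, hA1, hA2, hA3⟩ := cc_exists2 hs0 (‖x‖ + ‖x'‖ + ‖h‖ + |t| + |τ| + 1)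
  have hA0 : 0 < A := by linarith
  have e : W (t + τ) (x + h) - W t x - (W (t + τ) (x' + h) - W t x') = 0 := by
    apply sublin (K := 2 * C * A ^ α * ‖x - x'‖ ^ β) hαμ
    intro m hm
    have hm1 : (1:ℝ) ≤ m := by exact_mod_cast hm
    have hm0 : (0:ℝ) < m := by linarith
    have i1 := iterD hinv hτ hh ht hx m
    have i2 := iterD hinv hτ hh ht hx' m
    have hmμ : (m:ℝ) ≤ (m:ℝ) ^ μ := by
      calc (m:ℝ) = (m:ℝ) ^ (1:ℝ) := (Real.rpow_one _).symm
        _ ≤ _ := Real.rpow_le_rpow_of_exponent_le hm1 hμ1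
    have hR1 : 1 ≤ A * (m:ℝ) ^ μ := by nlinarith
    have hRs : A ^ (2 * s) * m ≤ (A * (m:ℝ) ^ μ) ^ (2 * s) := by
      rw [Real.mul_rpow hA0.le (by positivity), ← Real.rpow_mul hm0.le]
      gcongr
      calc (m:ℝ) = (m:ℝ) ^ (1:ℝ) := (Real.rpow_one _).symm
        _ ≤ _ := Real.rpow_le_rpow_of_exponent_le hm1 (by linarith)
    have n1 := norm_nonneg x
    have n2 := norm_nonneg x'
    have n3 := norm_nonneg h
    have n4 := abs_nonneg t
    have n5 := abs_nonneg τ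
    have p1 : ‖x‖ ≤ ‖x‖ * m := le_mul_of_one_le_right n1 hm1
    have p2 : ‖x'‖ ≤ ‖x'‖ * m := le_mul_of_one_le_right n2 hm1
    have p3 : 0 ≤ ‖h‖ * m := by positivity
    have p4 : |t| ≤ |t| * m := le_mul_of_one_le_right n4 hm1
    have p5 : 0 ≤ |τ| * m := by positivity
    have q1 : (‖x‖ + ‖x'‖ + ‖h‖ + |t| + |τ| + 1) * m ≤ A * (m:ℝ) ^ μ :=
      (mul_le_mul_of_nonneg_right hA2 hm0.le).trans (mul_le_mul_of_nonneg_left hmμ hA0.le)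
    have q2 : (‖x‖ + ‖x'‖ + ‖h‖ + |t| + |τ| + 1) * m ≤ (A * (m:ℝ) ^ μ) ^ (2 * s) :=
      (mul_le_mul_of_nonneg_right hA3 hm0.le).trans hRs
    have q3 : m * τ = - (|τ| * m) := by rw [abs_of_neg hτ]; ring
    have q4 := neg_abs_le t
    simp only [add_mul, one_mul] at q1 q2
    have ht1 : -((A * (m:ℝ) ^ μ) ^ (2 * s)) < t := by linarith
    have ht2 : -((A * (m:ℝ) ^ μ) ^ (2 * s)) < t + m * τ := by linarith
    have ht3 : t + m * τ < 0 := by linarith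
    have hsm : ‖(m:ℝ) • h‖ = ‖h‖ * m := by rw [norm_smul, Real.norm_of_nonneg hm0.le, mul_comm]
    have hx1 : ‖x‖ < A * (m:ℝ) ^ μ := by linarith
    have hx2 : ‖x'‖ < A * (m:ℝ) ^ μ := by linarith
    have hx3 : ‖x + (m:ℝ) • h‖ < A * (m:ℝ) ^ μ := by
      have := norm_add_le x ((m:ℝ) • h)
      linarith
    have hx4 : ‖x' + (m:ℝ) • h‖ < A * (m:ℝ) ^ μ := by
      have := norm_add_le x' ((m:ℝ) • h)
      linarith
    have b1 := hW (A * (m:ℝ) ^ μ) hR1 t x t x' ht1 ht ht1 ht hx1 hx2 hx hx'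
    have b2 := hW (A * (m:ℝ) ^ μ) hR1 (t + m * τ) (x + (m:ℝ) • h) (t + m * τ) (x' + (m:ℝ) • h) ht2 ht3 ht2 ht3 hx3 hx4
      (by rw [lastC_add, lastC_smul, hh]; linarith) (by rw [lastC_add, lastC_smul, hh]; linarith)
    have hz : (0:ℝ) ^ (β / (2 * s)) = 0 := Real.zero_rpow (by positivity)
    rw [add_sub_add_right_eq_sub x] at b2
    rw [sub_self, abs_zero, hz, zero_add] at b1 b2
    rw [Real.mul_rpow hA0.le (by positivity), ← Real.rpow_mul hm0.le, mul_comm μ α] at b1 b2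
    have e1 : (m:ℝ) * |W (t + τ) (x + h) - W t x - (W (t + τ) (x' + h) - W t x')| =
        |(W (t + m * τ) (x + (m:ℝ) • h) - W (t + m * τ) (x' + (m:ℝ) • h)) - (W t x - W t x')| := by
      rw [← abs_of_pos hm0, ← abs_mul, abs_of_pos hm0]
      congr 1; linear_combination i2 - i1
    rw [e1]
    refine (abs_sub _ _).trans ?_
    linarith
  linarith

theorem ST2b {n : ℕ} {s β α C : ℝ} (hs : s ∈ Ioo (0:ℝ) 1) (hα : α ∈ Ioo 0 s) (hβ : 0 < β) (hαβ : α + β < 2 * s) (hC : 0 < C)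
    {W : ℝ → En n → ℝ} (hW : WH s β α C W)
    (hinv : ∀ τ < 0, ∀ h, lastC h = 0 → ∀ t < 0, ∀ t' < 0, ∀ x x', 0 < lastC x → lastC x = lastC x' →
      W (t + τ) (x + h) - W t x = W (t' + τ) (x' + h) - W t' x')
    {τ : ℝ} (hτ : τ < 0) {t : ℝ} (ht : t < 0) {x : En n} (hx : 0 < lastC x) :
    W (t + τ) x = W t x := by
  have hs0 := hs.1
  have hh : lastC (0 : En n) = 0 := lastC_zero
  obtain ⟨A, hA1, hA2, hA3⟩ := cc_exists2 hs0 (‖x‖ + |t| + |τ| + 1)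
  have hA0 : 0 < A := by linarith
  have e : W (t + τ) (x + 0) - W t x = 0 := by
    apply sublin (K := C * A ^ α * |τ| ^ (β / (2 * s))) (θ := (α + β) / (2 * s)) (by rw [div_lt_one (by positivity)]; exact hαβ)
    intro m hm
    have hm1 : (1:ℝ) ≤ m := by exact_mod_cast hm
    have hm0 : (0:ℝ) < m := by linarith
    have i1 := iterD hinv hτ hh ht hx m
    rw [smul_zero] at i1
    have hm2 : 1 ≤ (m:ℝ) ^ (1 / (2 * s)) := Real.one_le_rpow hm1 (by positivity)
    have hR1 : 1 ≤ A * (m:ℝ) ^ (1 / (2 * s)) := by nlinarith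
    have hRs : (A * (m:ℝ) ^ (1 / (2 * s))) ^ (2 * s) = A ^ (2 * s) * m := by
      rw [Real.mul_rpow hA0.le (by positivity), ← Real.rpow_mul hm0.le, one_div_mul_cancel (by positivity), Real.rpow_one]
    have n1 := norm_nonneg x
    have n4 := abs_nonneg t
    have n5 := abs_nonneg τ
    have ht1 : -((A * (m:ℝ) ^ (1 / (2 * s))) ^ (2 * s)) < t := by
      rw [hRs]
      have := neg_abs_le t
      nlinarith
    have ht2 : -((A * (m:ℝ) ^ (1 / (2 * s))) ^ (2 * s)) < t + m * τ := by
      rw [hRs]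
      have := neg_abs_le t
      have h2 := neg_abs_le τ
      nlinarith
    have ht3 : t + m * τ < 0 := by nlinarith
    have hx1 : ‖x‖ < A * (m:ℝ) ^ (1 / (2 * s)) := by nlinarith
    have b1 := hW (A * (m:ℝ) ^ (1 / (2 * s))) hR1 (t + m * τ) x t x ht2 ht3 ht1 ht hx1 hx1 hx hx
    rw [sub_self, norm_zero, Real.zero_rpow hβ.ne', add_zero, add_sub_cancel_left, abs_mul, abs_of_pos hm0,
      Real.mul_rpow hm0.le (abs_nonneg _), Real.mul_rpow hA0.le (by positivity), ← Real.rpow_mul hm0.le] at b1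
    have e1 : (m:ℝ) * |W (t + τ) (x + 0) - W t x| = |W (t + m * τ) x - W t x| := by
      rw [← abs_of_pos hm0, ← abs_mul, abs_of_pos hm0]
      congr 1; simp only [add_zero] at i1 ⊢; linarith
    rw [e1]
    refine b1.trans (le_of_eq ?_)
    rw [show (α + β) / (2 * s) = 1 / (2 * s) * α + β / (2 * s) by field_simp, Real.rpow_add hm0]
    ring
  rw [add_zero] at e
  linarith

theorem ST2 {n : ℕ} {s β α C : ℝ} (hn : 0 < n) (hs : s ∈ Ioo (0:ℝ) 1) (hα : α ∈ Ioo 0 s) (hβ : 0 < β) (hαβ : α + β < 2 * s) (hC : 0 < C)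
    {W : ℝ → En n → ℝ} (hW : WH s β α C W)
    (hinv : ∀ τ < 0, ∀ h, lastC h = 0 → ∀ t < 0, ∀ t' < 0, ∀ x x', 0 < lastC x → lastC x = lastC x' →
      W (t + τ) (x + h) - W t x = W (t' + τ) (x' + h) - W t' x') :
    ∃ (P : En n →L[ℝ] ℝ) (F : ℝ → ℝ), P (eLast n) = 0 ∧
      (∀ t < 0, ∀ x, 0 < lastC x → W t x = P x + F (lastC x)) ∧
      (∀ R : ℝ, 1 ≤ R → ∀ r r' : ℝ, 0 < r → r < R → 0 < r' → r' < R → |F r - F r'| ≤ C * R ^ α * |r - r'| ^ β) := by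
  have hs0 := hs.1
  have htind : ∀ t < 0, ∀ t' < 0, ∀ x : En n, 0 < lastC x → W t x = W t' x := by
    intro t ht t' ht' x hx
    have key : ∀ t < 0, ∀ t' < 0, t' < t → W t' x = W t x := by
      intro t ht t' ht' h
      have := ST2b hs hα hβ hαβ hC hW hinv (τ := t' - t) (by linarith) ht hx
      rwa [add_sub_cancel] at this
    rcases lt_trichotomy t t' with h | h | h
    · exact key t' ht' t ht h
    · rw [h]
    · exact (key t ht t' ht' h).symm
  set V : En n → ℝ := W (-(1/2)) with hV
  have hVe : ∀ t < 0, ∀ x, 0 < lastC x → W t x = V x := fun t ht x hx => htind t ht _ (by norm_num) x hx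
  have hVinv : ∀ h : En n, lastC h = 0 → ∀ x x' : En n, 0 < lastC x → 0 < lastC x' → V (x + h) - V x = V (x' + h) - V x' := by
    intro h hh x x' hx hx'
    have := ST2a hs hα hβ hC hW hinv (τ := -1) (by norm_num) hh (t := -(1/2)) (by norm_num) hx hx'
    rw [hVe _ (by norm_num) (x + h) (by rw [lastC_add, hh]; linarith), hVe _ (by norm_num) (x' + h) (by rw [lastC_add, hh]; linarith)] at this
    exact this
  have hVH : ∀ R : ℝ, 1 ≤ R → ∀ x x' : En n, ‖x‖ < R → ‖x'‖ < R → 0 < lastC x → 0 < lastC x' →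
      |V x - V x'| ≤ C * R ^ α * ‖x - x'‖ ^ β := by
    intro R hR x x' h1 h2 h3 h4
    have hR2 : 1 ≤ R ^ (2 * s) := Real.one_le_rpow hR (by positivity)
    have := hW R hR (-(1/2)) x (-(1/2)) x' (by linarith) (by norm_num) (by linarith) (by norm_num) h1 h2 h3 h4
    rw [sub_self, abs_zero, Real.zero_rpow (by positivity), zero_add] at this
    exact this
  set e := eLast n with he
  have hle : lastC e = 1 := lastC_eLast hn
  have hne : ‖e‖ = 1 := norm_eLast hn
  set pr : En n → En n := fun x => x - lastC x • e with hpr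
  have hpr0 : ∀ x, lastC (pr x) = 0 := by intro x; simp only [hpr]; rw [lastC_sub, lastC_smul, hle]; ring
  have hpradd : ∀ x y, pr (x + y) = pr x + pr y := by
    intro x y; simp only [hpr]; rw [lastC_add, add_smul]; abel
  set c : En n → ℝ := fun x => V (e + pr x) - V e with hc
  have hcadd : ∀ x y, c (x + y) = c x + c y := by
    intro x y
    simp only [hc]; rw [hpradd]
    have := hVinv (pr y) (hpr0 y) (e + pr x) e (by rw [lastC_add, hpr0, hle]; norm_num) (by rw [hle]; norm_num)
    rw [← add_assoc]; linarith
  have hcc : Continuous c := by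
    have hprc : Continuous pr := by
      simp only [hpr]; exact continuous_id.sub (continuous_lastC.smul continuous_const)
    rw [continuous_iff_continuousAt]
    intro x
    have hbd : ∀ᶠ y in 𝓝 x, |c y - c x| ≤ C * (3 + ‖pr x‖) ^ α * ‖pr y - pr x‖ ^ β := by
      have : ∀ᶠ y in 𝓝 x, ‖pr y‖ < 1 + ‖pr x‖ := (hprc.norm.tendsto x).eventually_lt_const (by linarith)
      filter_upwards [this] with y hy
      have := hVH (3 + ‖pr x‖) (by linarith [norm_nonneg (pr x)]) (e + pr y) (e + pr x)
        (by have := norm_add_le e (pr y); linarith) (by have := norm_add_le e (pr x); linarith)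
        (by rw [lastC_add, hpr0, hle]; norm_num) (by rw [lastC_add, hpr0, hle]; norm_num)
      rw [add_sub_add_left_eq_sub] at this
      simp only [hc]
      rw [sub_sub_sub_cancel_right]; exact this
    have hlim : Tendsto (fun y => C * (3 + ‖pr x‖) ^ α * ‖pr y - pr x‖ ^ β) (𝓝 x) (𝓝 0) := by
      have h1 : Continuous (fun y => C * (3 + ‖pr x‖) ^ α * ‖pr y - pr x‖ ^ β) :=
        continuous_const.mul ((hprc.sub continuous_const).norm.rpow_const (fun _ => Or.inr hβ.le))
      have := h1.tendsto x
      simpa [Real.zero_rpow hβ.ne'] using this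
    have h2 : Tendsto (fun y => c y - c x) (𝓝 x) (𝓝 0) := squeeze_zero_norm' hbd hlim
    have h3 := h2.add_const (c x)
    rw [zero_add] at h3
    simp only [sub_add_cancel] at h3
    exact h3
  let φ : En n →+ ℝ := AddMonoidHom.mk' c hcadd
  refine ⟨φ.toRealLinearMap hcc, fun r => V (r • e), ?_, ?_, ?_⟩
  · show c e = 0
    simp only [hc, hpr]; rw [hle, one_smul, sub_self, add_zero, sub_self]
  · intro t ht x hx
    rw [hVe t ht x hx]
    show V x = c x + V (lastC x • e)
    have := hVinv (pr x) (hpr0 x) (lastC x • e) e (by rw [lastC_smul, hle]; linarith) (by rw [hle]; norm_num)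
    have hx' : lastC x • e + pr x = x := by simp only [hpr]; abel
    rw [hx'] at this
    simp only [hc]; linarith
  · intro R hR r r' h1 h2 h3 h4
    have hnn : ∀ r : ℝ, ‖r • e‖ = |r| := by intro r; rw [norm_smul, hne, mul_one, Real.norm_eq_abs]
    have := hVH R hR (r • e) (r' • e) (by rw [hnn, abs_of_pos h1]; exact h2) (by rw [hnn, abs_of_pos h3]; exact h4)
      (by rw [lastC_smul, hle]; linarith) (by rw [lastC_smul, hle]; linarith)
    rwa [← sub_smul, hnn] at this


theorem WB {n : ℕ} {s β α C : ℝ} (hn : 0 < n) (hs : s ∈ Ioo (0:ℝ) 1) (hα : 0 < α) (hβ : 0 < β) (hC : 0 < C)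
    {W : ℝ → En n → ℝ} (hW : WH s β α C W) :
    ∃ C2 > 0, ∀ R : ℝ, 1 ≤ R → ∀ t x, -(R ^ (2 * s)) < t → t < 0 → ‖x‖ < R → 0 < lastC x →
      |W t x| ≤ C2 * R ^ (α + β) := by
  have hs0 := hs.1
  set e := eLast n with he
  have hle : lastC e = 1 := lastC_eLast hn
  have hne : ‖e‖ = 1 := norm_eLast hn
  refine ⟨|W (-(1/2)) ((1/2:ℝ) • e)| + C * (1 + 2 ^ β), by positivity, ?_⟩
  intro R hR t x h1 h2 h3 h4
  have hR0 : 0 < R := by linarith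
  have hR2 : 1 ≤ R ^ (2 * s) := Real.one_le_rpow hR (by positivity)
  have hn2 : ‖(1/2:ℝ) • e‖ = 1/2 := by rw [norm_smul, hne]; norm_num
  have := hW R hR t x (-(1/2)) ((1/2:ℝ) • e) h1 h2 (by linarith) (by norm_num) h3 (by rw [hn2]; linarith) h4
    (by rw [lastC_smul, hle]; norm_num)
  have b1 : |t - -(1/2)| ^ (β / (2 * s)) ≤ R ^ β := by
    calc |t - -(1/2)| ^ (β / (2 * s)) ≤ (R ^ (2 * s)) ^ (β / (2 * s)) := by
          apply Real.rpow_le_rpow (abs_nonneg _) _ (by positivity)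
          rw [abs_le]; constructor <;> linarith
      _ = R ^ β := by rw [← Real.rpow_mul hR0.le]; congr 1; field_simp
  have b2 : ‖x - (1/2:ℝ) • e‖ ^ β ≤ 2 ^ β * R ^ β := by
    rw [← Real.mul_rpow (by norm_num) hR0.le]
    apply Real.rpow_le_rpow (norm_nonneg _) _ hβ.le
    have := norm_sub_le x ((1/2:ℝ) • e)
    linarith
  have b3 : |W t x| ≤ |W (-(1/2)) ((1/2:ℝ) • e)| + |W t x - W (-(1/2)) ((1/2:ℝ) • e)| := by
    have := abs_add_le (W (-(1/2)) ((1/2:ℝ) • e)) (W t x - W (-(1/2)) ((1/2:ℝ) • e))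
    rwa [add_sub_cancel] at this
  have b4 : 1 ≤ R ^ (α + β) := Real.one_le_rpow hR (by positivity)
  calc |W t x| ≤ _ := b3
    _ ≤ |W (-(1/2)) ((1/2:ℝ) • e)| * R ^ (α + β) + C * R ^ α * (R ^ β + 2 ^ β * R ^ β) := by
      refine add_le_add (le_mul_of_one_le_right (abs_nonneg _) b4) (this.trans ?_)
      gcongr
    _ = _ := by rw [Real.rpow_add hR0]; ring

theorem WCONT {n : ℕ} {s β α C : ℝ} (hn : 0 < n) (hs : s ∈ Ioo (0:ℝ) 1) (hα : 0 < α) (hβ : 0 < β) (hC : 0 < C)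
    {W w : ℝ → En n → ℝ} (hW : WH s β α C W) (hw : ∀ t < 0, ∀ x, w t x = gs s (lastC x) * W t x) :
    ContinuousOn (fun p : ℝ × En n => w p.1 p.2) (Iio 0 ×ˢ univ) := by
  have hs0 := hs.1
  obtain ⟨C2, hC2, hWB⟩ := WB hn hs hα hβ hC hW
  rintro ⟨t0, x0⟩ ⟨ht0, -⟩
  have ht0 : t0 < 0 := ht0
  apply ContinuousAt.continuousWithinAt
  obtain ⟨R, hR1, hR2, hR3⟩ := cc_exists2 hs0 (‖x0‖ + |t0| + 1)
  have n1 := norm_nonneg x0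
  have n2 := abs_nonneg t0
  have n3 := neg_abs_le t0
  have hgc : Continuous (fun p : ℝ × En n => gs s (lastC p.2)) := (gs_cont hs0).comp (continuous_lastC.comp continuous_snd)
  have ev1 : ∀ᶠ p : ℝ × En n in 𝓝 (t0, x0), p.1 < 0 := continuous_fst.continuousAt.eventually_lt_const ht0
  have ev2 : ∀ᶠ p : ℝ × En n in 𝓝 (t0, x0), -(R ^ (2 * s)) < p.1 :=
    continuous_fst.continuousAt.eventually_const_lt (by show _ < t0; linarith)
  have ev3 : ∀ᶠ p : ℝ × En n in 𝓝 (t0, x0), ‖p.2‖ < R :=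
    continuous_snd.norm.continuousAt.eventually_lt_const (by show ‖x0‖ < _; linarith)
  rcases le_or_gt (lastC x0) 0 with h | h
  · have hz : w t0 x0 = 0 := by rw [hw t0 ht0, gs_neg hs0 h, zero_mul]
    show Tendsto _ _ (𝓝 (w t0 x0))
    rw [hz]
    apply squeeze_zero_norm' (a := fun p : ℝ × En n => gs s (lastC p.2) * (C2 * R ^ (α + β)))
    · filter_upwards [ev1, ev2, ev3] with p h1 h2 h3
      rw [hw p.1 h1, norm_mul, Real.norm_of_nonneg gs_nonneg]
      rcases le_or_gt (lastC p.2) 0 with h' | h'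
      · rw [gs_neg hs0 h']; simp
      · exact mul_le_mul_of_nonneg_left (hWB R hR1 p.1 p.2 h2 h1 h3 h') gs_nonneg
    · have hcm : Continuous (fun p : ℝ × En n => gs s (lastC p.2) * (C2 * R ^ (α + β))) := hgc.mul continuous_const
      have := hcm.tendsto (t0, x0)
      simpa only [gs_neg hs0 h, zero_mul] using this
  · have ev4 : ∀ᶠ p : ℝ × En n in 𝓝 (t0, x0), 0 < lastC p.2 :=
      (continuous_lastC.comp continuous_snd).continuousAt.eventually_const_lt h
    have hWc : ContinuousAt (fun p : ℝ × En n => W p.1 p.2) (t0, x0) := by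
      have hl : Tendsto (fun p : ℝ × En n => W p.1 p.2 - W t0 x0) (𝓝 (t0, x0)) (𝓝 0) := by
        apply squeeze_zero_norm' (a := fun p : ℝ × En n => C * R ^ α * (|p.1 - t0| ^ (β / (2 * s)) + ‖p.2 - x0‖ ^ β))
        · filter_upwards [ev1, ev2, ev3, ev4] with p h1 h2 h3 h4
          exact hW R hR1 p.1 p.2 t0 x0 h2 h1 (by linarith) ht0 h3 (by linarith) h4 h
        · have hβs : 0 < β / (2 * s) := by positivity
          have hc : Continuous (fun p : ℝ × En n => C * R ^ α * (|p.1 - t0| ^ (β / (2 * s)) + ‖p.2 - x0‖ ^ β)) := by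
            refine continuous_const.mul (Continuous.add ?_ ?_)
            · exact ((continuous_fst.sub continuous_const).abs).rpow_const (fun _ => Or.inr hβs.le)
            · exact ((continuous_snd.sub continuous_const).norm).rpow_const (fun _ => Or.inr hβ.le)
          have := hc.tendsto (t0, x0)
          simpa [Real.zero_rpow hβ.ne', Real.zero_rpow hβs.ne'] using this
      have h3 := hl.add_const (W t0 x0)
      rw [zero_add] at h3
      simp only [sub_add_cancel] at h3
      exact h3
    refine (hgc.continuousAt.mul hWc).congr ?_
    filter_upwards [ev1] with p h1
    exact (hw p.1 h1 p.2).symm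

theorem ST12 (n : ℕ) (s γ β α lam Lam : ℝ)
    (hn : 0 < n) (hs : s ∈ Ioo (0 : ℝ) 1) (hγ : γ ∈ Ioo 0 s) (hβ : β ∈ Ioo γ 1)
    (hα : α = s + γ - β) (hα' : α ∈ Ioo 0 s)
    (hlam : 0 < lam) (hlL : lam ≤ Lam)
    (a : En n → ℝ) (ha : KernelBounds lam Lam a)
    (w : ℝ → En n → ℝ) (C : ℝ) (hC : 0 < C)
    (hbdry : ∀ t < (0 : ℝ), ∀ x : En n, lastC x ≤ 0 → w t x = 0)
    (heq : ∀ h : En n, 0 ≤ lastC h → ∀ τ < (0 : ℝ), ∀ t < (0 : ℝ), ∀ x : En n, 0 < lastC x →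
      SolvesAt n s a (fun t' x' => w (t' + τ) (x' + h) - w t' x') (fun _ _ => 0) t x)
    (hgrowth : ∀ R ≥ (1 : ℝ),
      ParHolderBnd s β (C * R ^ α) (Ioo (-(R ^ (2 * s))) 0)
        (ball (0 : En n) R ∩ {x | 0 < lastC x})
        (fun t x => w t x / max (lastC x) 0 ^ s)) :
    ∃ (a' : En n → ℝ) (P : En n →L[ℝ] ℝ) (F : ℝ → ℝ), KernelBounds lam Lam a' ∧ AM n a' ∧ P (eLast n) = 0 ∧
      (∀ t < 0, ∀ x, w t x = gs s (lastC x) * (P x + F (lastC x))) ∧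
      (∀ R : ℝ, 1 ≤ R → ∀ r r' : ℝ, 0 < r → r < R → 0 < r' → r' < R → |F r - F r'| ≤ C * R ^ α * |r - r'| ^ β) ∧
      (∀ k : ℝ, 0 ≤ k → ∀ x, 0 < lastC x →
        Integrable (Lintegrand n s a' (fun x => w (-1) (x + k • eLast n) - w (-1) x) x) ∧
        Lop n s a' (fun x => w (-1) (x + k • eLast n) - w (-1) x) x = 0) := by
  have hs0 := hs.1
  have hβ0 : 0 < β := by linarith [hβ.1, hγ.1]
  obtain ⟨a', ha', ham, hsame⟩ := AMEAS (s := s) hn hlL ha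
  set W : ℝ → En n → ℝ := fun t x => w t x / max (lastC x) 0 ^ s with hWdef
  have hW : WH s β α C W := by
    intro R hR t x t' x' h1 h2 h3 h4 h5 h6 h7 h8
    exact hgrowth R hR t ⟨h1, h2⟩ x ⟨by simpa using h5, h7⟩ t' ⟨h3, h4⟩ x' ⟨by simpa using h6, h8⟩
  have hw : ∀ t < 0, ∀ x, w t x = gs s (lastC x) * W t x := by
    intro t ht x
    rcases le_or_gt (lastC x) 0 with h | h
    · rw [gs_neg hs0 h, zero_mul, hbdry t ht x h]
    · have : 0 < max (lastC x) 0 ^ s := by rw [max_eq_left h.le]; positivity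
      simp only [hWdef, gs]; field_simp
  have hwc := WCONT hn hs hα'.1 hβ0 hC hW hw
  have heq' : ∀ h : En n, 0 ≤ lastC h → ∀ τ < (0 : ℝ), ∀ t < (0 : ℝ), ∀ x : En n, 0 < lastC x →
      SolvesAt n s a' (fun t' x' => w (t' + τ) (x' + h) - w t' x') (fun _ _ => 0) t x := by
    intro h hh τ hτ t ht x hx
    obtain ⟨h1, h2⟩ := heq h hh τ hτ t ht x hx
    have hc1 : Continuous (w t) := cont_slice hwc ht
    have hc2 : Continuous (w (t + τ)) := cont_slice hwc (by show t + τ < 0; linarith)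
    have hcu : Continuous (fun x' => w (t + τ) (x' + h) - w t x') := (hc2.comp (by fun_prop)).sub hc1
    have hsm := hsame (fun x' => w (t + τ) (x' + h) - w t x') x hcu h1
    refine ⟨by rw [hsm]; exact h1, ?_⟩
    have : Lop n s a' (fun x' => w (t + τ) (x' + h) - w t x') x = Lop n s a (fun x' => w (t + τ) (x' + h) - w t x') x := by
      unfold Lop; rw [hsm]
    simp only [this]; exact h2
  have hinv : ∀ τ < 0, ∀ h, lastC h = 0 → ∀ t < 0, ∀ t' < 0, ∀ x x', 0 < lastC x → lastC x = lastC x' →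
      W (t + τ) (x + h) - W t x = W (t' + τ) (x' + h) - W t' x' := by
    intro τ hτ h hh t ht t' ht' x x' hx hxx
    have hgl : ∀ x, lastC (x + h) = lastC x := fun x => by rw [lastC_add, hh, add_zero]
    obtain ⟨c, hc1, hc2, hc3⟩ := cc_exists2 hs0 (1 + ‖h‖ + |τ|)
    have n1 := norm_nonneg h
    have n2 := abs_nonneg τ
    have hc0 : 0 < c := by linarith
    have hue : ∀ t < 0, ∀ x, w (t + τ) (x + h) - w t x = gs s (lastC x) * (W (t + τ) (x + h) - W t x) := by
      intro t ht x; rw [hw _ (by linarith), hw t ht, hgl]; ring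
    obtain ⟨r1, r2⟩ := RIG hn hs hα' hlam hlL ha' ham (M := C * c ^ α * (|τ| ^ (β / (2 * s)) + ‖h‖ ^ β) + 1) (by positivity)
      (fun t' x' => w (t' + τ) (x' + h) - w t' x')
      ((hwc.comp (f := fun p : ℝ × En n => (p.1 + τ, p.2 + h)) (by fun_prop) (fun p hp => ⟨by
          have : p.1 < 0 := hp.1
          show p.1 + τ < 0
          linarith, mem_univ _⟩)).sub hwc)
      (fun t ht x hx => by rw [hbdry t ht x hx, hbdry (t + τ) (by linarith) _ (by rw [hgl]; exact hx), sub_zero])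
      (fun t ht x hx => heq' h hh.ge τ hτ t ht x hx)
      (by
        intro R hR t x h1 h2 h3
        have hR0 : 0 < R := by linarith
        rw [hue t h2, abs_mul, abs_of_nonneg gs_nonneg]
        rcases le_or_gt (lastC x) 0 with h' | h'
        · rw [gs_neg hs0 h']; simp
        have hR2 : 1 ≤ R ^ (2 * s) := Real.one_le_rpow hR (by positivity)
        have hcR : (1 + ‖h‖ + |τ|) * R ≤ c * R := mul_le_mul_of_nonneg_right hc2 hR0.le
        have hcR2 : (1 + ‖h‖ + |τ|) * R ^ (2 * s) ≤ (c * R) ^ (2 * s) := by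
          rw [Real.mul_rpow hc0.le hR0.le]; exact mul_le_mul_of_nonneg_right hc3 (by linarith)
        have p1 : ‖h‖ ≤ ‖h‖ * R := le_mul_of_one_le_right n1 hR
        have p2 : 0 ≤ |τ| * R := by positivity
        have p3 : 0 ≤ ‖h‖ * R ^ (2 * s) := by positivity
        have p4 : |τ| ≤ |τ| * R ^ (2 * s) := le_mul_of_one_le_right n2 hR2
        have p5 := neg_abs_le τ
        simp only [add_mul, one_mul] at hcR hcR2
        have := hW (c * R) (by nlinarith) (t + τ) (x + h) t x (by linarith) (by linarith) (by linarith) h2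
          (by have := norm_add_le x h; linarith) (by linarith) (by rw [hgl]; exact h') h'
        rw [add_sub_cancel_left, add_sub_cancel_left, Real.mul_rpow hc0.le hR0.le] at this
        have p6 : 0 ≤ gs s (lastC x) := gs_nonneg
        have p7 : 0 < R ^ α := by positivity
        calc gs s (lastC x) * |W (t + τ) (x + h) - W t x| ≤ gs s (lastC x) * (C * (c ^ α * R ^ α) * (|τ| ^ (β / (2 * s)) + ‖h‖ ^ β)) := by gcongr
          _ = (C * c ^ α * (|τ| ^ (β / (2 * s)) + ‖h‖ ^ β)) * gs s (lastC x) * R ^ α := by ring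
          _ ≤ _ := by gcongr; linarith)
    have k1 := r1 (x' - x) (by rw [lastC_sub]; linarith) t ht x
    have k2 := r2 t ht t' ht' x'
    rw [add_sub_cancel] at k1
    rw [hue t ht, hue t ht] at k1
    rw [hue t ht, hue t' ht'] at k2
    have hg : gs s (lastC x) ≠ 0 := by rw [gs_pos hx.le]; positivity
    rw [← hxx] at k1 k2
    have k3 := mul_left_cancel₀ hg k1
    have k4 := mul_left_cancel₀ hg k2
    linarith
  obtain ⟨P, F, hP, hPF, hF⟩ := ST2 hn hs hα' hβ0 (by rw [hα]; linarith [hγ.2]) hC hW hinv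
  have hwe : ∀ t < 0, ∀ x, w t x = gs s (lastC x) * (P x + F (lastC x)) := by
    intro t ht x
    rcases le_or_gt (lastC x) 0 with h | h
    · rw [gs_neg hs0 h, zero_mul, hbdry t ht x h]
    · rw [hw t ht, hPF t ht x h]
  refine ⟨a', P, F, ha', ham, hP, hwe, hF, ?_⟩
  intro k hk x hx
  have hke : 0 ≤ lastC (k • eLast n) := by rw [lastC_smul, lastC_eLast hn, mul_one]; exact hk
  obtain ⟨h1, h2⟩ := heq' (k • eLast n) hke (-1) (by norm_num) (-1) (by norm_num) x hx
  have e1 : (fun x' => w (-1 + -1) (x' + k • eLast n) - w (-1) x') = fun x' => w (-1) (x' + k • eLast n) - w (-1) x' := by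
    funext x'; rw [hwe (-1 + -1) (by norm_num), hwe (-1) (by norm_num) (x' + k • eLast n)]
  replace h1 : Integrable (Lintegrand n s a' (fun x' => w (-1 + -1) (x' + k • eLast n) - w (-1) x') x) := h1
  rw [e1] at h1
  refine ⟨h1, ?_⟩
  simp only [e1, add_zero] at h2
  have hcst : HasDerivAt (fun τ : ℝ => w (τ + -1) (x + k • eLast n) - w τ x) 0 (-1) := by
    refine (hasDerivAt_const (-1 : ℝ) (w (-1) (x + k • eLast n) - w (-1) x)).congr_of_eventuallyEq ?_
    filter_upwards [eventually_lt_nhds (by norm_num : (-1:ℝ) < 0)] with τ hτ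
    rw [hwe (τ + -1) (by linarith), hwe τ hτ, hwe (-1) (by norm_num), hwe (-1) (by norm_num)]
  exact h2.unique hcst


theorem d1_zero {g : ℝ → ℝ} {X : ℝ} : d1 g X 0 = 0 := by simp [d1]; ring

theorem RED {n : ℕ} (hn : 0 < n) {s lam Lam : ℝ} (hs : s ∈ Ioo (0:ℝ) 1) {a : En n → ℝ} (hlam : 0 < lam)
    (ha : KernelBounds lam Lam a) (ham : AM n a) {P : En n →L[ℝ] ℝ} {q k : ℝ} (hk : 0 ≤ k)
    (g : ℝ → ℝ) (hg : Measurable g) (x : En n) (hx : 0 < lastC x)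
    (hi : Integrable (Lintegrand n s a (fun z => qk s k (lastC z) * (P z + q) + g (lastC z)) x))
    (hl : Lop n s a (fun z => qk s k (lastC z) * (P z + q) + g (lastC z)) x = 0) :
    Int1 s g (lastC x) ∧ L1 s g (lastC x) = 0 := by
  have hs0 := hs.1
  set X := lastC x with hX
  set f : En n → ℝ := fun y => (P x + q) * d1 (qk s k) X (lastC y) + P y * (qk s k (X + lastC y) - qk s k (X - lastC y))
    + d1 g X (lastC y) with hf
  have e : Lintegrand n s a (fun z => qk s k (lastC z) * (P z + q) + g (lastC z)) x =
      fun y => f y * a (‖y‖⁻¹ • y) * JJ n s y := by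
    funext y
    rw [Lintegrand_eq]
    congr 2
    simp only [DD, hf, d1, lastC_add, lastC_sub, map_add, map_sub, ← hX]
    ring
  obtain ⟨hA1, hA2⟩ := factAq hs hx hk
  obtain ⟨hB1, hB2⟩ := factB hs hx hk
  have hK := POLK hn (s := s) f a
  unfold Lop at hl
  rw [e] at hi hl
  rw [hK.2] at hl
  have hpi := hK.1.1 hi
  set φ : ℝ → ℝ := fun ρ => ρ * (qk s k (X + ρ) - qk s k (X - ρ)) with hφ
  have hφe : ∀ ρ ∈ Ioi (0:ℝ), φ ρ * ρ ^ (-1 - 2 * s) = (qk s k (X + ρ) - qk s k (X - ρ)) * ρ ^ (-2 * s) := by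
    intro ρ hρ
    have hρ : 0 < ρ := hρ
    simp only [hφ]
    rw [show -2 * s = 1 + (-1 - 2 * s) by ring, Real.rpow_add hρ, Real.rpow_one]; ring
  have hφi : IntegrableOn (fun ρ => φ ρ * ρ ^ (-1 - 2 * s)) (Ioi 0) :=
    IntegrableOn.congr_fun hB1 (fun ρ hρ => (hφe ρ hρ).symm) measurableSet_Ioi
  have hφz : ∫ ρ in Ioi 0, φ ρ * ρ ^ (-1 - 2 * s) = 0 := by
    rw [setIntegral_congr_fun measurableSet_Ioi hφe]; exact hB2
  have hφev : ∀ r, φ (-r) = φ r := by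
    intro r; simp only [hφ]; rw [← sub_eq_add_neg, sub_neg_eq_add]; ring
  have hφ0 : φ 0 = 0 := by simp [hφ]
  -- the lower-order part of a slice
  have hlow : ∀ θ : Sp n,
      IntegrableOn (fun r => (f (r • (θ : En n)) - d1 g X (r * lastC (θ : En n))) * a θ * r ^ (-1 - 2 * s)) (Ioi 0) ∧
      ∫ r in Ioi 0, (f (r • (θ : En n)) - d1 g X (r * lastC (θ : En n))) * a θ * r ^ (-1 - 2 * s) = 0 := by
    intro θ
    set c := lastC (θ : En n) with hc
    have r1 := RAD hs0 (d1 (qk s k) X) d1_even d1_zero hA1 c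
    have r2 := RAD hs0 φ hφev hφ0 hφi c
    have e3 : (fun r => (f (r • (θ : En n)) - d1 g X (r * c)) * a θ * r ^ (-1 - 2 * s)) =
      fun r => (P x + q) * a θ * (d1 (qk s k) X (r * c) * r ^ (-1 - 2 * s)) + (P θ / c * a θ) * (φ (r * c) * r ^ (-1 - 2 * s)) := by
      funext r
      simp only [hf, hφ, lastC_smul, map_smul, smul_eq_mul, ← hc]
      rcases eq_or_ne c 0 with h | h
      · rw [h]; simp only [mul_zero, add_zero, sub_zero, sub_self, div_zero]; ring
      · field_simp; ring
    rw [e3]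
    refine ⟨(r1.1.const_mul _).add (r2.1.const_mul _), ?_⟩
    have z := integral_add (r1.1.const_mul ((P x + q) * a θ)) (r2.1.const_mul (P θ / c * a θ))
    rw [z, integral_const_mul, integral_const_mul, r1.2, r2.2, hφz]
    have hA2' := hA2
    unfold L1 at hA2'
    rw [hA2']; ring
  have hpi' := hpi
  rw [pm] at hpi'
  have hae := Integrable.prod_right_ae hpi'
  have hint1 : Int1 s g X := by
    obtain ⟨θ, hθ1, hθ2⟩ : ∃ θ : Sp n, lastC (θ : En n) ≠ 0 ∧
        Integrable (fun r => f (r • (θ : En n)) * a θ * r ^ (-1 - 2 * s)) (volume.restrict (Ioi 0)) := by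
      by_contra hcon
      push Not at hcon
      refine (sm_pos hn).ne' (measure_mono_null (fun θ hθ => ?_) hae)
      exact hcon θ hθ
    set c := lastC (θ : En n) with hc
    have haθ : a θ ≠ 0 := by have := (ha θ (Sp_norm θ)).1; linarith
    have h1 := (hθ2.sub (hlow θ).1).const_mul (a θ)⁻¹
    have h2 : IntegrableOn (fun r => d1 g X (r * c) * r ^ (-1 - 2 * s)) (Ioi 0) := by
      refine h1.congr (Eventually.of_forall fun r => ?_)
      simp only [Pi.sub_apply]; rw [← hc]; field_simp; ring
    have r3 := (RAD hs0 (fun ρ => d1 g X (ρ * c)) (fun r => by rw [neg_mul, d1_even]) (by rw [zero_mul, d1_zero]) h2 (1 / c)).1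
    unfold Int1
    refine r3.congr (Eventually.of_forall fun r => ?_)
    simp only
    rw [mul_assoc r, one_div_mul_cancel hθ1, mul_one]
  refine ⟨hint1, ?_⟩
  have hS := SLG hn hs0 hlam ha ham (d1 g X) (by
    unfold d1
    exact ((hg.comp (by fun_prop)).add (hg.comp (by fun_prop))).sub_const _) d1_even d1_zero hint1
  have hK2 := POLK hn (s := s) (fun y => d1 g X (lastC y)) a
  have hpi2 := hK2.1.1 hS.1
  rw [hK2.2] at hS
  have hEq : ∫ p, f (p.2 • (p.1 : En n)) * a p.1 * p.2 ^ (-1 - 2 * s) ∂(pm n) =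
      ∫ p, d1 g X (lastC (p.2 • (p.1 : En n))) * a p.1 * p.2 ^ (-1 - 2 * s) ∂(pm n) := by
    have z1 := integral_prod _ hpi'
    have hpi2' := hpi2
    rw [pm] at hpi2'
    have z2 := integral_prod _ hpi2'
    rw [pm, z1, z2]
    apply integral_congr_ae
    filter_upwards [hae] with θ hθ
    have h1 := integral_sub hθ (hlow θ).1
    rw [(hlow θ).2, sub_zero] at h1
    rw [← h1]
    congr 1; funext r
    simp only [lastC_smul]; ring
  rw [hEq, hS.2] at hl
  have hca := ca_pos hn hs0 hlam ha ham
  rcases mul_eq_zero.1 hl with h | h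
  · exact absurd h hca.ne'
  · exact h


/-- one dimensional maximum principle -/
theorem MP1 {s : ℝ} (hs : s ∈ Ioo (0:ℝ) 1) (G : ℝ → ℝ) (hG : Continuous G)
    (hL : ∀ X, 0 < X → Int1 s G X ∧ L1 s G X = 0) (h0 : ∀ r ≤ 0, G r ≤ 0)
    (hinf : ∀ δ > 0, ∃ R, ∀ r, R ≤ r → G r ≤ δ * gs s r) (r : ℝ) : G r ≤ 0 := by
  have key : ∀ δ > 0, ∀ r, G r ≤ δ * gs s r := by
    intro δ hδ
    by_contra hcon
    push Not at hcon
    obtain ⟨r0, hr0⟩ := hcon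
    obtain ⟨R, hR⟩ := hinf δ hδ
    set H : ℝ → ℝ := fun x => 1 * G x + (-δ) * gs s x with hH
    have hHc : Continuous H := by
      have := gs_cont hs.1
      fun_prop
    have hH0 : ∀ r ≤ 0, H r ≤ 0 := by
      intro r hr
      have := h0 r hr
      have h2 := gs_nonneg (s := s) (x := r)
      simp only [hH]; nlinarith
    have hHR : ∀ r, R ≤ r → H r ≤ 0 := by
      intro r hr
      have := hR r hr
      simp only [hH]; linarith
    have hr0p : 0 < H r0 := by simp only [hH]; linarith
    have hr01 : 0 < r0 := by
      by_contra h; push Not at h; linarith [hH0 r0 h]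
    have hr02 : r0 < R := by
      by_contra h; push Not at h; linarith [hHR r0 h]
    obtain ⟨X, hX, hmax⟩ := isCompact_Icc.exists_isMaxOn (s := Icc 0 R) ⟨r0, hr01.le, hr02.le⟩ hHc.continuousOn
    have hXm : H r0 ≤ H X := hmax ⟨hr01.le, hr02.le⟩
    have hXp : 0 < H X := by linarith
    have hXpos : 0 < X := by
      by_contra h; push Not at h; linarith [hH0 X h]
    have hglob : ∀ z, H z ≤ H X := by
      intro z
      rcases le_or_gt z 0 with h | h
      · linarith [hH0 z h]
      rcases le_or_gt R z with h' | h'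
      · linarith [hHR z h']
      exact hmax ⟨h.le, h'.le⟩
    obtain ⟨hi, hl⟩ := Int1.comb 1 (-δ) (hL X hXpos).1 (factA hs hXpos).1
    rw [(hL X hXpos).2, (factA hs hXpos).2] at hl
    have hl' : L1 s H X = 0 := by rw [hH, hl]; ring
    have hi' : Int1 s H X := hi
    set A := max X R with hA
    have hA0 : 0 < A := lt_of_lt_of_le hXpos (le_max_left _ _)
    have hneg : ∀ ρ ∈ Ioi (0:ℝ), 0 ≤ -(d1 H X ρ * ρ ^ (-1 - 2 * s)) := by
      intro ρ hρ
      have hρ' : 0 < ρ := hρ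
      have h1 := hglob (X + ρ)
      have h2 := hglob (X - ρ)
      have h3 : 0 < ρ ^ (-1 - 2 * s) := Real.rpow_pos_of_pos hρ' _
      unfold d1
      nlinarith
    have hz : ∫ ρ in Ioi 0, -(d1 H X ρ * ρ ^ (-1 - 2 * s)) = 0 := by
      rw [integral_neg]; unfold L1 at hl'; rw [hl', neg_zero]
    rw [setIntegral_eq_zero_iff_of_nonneg_ae (ae_restrict_of_forall_mem measurableSet_Ioi hneg) (Integrable.neg hi')] at hz
    have hz2 : ∀ᵐ ρ ∂(volume.restrict (Ioi A)), -(d1 H X ρ * ρ ^ (-1 - 2 * s)) = 0 :=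
      ae_mono (Measure.restrict_mono (Ioi_subset_Ioi hA0.le) le_rfl) hz
    have hz3 : ∀ᵐ ρ ∂(volume.restrict (Ioi A)), False := by
      filter_upwards [hz2, ae_restrict_mem measurableSet_Ioi] with ρ h1 h2
      have h2' : A < ρ := h2
      have h3 : 0 < ρ ^ (-1 - 2 * s) := Real.rpow_pos_of_pos (hA0.trans h2') _
      have h4 := hHR (X + ρ) (by linarith [le_max_right X R])
      have h5 := hH0 (X - ρ) (by linarith [le_max_left X R])
      unfold d1 at h1
      nlinarith
    rw [ae_restrict_iff' measurableSet_Ioi] at hz3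
    have : volume (Ioi A) = 0 := by
      have h := hz3
      rw [ae_iff] at h
      convert h using 2; ext x; simp
    simp at this
  by_contra hr
  push Not at hr
  have hgn := gs_nonneg (s := s) (x := r)
  have := key (G r / (2 * (gs s r + 1))) (by positivity) r
  have h2 : G r / (2 * (gs s r + 1)) * gs s r ≤ G r / 2 := by
    rw [div_mul_eq_mul_div, div_le_div_iff₀ (by positivity) (by positivity)]
    nlinarith
  linarith

/-- the class of one dimensional functions under study -/
def GG (s c0 : ℝ) (G : ℝ → ℝ) : Prop :=
  Continuous G ∧ (∀ X, 0 < X → Int1 s G X ∧ L1 s G X = 0) ∧ (∀ r ≤ -c0, G r = 0) ∧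
  (∀ h > 0, ∀ δ > 0, ∃ R, ∀ r, R ≤ r → |G (r + h) - G r| ≤ δ * gs s r)

theorem GG.neg {s c0 : ℝ} {G : ℝ → ℝ} (h : GG s c0 G) : GG s c0 (fun r => - G r) := by
  obtain ⟨h1, h2, h3, h4⟩ := h
  refine ⟨h1.neg, ?_, ?_, ?_⟩
  · intro X hX
    obtain ⟨h5, h6⟩ := Int1.comb (-1) 0 (h2 X hX).1 (h2 X hX).1
    have e : (fun x => -1 * G x + 0 * G x) = fun x => - G x := by ext; ring
    rw [e] at h5 h6
    exact ⟨h5, by rw [h6, (h2 X hX).2]; ring⟩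
  · intro r hr; show - G r = 0; rw [h3 r hr, neg_zero]
  · intro h hh δ hδ
    obtain ⟨R, hR⟩ := h4 h hh δ hδ
    refine ⟨R, fun r hr => ?_⟩
    rw [← abs_neg]
    convert hR r hr using 2; ring

theorem gs_large {s : ℝ} (hs : 0 < s) (K : ℝ) {δ : ℝ} (hδ : 0 < δ) : ∃ R, 0 < R ∧ ∀ r, R ≤ r → K ≤ δ * gs s r := by
  refine ⟨(max (K / δ) 1) ^ (1 / s), by positivity, fun r hr => ?_⟩
  have h1 : gs s ((max (K / δ) 1) ^ (1 / s)) = max (K / δ) 1 := by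
    rw [gs_pos (by positivity), ← Real.rpow_mul (by positivity), one_div_mul_cancel hs.ne', Real.rpow_one]
  have h2 := gs_mono hs hr
  rw [h1] at h2
  have : K / δ ≤ gs s r := (le_max_left _ _).trans h2
  rw [div_le_iff₀ hδ] at this
  linarith

theorem gs_add_le {s x y : ℝ} (hs : s ∈ Ioo (0:ℝ) 1) (hy : 0 ≤ y) : gs s (x + y) ≤ gs s x + gs s y := by
  rcases le_or_gt x 0 with h | h
  · have := gs_mono hs.1 (show x + y ≤ y by linarith)
    linarith [gs_nonneg (s := s) (x := x)]
  · rw [gs_pos h.le, gs_pos hy, gs_pos (by linarith)]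
    exact Real.rpow_add_le_add_rpow h.le hy hs.1.le hs.2.le

theorem qk_le {s k x : ℝ} (hs : s ∈ Ioo (0:ℝ) 1) (hk : 0 ≤ k) : qk s k x ≤ gs s k := by
  unfold qk; linarith [gs_add_le (x := x) hs hk]

/-- key increment comparison -/
theorem KI0 {s c0 c e h : ℝ} {G : ℝ → ℝ} (hs : s ∈ Ioo (0:ℝ) 1) (hG : GG s c0 G) (hc0 : 0 < c0) (hh : c0 ≤ h)
    (he : 0 ≤ e) (h1 : ∀ r, -c0 ≤ r → r ≤ 0 → |G r| ≤ e) (h2 : ∀ r, 0 < r → r ≤ h → G r ≤ c * gs s r + e) (r : ℝ) :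
    G (r + h) - G r ≤ c * qk s h r + 2 * e / gs s h * qk s (3 * h) r := by
  have hs0 := hs.1
  have hh0 : 0 < h := by linarith
  obtain ⟨g1, g2, g3, g4⟩ := hG
  have hgh : 0 < gs s h := by rw [gs_pos hh0.le]; positivity
  set D : ℝ → ℝ := fun r => 1 * (1 * G (r + h) + (-1) * G r) + (-1) * (c * qk s h r + 2 * e / gs s h * qk s (3 * h) r) with hD
  suffices h : D r ≤ 0 by simp only [hD] at h; linarith
  have h1' : ∀ r ≤ 0, |G r| ≤ e := by
    intro r hr
    rcases le_total (-c0) r with h | h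
    · exact h1 r h hr
    · rw [g3 r h]; simpa using he
  refine MP1 hs D ?_ ?_ ?_ ?_ r
  · have a := qk_cont (k := h) hs0
    have b := qk_cont (k := 3 * h) hs0
    fun_prop
  · intro X hX
    have a1 := Int1.shift (g := G) (k := h) (g2 (X + h) (by linarith)).1
    have a2 := Int1.comb 1 (-1) a1.1 (g2 X hX).1
    have a3 := factAq hs hX hh0.le
    have a4 := factAq hs hX (show 0 ≤ 3 * h by linarith)
    have a5 := Int1.comb c (2 * e / gs s h) a3.1 a4.1
    have a6 := Int1.comb 1 (-1) a2.1 a5.1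
    refine ⟨a6.1, a6.2.trans ?_⟩
    rw [a2.2, a5.2, a1.2, a3.2, a4.2, (g2 X hX).2, (g2 (X + h) (by linarith)).2]; ring
  · intro r hr
    have hq3 : 0 ≤ qk s (3 * h) r := qk_nonneg hs0 (by linarith)
    have hq3' : -(2 * h) ≤ r → gs s h ≤ qk s (3 * h) r := by
      intro h; unfold qk; rw [gs_neg hs0 hr, sub_zero]; exact gs_mono hs0 (by linarith)
    have hmain : -(2 * h) ≤ r → 2 * e ≤ 2 * e / gs s h * qk s (3 * h) r := by
      intro h'
      have := hq3' h'
      rw [div_mul_eq_mul_div, le_div_iff₀ hgh]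
      nlinarith
    have hmain0 : 0 ≤ 2 * e / gs s h * qk s (3 * h) r := by positivity
    simp only [hD]
    rcases le_or_gt r (-h) with h3 | h3
    · have e1 : qk s h r = 0 := by
        unfold qk; rw [gs_neg hs0 hr, gs_neg hs0 (by linarith), sub_zero]
      have e2 : G r = 0 := g3 r (by linarith)
      rw [e1, e2]
      rcases le_or_gt (-(2 * h)) r with h4 | h4
      · have := hmain h4
        have h5 := (abs_le.1 (h1' (r + h) (by linarith))).2
        linarith
      · rw [g3 (r + h) (by linarith)]; linarith
    · have := hmain (by linarith)
      have h5 := (abs_le.1 (h1' r hr)).1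
      have h6 := h2 (r + h) (by linarith) (by linarith)
      have e1 : qk s h r = gs s (r + h) := by unfold qk; rw [gs_neg hs0 hr, sub_zero]
      rw [e1]; linarith
  · intro δ hδ
    obtain ⟨R1, hR1⟩ := g4 h hh0 (δ / 2) (by linarith)
    obtain ⟨R2, hR2, hR2'⟩ := gs_large hs0 (|c| * gs s h) (show 0 < δ / 2 by linarith)
    refine ⟨max R1 R2, fun r hr => ?_⟩
    have a1 := (abs_le.1 (hR1 r ((le_max_left _ _).trans hr))).2
    have a2 := hR2' r ((le_max_right _ _).trans hr)
    have a3 : 0 ≤ qk s h r := qk_nonneg hs0 hh0.le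
    have a4 : qk s h r ≤ gs s h := qk_le hs hh0.le
    have a5 : 0 ≤ 2 * e / gs s h * qk s (3 * h) r := mul_nonneg (by positivity) (qk_nonneg hs0 (by linarith))
    have a6 : -(c * qk s h r) ≤ |c| * gs s h := by
      calc -(c * qk s h r) ≤ |c * qk s h r| := neg_le_abs _
        _ = |c| * qk s h r := by rw [abs_mul, abs_of_nonneg a3]
        _ ≤ _ := by gcongr
    simp only [hD]; linarith

/-- propagation of a bound to infinity -/
theorem KI {s c0 c e h : ℝ} {G : ℝ → ℝ} (hs : s ∈ Ioo (0:ℝ) 1) (hG : GG s c0 G) (hc0 : 0 < c0) (hh : c0 ≤ h)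
    (he : 0 ≤ e) (h1 : ∀ r, -c0 ≤ r → r ≤ 0 → |G r| ≤ e) (h2 : ∀ r, 0 < r → r ≤ h → G r ≤ c * gs s r + e) (x : ℝ)
    (hx : h ≤ x) : G x ≤ (c + 19 * e / gs s h) * gs s x := by
  have hs0 := hs.1
  have hh0 : 0 < h := by linarith
  have hk := KI0 hs hG hc0 hh he h1 h2
  have hgh : 0 < gs s h := by rw [gs_pos hh0.le]; positivity
  have tel : ∀ m : ℕ, ∀ r, G (r + m * h) - G r ≤ c * (gs s (r + m * h) - gs s r)
      + 2 * e / gs s h * (gs s (r + m * h) + gs s (r + m * h + h) + gs s (r + m * h + 2 * h) - gs s r - gs s (r + h) - gs s (r + 2 * h)) := by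
    intro m r
    induction m with
    | zero => simp only [Nat.cast_zero, zero_mul, add_zero, sub_self, mul_zero, zero_add]; exact le_of_eq (by ring)
    | succ m ih =>
      have := hk (r + m * h)
      unfold qk at this
      have e1 : r + ((m + 1 : ℕ) : ℝ) * h = r + m * h + h := by push_cast; ring
      have e2 : r + m * h + h + h = r + m * h + 2 * h := by ring
      have e3 : r + m * h + h + 2 * h = r + m * h + 3 * h := by ring
      rw [e1, e2, e3]
      linarith
  obtain ⟨m, r, hr0, hrh, hxr⟩ : ∃ m : ℕ, ∃ r, 0 < r ∧ r ≤ h ∧ x = r + m * h := by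
    obtain ⟨m, hm⟩ : ∃ m : ℕ, m = ⌈x / h⌉₊ - 1 := ⟨_, rfl⟩
    have hx0 : 0 < x / h := div_pos (by linarith) hh0
    have hc1 : 0 < ⌈x / h⌉₊ := Nat.ceil_pos.2 hx0
    have hm1 : (m : ℝ) + 1 = ⌈x / h⌉₊ := by
      have : m + 1 = ⌈x / h⌉₊ := by omega
      exact_mod_cast this
    have b1 := Nat.le_ceil (x / h)
    have b2 := Nat.ceil_lt_add_one hx0.le
    rw [← hm1] at b1 b2
    rw [div_le_iff₀ hh0] at b1
    have b3 : (m : ℝ) < x / h := by linarith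
    rw [lt_div_iff₀ hh0] at b3
    exact ⟨m, x - m * h, by linarith, by linarith, by ring⟩
  have t := tel m r
  rw [← hxr] at t
  have g1 := h2 r hr0 hrh
  have g2 : gs s (x + 2 * h) ≤ 3 * gs s x := by
    have a := gs_add_le (x := x) (y := h) hs hh0.le
    have b := gs_add_le (x := x + h) (y := h) hs hh0.le
    have d := gs_mono hs0 hx
    have e : x + h + h = x + 2 * h := by ring
    rw [e] at b; linarith
  have g3 : gs s (x + h) ≤ gs s (x + 2 * h) := gs_mono hs0 (by linarith)
  have g3' : gs s x ≤ gs s (x + 2 * h) := gs_mono hs0 (by linarith)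
  have g4 : gs s h ≤ gs s x := gs_mono hs0 hx
  have p0 := gs_nonneg (s := s) (x := r)
  have p1 := gs_nonneg (s := s) (x := r + h)
  have p2 := gs_nonneg (s := s) (x := r + 2 * h)
  have q : e ≤ e / gs s h * gs s x := by
    rw [div_mul_eq_mul_div, le_div_iff₀ hgh]; nlinarith
  have q0 : 0 ≤ e / gs s h := by positivity
  have q2 : 2 * e / gs s h * (gs s x + gs s (x + h) + gs s (x + 2 * h) - gs s r - gs s (r + h) - gs s (r + 2 * h))
      ≤ 2 * e / gs s h * (9 * gs s x) := by
    refine mul_le_mul_of_nonneg_left ?_ (by positivity)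
    linarith
  have e1 : 2 * e / gs s h * (9 * gs s x) = 18 * (e / gs s h * gs s x) := by ring
  have e2 : (c + 19 * e / gs s h) * gs s x = c * gs s x + 19 * (e / gs s h * gs s x) := by ring
  rw [e2]; linarith


theorem LIMG {s c0 : ℝ} {G : ℝ → ℝ} (hs : s ∈ Ioo (0:ℝ) 1) (hG : GG s c0 G) (hc0 : 0 < c0) :
    ∃ M, ∀ δ > 0, ∃ R, ∀ r, R ≤ r → |G r - M * gs s r| ≤ δ * gs s r := by
  have hs0 := hs.1
  have hGc : Continuous G := hG.1
  have bdd : ∀ a b : ℝ, ∃ E, 0 ≤ E ∧ ∀ r, a ≤ r → r ≤ b → |G r| ≤ E := by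
    intro a b
    obtain ⟨E, hE⟩ := (isCompact_Icc (a := a) (b := b)).exists_bound_of_continuousOn hGc.continuousOn
    exact ⟨max E 0, le_max_right _ _, fun r h1 h2 => (hE r ⟨h1, h2⟩).trans (le_max_left _ _)⟩
  obtain ⟨E, hE0, hE⟩ := bdd (-c0) c0
  set K := 19 * E / gs s c0 with hK
  have hgc : 0 < gs s c0 := by rw [gs_pos hc0.le]; positivity
  have hK0 : 0 ≤ K := by positivity
  have up : ∀ x, c0 ≤ x → G x ≤ K * gs s x := by
    intro x hx
    have := KI (c := 0) hs hG hc0 le_rfl hE0 (fun r h1 h2 => hE r h1 (by linarith))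
      (fun r h1 h2 => by have := (abs_le.1 (hE r (by linarith) h2)).2; linarith) x hx
    rwa [zero_add] at this
  have lo : ∀ x, c0 ≤ x → -G x ≤ K * gs s x := by
    intro x hx
    have := KI (c := 0) hs hG.neg hc0 le_rfl hE0 (fun r h1 h2 => by rw [abs_neg]; exact hE r h1 (by linarith))
      (fun r h1 h2 => by have := (abs_le.1 (hE r (by linarith) h2)).1; linarith) x hx
    rwa [zero_add] at this
  set S : Set ℝ := {c | ∃ e, 0 ≤ e ∧ ∀ r, 0 < r → G r ≤ c * gs s r + e} with hS
  have hSne : S.Nonempty := by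
    refine ⟨K, E, hE0, fun r hr => ?_⟩
    have := gs_nonneg (s := s) (x := r)
    rcases le_total c0 r with h | h
    · linarith [up r h]
    · have h2 := (abs_le.1 (hE r (by linarith) h)).2
      have : 0 ≤ K * gs s r := by positivity
      linarith
  have hSb : BddBelow S := by
    refine ⟨-K, ?_⟩
    rintro c ⟨e, he, hc⟩
    by_contra hlt
    push Not at hlt
    obtain ⟨R, hR, hR'⟩ := gs_large hs0 (e + 1) (show 0 < -K - c by linarith)
    have h1 := hR' (max R c0) (le_max_left _ _)
    have h2 := lo (max R c0) (le_max_right _ _)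
    have h3 := hc (max R c0) (lt_of_lt_of_le hR (le_max_left _ _))
    linarith
  set M := sInf S with hM
  have main : ∀ δ > 0, ∃ R, ∀ r, R ≤ r → |G r - M * gs s r| ≤ 304 * δ * gs s r := by
    intro δ hδ
    obtain ⟨c, ⟨e, he, hc⟩, hcM⟩ := exists_lt_of_csInf_lt hSne (show sInf S < M + δ by linarith)
    have hc' : ∀ r, 0 < r → G r ≤ (M + δ) * gs s r + max e E := by
      intro r hr
      have := hc r hr
      have h2 := gs_nonneg (s := s) (x := r)
      have h3 : c * gs s r ≤ (M + δ) * gs s r := by gcongr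
      linarith [le_max_left e E]
    set e' := max e E with he'
    have he'0 : 0 ≤ e' := he.trans (le_max_left _ _)
    obtain ⟨h1, hh1, hh1'⟩ := gs_large hs0 e' hδ
    set h0 := max h1 c0 with hh0
    have hh0c : c0 ≤ h0 := le_max_right _ _
    have hh0e : e' ≤ δ * gs s h0 := hh1' _ (le_max_left _ _)
    obtain ⟨R1, hR1, hR1'⟩ := gs_large hs0 E (show 0 < 8 * δ by linarith)
    set R0 := max (2 * h0) R1 with hR0
    have hnot : M - δ ∉ S := notMem_of_lt_csInf (show M - δ < sInf S by linarith) hSb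
    obtain ⟨R, hRR, hR⟩ : ∃ R, R0 ≤ R ∧ (M - δ) * gs s R < G R := by
      by_contra hcon
      push Not at hcon
      apply hnot
      obtain ⟨E2, hE2, hE2'⟩ := bdd 0 R0
      have q := gs_nonneg (s := s) (x := R0)
      refine ⟨E2 + |M - δ| * gs s R0, by positivity, fun r hr => ?_⟩
      rcases le_total R0 r with h | h
      · have := hcon r h
        have : 0 ≤ |M - δ| * gs s R0 := by positivity
        linarith
      · have a1 := (abs_le.1 (hE2' r hr.le h)).2
        have a2 := gs_mono hs0 h
        have a3 := gs_nonneg (s := s) (x := r)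
        have a4 : -((M - δ) * gs s r) ≤ |M - δ| * gs s R0 := by
          calc -((M - δ) * gs s r) ≤ |(M - δ) * gs s r| := neg_le_abs _
            _ = |M - δ| * gs s r := by rw [abs_mul, abs_of_nonneg a3]
            _ ≤ _ := by gcongr
        linarith
    have hR2 : 2 * h0 ≤ R := (le_max_left _ _).trans hRR
    have hR3 : E ≤ 8 * δ * gs s R := hR1' _ ((le_max_right _ _).trans hRR)
    have hRp : 0 < R := by linarith
    have low1 : ∀ x, 0 < x → x ≤ R / 2 → -G x ≤ -(M + δ) * gs s x + 8 * δ * gs s R := by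
      intro x hx hx2
      have hb : h0 ≤ R - x := by linarith
      have k := KI0 (c := M + δ) (e := e') (h := R - x) hs hG hc0 (by linarith) he'0
        (fun r h1 h2 => (hE r h1 (by linarith)).trans (le_max_right _ _)) (fun r h1 h2 => hc' r h1) x
      rw [add_sub_cancel] at k
      have q1 : 0 < gs s (R - x) := by rw [gs_pos (by linarith)]; exact Real.rpow_pos_of_pos (by linarith) _
      have q2 : 2 * e' / gs s (R - x) ≤ 2 * δ := by
        rw [div_le_iff₀ q1]
        have : gs s h0 ≤ gs s (R - x) := gs_mono hs0 hb
        nlinarith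
      have q3 : qk s (3 * (R - x)) x ≤ 3 * gs s R := by
        have a0 := qk_le (x := x) hs (show 0 ≤ 3 * (R - x) by linarith)
        have a1 := gs_add_le (x := R - x) (y := R - x) hs (by linarith)
        have a2 := gs_add_le (x := R - x + (R - x)) (y := R - x) hs (by linarith)
        have a3 : R - x + (R - x) + (R - x) = 3 * (R - x) := by ring
        have a4 : gs s (R - x) ≤ gs s R := gs_mono hs0 (by linarith)
        rw [a3] at a2; linarith
      have q4 : 0 ≤ qk s (3 * (R - x)) x := qk_nonneg hs0 (by linarith)
      have q5 : 2 * e' / gs s (R - x) * qk s (3 * (R - x)) x ≤ 2 * δ * (3 * gs s R) :=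
        mul_le_mul q2 q3 q4 (by linarith)
      have q6 : qk s (R - x) x = gs s R - gs s x := by unfold qk; rw [add_sub_cancel]
      rw [q6] at k
      linarith
    have hRg : 0 < gs s (R / 2) := by rw [gs_pos (by linarith)]; positivity
    have low2 : ∀ x, R / 2 ≤ x → -G x ≤ (-(M + δ) + 304 * δ) * gs s x := by
      intro x hx
      have k := KI (c := -(M + δ)) (e := 8 * δ * gs s R) (h := R / 2) hs hG.neg hc0 (by linarith)
        (mul_nonneg (by linarith) gs_nonneg)
        (fun r h1 h2 => by rw [abs_neg]; exact (hE r h1 (by linarith)).trans hR3) low1 x hx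
      refine k.trans (mul_le_mul_of_nonneg_right ?_ gs_nonneg)
      have a1 := gs_add_le (x := R / 2) (y := R / 2) hs (by linarith)
      rw [add_halves] at a1
      have a2 : 19 * (8 * δ * gs s R) / gs s (R / 2) ≤ 304 * δ := by
        rw [div_le_iff₀ hRg]; nlinarith
      linarith
    obtain ⟨R4, hR4, hR4'⟩ := gs_large hs0 e' hδ
    refine ⟨max (R / 2) R4, fun r hr => ?_⟩
    have b1 := low2 r ((le_max_left _ _).trans hr)
    have b2 := hR4' r ((le_max_right _ _).trans hr)
    have b3 := hc' r (lt_of_lt_of_le hR4 ((le_max_right _ _).trans hr))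
    have b4 : 0 ≤ δ * gs s r := mul_nonneg hδ.le gs_nonneg
    rw [abs_le]
    constructor <;> linarith
  refine ⟨M, fun δ hδ => ?_⟩
  obtain ⟨R, hR⟩ := main (δ / 304) (by positivity)
  refine ⟨R, fun r hr => ?_⟩
  have := hR r hr
  rwa [mul_div_cancel₀ _ (by norm_num)] at this


theorem ADDLIN {F : ℝ → ℝ} {K : ℝ} (hadd : ∀ r r', 0 < r → 0 < r' → F (r + r') = F r + F r')
    (hb : ∀ r, 0 < r → r ≤ 1 → |F r| ≤ K) (r : ℝ) (hr : 0 < r) : F r = r * F 1 := by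
  set H : ℝ → ℝ := fun r => F r - r * F 1 with hH
  have hHadd : ∀ r r', 0 < r → 0 < r' → H (r + r') = H r + H r' := by
    intro r r' h h'; simp only [hH]; rw [hadd r r' h h']; ring
  have hH1 : H 1 = 0 := by simp [hH]
  have hper : ∀ m : ℕ, ∀ r, 0 < r → H (r + m) = H r := by
    intro m r hr
    induction m with
    | zero => simp
    | succ m ih =>
      push_cast
      rw [← add_assoc, hHadd _ _ (by positivity) one_pos, hH1, ih, add_zero]
  have hHb1 : ∀ r, 0 < r → r ≤ 1 → |H r| ≤ K + |F 1| := by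
    intro r h h'
    have := hb r h h'
    calc |H r| ≤ |F r| + |r * F 1| := abs_sub _ _
      _ ≤ K + 1 * |F 1| := by
          rw [abs_mul, abs_of_pos h]; gcongr
      _ = _ := by ring
  have hHb : ∀ r, 0 < r → |H r| ≤ K + |F 1| := by
    intro x hx
    obtain ⟨m, hm⟩ : ∃ m : ℕ, m = ⌈x⌉₊ - 1 := ⟨_, rfl⟩
    have hc1 : 0 < ⌈x⌉₊ := Nat.ceil_pos.2 hx
    have hm1 : (m : ℝ) + 1 = ⌈x⌉₊ := by
      have : m + 1 = ⌈x⌉₊ := by omega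
      exact_mod_cast this
    have b1 := Nat.le_ceil x
    have b2 := Nat.ceil_lt_add_one hx.le
    rw [← hm1] at b1 b2
    have e := hper m (x - m) (by linarith)
    rw [sub_add_cancel] at e
    rw [e]
    exact hHb1 _ (by linarith) (by linarith)
  have hmul : ∀ m : ℕ, 1 ≤ m → H (m * r) = m * H r := by
    intro m hm
    induction m, hm using Nat.le_induction with
    | base => simp
    | succ m hm ih =>
      have hm' : (0:ℝ) < m := by exact_mod_cast hm
      push_cast
      rw [add_mul, one_mul, hHadd _ _ (by positivity) hr, ih]; ring
  have : H r = 0 := by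
    refine sublin (θ := 0) (K := K + |F 1|) one_pos fun m hm => ?_
    have hm' : (0:ℝ) < m := by exact_mod_cast hm
    have := hHb (m * r) (by positivity)
    rw [hmul m hm, abs_mul, abs_of_pos hm'] at this
    simpa using this
  simp only [hH] at this; linarith

theorem ONED {s C β : ℝ} (hs : s ∈ Ioo (0:ℝ) 1) (hβ : 0 < β) (hC : 0 ≤ C) (f F : ℝ → ℝ)
    (hfF : ∀ r, f r = gs s r * F r) (hF : ∀ r, 0 < r → r ≤ 1 → |F r| ≤ C * r ^ β)
    (hGG : ∀ k, 0 < k → GG s k (fun r => f (r + k) - f r)) (r : ℝ) (hr : 0 < r) : F r = r * F 1 := by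
  have hs0 := hs.1
  have hlim : ∀ k, ∃ M, 0 < k → ∀ δ > 0, ∃ R, ∀ r, R ≤ r → |f (r + k) - f r - M * gs s r| ≤ δ * gs s r := by
    intro k
    by_cases hk : 0 < k
    · obtain ⟨M, hM⟩ := LIMG hs (hGG k hk) hk
      exact ⟨M, fun _ => hM⟩
    · exact ⟨0, fun h => absurd h hk⟩
  choose p hp using hlim
  have padd : ∀ k l, 0 < k → 0 < l → p (k + l) = p k + p l := by
    intro k l hk hl
    have key : ∀ δ > 0, |p (k + l) - p k - p l| ≤ 4 * δ := by
      intro δ hδ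
      obtain ⟨R1, h1⟩ := hp (k + l) (by linarith) δ hδ
      obtain ⟨R2, h2⟩ := hp k hk δ hδ
      obtain ⟨R3, h3⟩ := hp l hl δ hδ
      obtain ⟨R4, h4⟩ := (hGG k hk).2.2.2 l hl δ hδ
      set r := max (max (max R1 R2) (max R3 R4)) 1 with hr
      have r0 : 0 < r := lt_of_lt_of_le one_pos (le_max_right _ _)
      have hm := le_max_left (max (max R1 R2) (max R3 R4)) 1
      have b1 := h1 r (((le_max_left _ _).trans (le_max_left _ _)).trans hm)
      have b2 := h2 r (((le_max_right _ _).trans (le_max_left _ _)).trans hm)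
      have b3 := h3 r (((le_max_left _ _).trans (le_max_right _ _)).trans hm)
      have b4 := h4 r (((le_max_right _ _).trans (le_max_right _ _)).trans hm)
      have hg : 0 < gs s r := by rw [gs_pos r0.le]; positivity
      have e : r + l + k = r + (k + l) := by ring
      simp only [e] at b4
      have : |p (k + l) - p k - p l| * gs s r ≤ 4 * δ * gs s r := by
        rw [← abs_of_pos hg, ← abs_mul, abs_of_pos hg]
        rw [abs_le] at b1 b2 b3 b4 ⊢
        constructor <;> linarith [b1.1, b1.2, b2.1, b2.2, b3.1, b3.2, b4.1, b4.2]
      exact le_of_mul_le_mul_right this hg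
    have h0 : |p (k + l) - p k - p l| ≤ 0 := by
      refine le_of_forall_pos_le_add fun ε hε => ?_
      have := key (ε / 4) (by linarith)
      linarith
    have := abs_nonpos_iff.1 h0
    linarith
  have pmul : ∀ N : ℕ, 1 ≤ N → ∀ k, 0 < k → p (N * k) = N * p k := by
    intro N hN k hk
    induction N, hN using Nat.le_induction with
    | base => simp
    | succ m hm ih =>
      have hm' : (0:ℝ) < m := by exact_mod_cast hm
      push_cast
      rw [add_mul, one_mul, padd _ _ (by positivity) hk, ih]; ring
  have hf0 : ∀ r ≤ 0, f r = 0 := fun r hr => by rw [hfF, gs_neg hs0 hr, zero_mul]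
  have side : ∀ σ : ℝ, |σ| = 1 → ∀ k, 0 < k → k ≤ 1 → ∀ r,
      σ * (f (r + k) - f r - p k * gs s r) ≤ C * k ^ β * qk s k r := by
    intro σ hσ k hk hk1 r
    obtain ⟨g1, g2, g3, g4⟩ := hGG k hk
    set D : ℝ → ℝ := fun r => 1 * (σ * (f (r + k) - f r) + (-σ * p k) * gs s r) + (-(C * k ^ β)) * qk s k r with hD
    suffices h : D r ≤ 0 by simp only [hD] at h; linarith
    have hqn : ∀ r, 0 ≤ C * k ^ β * qk s k r := fun r => by
      have := qk_nonneg (x := r) hs0 hk.le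
      positivity
    refine MP1 hs D ?_ ?_ ?_ ?_ r
    · have a := qk_cont (k := k) hs0
      have b := gs_cont hs0
      have c : Continuous (fun r => f (r + k) - f r) := g1
      exact (continuous_const.mul ((continuous_const.mul c).add (continuous_const.mul b))).add (continuous_const.mul a)
    · intro X hX
      have a2 := Int1.comb σ (-σ * p k) (g2 X hX).1 (factA hs hX).1
      have a3 := factAq hs hX hk.le
      have a6 := Int1.comb 1 (-(C * k ^ β)) a2.1 a3.1
      refine ⟨a6.1, a6.2.trans ?_⟩
      rw [a2.2, a3.2, (g2 X hX).2, (factA hs hX).2]; ring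
    · intro r hr
      simp only [hD]
      have e1 : qk s k r = gs s (r + k) := by unfold qk; rw [gs_neg hs0 hr, sub_zero]
      rw [e1, gs_neg hs0 hr, hf0 r hr, hfF]
      rcases le_or_gt (r + k) 0 with h | h
      · rw [gs_neg hs0 h]; simp
      · have b1 := hF (r + k) h (by linarith)
        have b2 : (r + k) ^ β ≤ k ^ β := Real.rpow_le_rpow h.le (by linarith) hβ.le
        have b3 : σ * F (r + k) ≤ C * k ^ β := by
          calc σ * F (r + k) ≤ |σ * F (r + k)| := le_abs_self _
            _ = |F (r + k)| := by rw [abs_mul, hσ, one_mul]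
            _ ≤ C * (r + k) ^ β := b1
            _ ≤ _ := by gcongr
        have b4 := gs_nonneg (s := s) (x := r + k)
        nlinarith
    · intro δ hδ
      obtain ⟨R, hR⟩ := hp k hk δ hδ
      refine ⟨R, fun r hr => ?_⟩
      have b1 := hR r hr
      have b2 : σ * (f (r + k) - f r - p k * gs s r) ≤ δ * gs s r := by
        calc _ ≤ |σ * (f (r + k) - f r - p k * gs s r)| := le_abs_self _
          _ = |(f (r + k) - f r - p k * gs s r)| := by rw [abs_mul, hσ, one_mul]
          _ ≤ _ := b1
      have := hqn r
      simp only [hD]; linarith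
  have bnd : ∀ k, 0 < k → k ≤ 1 → ∀ r, |f (r + k) - f r - p k * gs s r| ≤ C * k ^ β * qk s k r := by
    intro k hk hk1 r
    have h1 := side 1 (by simp) k hk hk1 r
    have h2 := side (-1) (by simp) k hk hk1 r
    rw [abs_le]; constructor <;> linarith
  have sumb : ∀ k, 0 < k → k ≤ 1 → ∀ N : ℕ, |f (N * k) - p k * ∑ j ∈ Finset.range N, gs s (j * k)| ≤ C * k ^ β * gs s (N * k) := by
    intro k hk hk1 N
    induction N with
    | zero => simp [hf0 0 le_rfl, gs_neg hs0 (le_refl 0)]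
    | succ m ih =>
      have h := bnd k hk hk1 (m * k)
      have e : ((m + 1 : ℕ) : ℝ) * k = m * k + k := by push_cast; ring
      rw [e, Finset.sum_range_succ]
      unfold qk at h
      rw [abs_le] at h ih ⊢
      constructor <;> linarith [h.1, h.2, ih.1, ih.2]
  set S : ℕ → ℝ := fun N => (∑ j ∈ Finset.range N, ((j:ℝ) / N) ^ s) / N with hS
  have approx : ∀ r : ℝ, 0 < r → ∀ N : ℕ, 1 ≤ N → r ≤ N → |F r - p r * S N| ≤ C * (r / N) ^ β := by
    intro r hr N hN hrN
    have hN' : (0:ℝ) < N := by exact_mod_cast hN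
    have h := sumb (r / N) (by positivity) (by rw [div_le_one hN']; exact hrN) N
    have e1 : (N : ℝ) * (r / N) = r := by field_simp
    have e2 : p r = N * p (r / N) := by rw [← pmul N hN (r / N) (by positivity), e1]
    have e3 : ∑ j ∈ Finset.range N, gs s (j * (r / N)) = r ^ s * ∑ j ∈ Finset.range N, ((j:ℝ) / N) ^ s := by
      rw [Finset.mul_sum]
      refine Finset.sum_congr rfl fun j _ => ?_
      rw [gs_pos (by positivity), ← Real.mul_rpow hr.le (by positivity)]
      congr 1; ring
    have hrs : 0 < r ^ s := by positivity
    rw [e1, e3, hfF, gs_pos hr.le] at h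
    have e4 : r ^ s * F r - p (r / N) * (r ^ s * ∑ j ∈ Finset.range N, ((j:ℝ) / N) ^ s) = r ^ s * (F r - p r * S N) := by
      rw [e2]; simp only [hS]; field_simp
    rw [e4, abs_mul, abs_of_pos hrs] at h
    nlinarith
  have hFadd : ∀ r r', 0 < r → 0 < r' → F (r + r') = F r + F r' := by
    intro r r' h h'
    have hb : ∀ᶠ N : ℕ in atTop, |F (r + r') - F r - F r'| ≤ C * ((r + r') / N) ^ β + C * (r / N) ^ β + C * (r' / N) ^ β := by
      filter_upwards [eventually_ge_atTop (max 1 ⌈r + r'⌉₊)] with N hN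
      have h1 : 1 ≤ N := (le_max_left _ _).trans hN
      have h2 : r + r' ≤ N := (Nat.le_ceil _).trans (by exact_mod_cast (le_max_right _ _).trans hN)
      have a1 := approx (r + r') (by linarith) N h1 h2
      have a2 := approx r h N h1 (by linarith)
      have a3 := approx r' h' N h1 (by linarith)
      rw [padd r r' h h'] at a1
      rw [abs_le] at a1 a2 a3 ⊢
      constructor <;> linarith [a1.1, a1.2, a2.1, a2.2, a3.1, a3.2]
    have ht : ∀ x : ℝ, Tendsto (fun N : ℕ => C * (x / N) ^ β) atTop (𝓝 0) := by
      intro x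
      have t1 : Tendsto (fun N : ℕ => x / (N:ℝ)) atTop (𝓝 0) := tendsto_const_div_atTop_nhds_zero_nat x
      have t2 := (t1.rpow_const (p := β) (Or.inr hβ.le)).const_mul C
      rwa [Real.zero_rpow hβ.ne', mul_zero] at t2
    have := ge_of_tendsto (((ht (r + r')).add (ht r)).add (ht r')) hb
    rw [add_zero, add_zero] at this
    have := abs_nonpos_iff.1 this
    linarith
  refine ADDLIN (K := C) hFadd (fun r h h' => ?_) r hr
  calc |F r| ≤ C * r ^ β := hF r h h'
    _ ≤ C * 1 := by
        gcongr
        exact Real.rpow_le_one h.le h' hβ.le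
    _ = C := mul_one C


theorem GROW {s α β C k : ℝ} {F : ℝ → ℝ} (hs : s ∈ Ioo (0:ℝ) 1) (hα : α ∈ Ioo 0 s) (hβ : β ∈ Ioo (0:ℝ) 1) (hC : 0 < C)
    (hk : 0 < k)
    (hF : ∀ R : ℝ, 1 ≤ R → ∀ r r' : ℝ, 0 < r → r < R → 0 < r' → r' < R → |F r - F r'| ≤ C * R ^ α * |r - r'| ^ β)
    (hq : ∀ R : ℝ, 1 ≤ R → ∀ r : ℝ, 0 < r → r < R → |F r| ≤ C * R ^ α * r ^ β) :
    ∃ B > 0, ∀ r, |gs s (r + k) * F (r + k) - gs s r * F r| ≤ B * (1 + |r|) ^ (s + α) := by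
  have hs0 := hs.1
  have hα0 := hα.1
  have hα1 : α ≤ 1 := by linarith [hα.2, hs.2]
  refine ⟨C * (k ^ s + k) + (1 + k) * (1 + k) * C * k ^ β + k ^ s * (C * (1 + k) ^ α * k ^ β), by positivity, fun r => ?_⟩
  have e0 : 1 ≤ (1 + |r|) ^ (s + α) := Real.one_le_rpow (by linarith [abs_nonneg r]) (by linarith)
  have p1 : 0 ≤ C * (k ^ s + k) := by positivity
  have p2 : 0 ≤ (1 + k) * (1 + k) * C * k ^ β := by positivity
  have p3 : 0 ≤ k ^ s * (C * (1 + k) ^ α * k ^ β) := by positivity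
  rcases le_or_gt r 0 with h | h
  · rw [gs_neg hs0 h, zero_mul, sub_zero]
    suffices hh : |gs s (r + k) * F (r + k)| ≤ k ^ s * (C * (1 + k) ^ α * k ^ β) by nlinarith
    rcases le_or_gt (r + k) 0 with h' | h'
    · rw [gs_neg hs0 h', zero_mul, abs_zero]; exact p3
    · have a1 := hq (1 + k) (by linarith) (r + k) h' (by linarith)
      have a2 : (r + k) ^ β ≤ k ^ β := Real.rpow_le_rpow h'.le (by linarith) hβ.1.le
      have a3 : gs s (r + k) ≤ k ^ s := by rw [← gs_pos hk.le]; exact gs_mono hs0 (by linarith)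
      rw [abs_mul, abs_of_nonneg gs_nonneg]
      calc gs s (r + k) * |F (r + k)| ≤ k ^ s * (C * (1 + k) ^ α * (r + k) ^ β) := by gcongr
        _ ≤ _ := by gcongr
  · rw [abs_of_pos h] at e0 ⊢
    have hr1 : 0 < 1 + r := by linarith
    have e1 : (1 + r) ^ (s + α) = (1 + r) ^ s * (1 + r) ^ α := Real.rpow_add hr1 _ _
    have e2 : gs s (r + k) * F (r + k) - gs s r * F r = qk s k r * F r + gs s (r + k) * (F (r + k) - F r) := by
      unfold qk; ring
    have t1 : qk s k r * r ^ β ≤ (k ^ s + k) * (1 + r) ^ s := by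
      have w1 : 1 ≤ (1 + r) ^ s := Real.one_le_rpow (by linarith) hs0.le
      have ks : 0 ≤ k ^ s := by positivity
      rcases le_total r 1 with h1 | h1
      · have b1 : qk s k r ≤ k ^ s := by rw [← gs_pos hk.le]; exact qk_le hs hk.le
        have b2 : r ^ β ≤ 1 := Real.rpow_le_one h.le h1 hβ.1.le
        have b3 : 0 ≤ r ^ β := by positivity
        have b4 := qk_nonneg (x := r) hs0 hk.le
        nlinarith
      · have b1 : qk s k r ≤ k * r ^ (s - 1) := by
          unfold qk
          rw [gs_pos h.le, gs_pos (by linarith)]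
          have c1 : (1 + k / r) ^ s ≤ 1 + s * (k / r) :=
            rpow_one_add_le_one_add_mul_self (by linarith [show 0 < k / r by positivity]) hs0.le hs.2.le
          have c2 : (r + k) ^ s = r ^ s * (1 + k / r) ^ s := by
            rw [← Real.mul_rpow h.le (by positivity)]; congr 1; field_simp
          have c3 : r ^ (s - 1) = r ^ s / r := by rw [Real.rpow_sub h, Real.rpow_one]
          rw [c2, c3]
          have c4 : 0 < r ^ s := by positivity
          have c5 : s * (k / r) ≤ k / r := by
            have : 0 < k / r := by positivity
            nlinarith [hs.2]
          have c6 : k * (r ^ s / r) = r ^ s * (k / r) := by ring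
          rw [c6]; nlinarith
        have b2 : r ^ (s - 1) * r ^ β ≤ (1 + r) ^ s := by
          rw [← Real.rpow_add h]
          calc r ^ (s - 1 + β) ≤ r ^ s := Real.rpow_le_rpow_of_exponent_le h1 (by linarith [hβ.2])
            _ ≤ _ := Real.rpow_le_rpow h.le (by linarith) hs0.le
        have b3 : 0 ≤ r ^ β := by positivity
        have b5 : 0 < r ^ (s - 1) := by positivity
        calc qk s k r * r ^ β ≤ k * r ^ (s - 1) * r ^ β := by gcongr
          _ = k * (r ^ (s - 1) * r ^ β) := by ring
          _ ≤ k * (1 + r) ^ s := by gcongr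
          _ ≤ _ := by nlinarith
    have t2 : |qk s k r * F r| ≤ C * (k ^ s + k) * (1 + r) ^ (s + α) := by
      have a1 := hq (1 + r) (by linarith) r h (by linarith)
      have b4 := qk_nonneg (x := r) hs0 hk.le
      rw [abs_mul, abs_of_nonneg b4, e1]
      calc qk s k r * |F r| ≤ qk s k r * (C * (1 + r) ^ α * r ^ β) := by gcongr
        _ = C * (1 + r) ^ α * (qk s k r * r ^ β) := by ring
        _ ≤ C * (1 + r) ^ α * ((k ^ s + k) * (1 + r) ^ s) := by gcongr
        _ = _ := by ring
    have hle : 1 + r + k ≤ (1 + k) * (1 + r) := by nlinarith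
    have pwle : ∀ y : ℝ, 0 < y → y ≤ 1 → (1 + r + k) ^ y ≤ (1 + k) * (1 + r) ^ y := by
      intro y hy hy1
      calc (1 + r + k) ^ y ≤ ((1 + k) * (1 + r)) ^ y := Real.rpow_le_rpow (by linarith) hle hy.le
        _ = (1 + k) ^ y * (1 + r) ^ y := Real.mul_rpow (by linarith) hr1.le
        _ ≤ (1 + k) ^ (1:ℝ) * (1 + r) ^ y := by
            refine mul_le_mul_of_nonneg_right ?_ (by positivity)
            exact Real.rpow_le_rpow_of_exponent_le (by linarith) hy1
        _ = _ := by rw [Real.rpow_one]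
    have t3 : |gs s (r + k) * (F (r + k) - F r)| ≤ (1 + k) * (1 + k) * C * k ^ β * (1 + r) ^ (s + α) := by
      have a1 := hF (1 + r + k) (by linarith) (r + k) r (by linarith) (by linarith) h (by linarith)
      rw [show r + k - r = k by ring, abs_of_pos hk] at a1
      have a2 : gs s (r + k) ≤ (1 + k) * (1 + r) ^ s := by
        refine le_trans ?_ (pwle s hs0 hs.2.le)
        rw [← gs_pos (show 0 ≤ 1 + r + k by linarith)]; exact gs_mono hs0 (by linarith)
      have a3 := pwle α hα0 hα1
      rw [abs_mul, abs_of_nonneg gs_nonneg, e1]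
      calc gs s (r + k) * |F (r + k) - F r| ≤ ((1 + k) * (1 + r) ^ s) * (C * (1 + r + k) ^ α * k ^ β) := by gcongr
        _ ≤ ((1 + k) * (1 + r) ^ s) * (C * ((1 + k) * (1 + r) ^ α) * k ^ β) := by gcongr
        _ = _ := by ring
    rw [e2]
    refine (abs_add_le _ _).trans ?_
    have : 0 ≤ k ^ s * (C * (1 + k) ^ α * k ^ β) * (1 + r) ^ (s + α) := by positivity
    linarith

theorem INC {n : ℕ} (hn : 0 < n) {s α lam Lam B : ℝ} (hs : s ∈ Ioo (0:ℝ) 1) (hα : α ∈ Ioo 0 s) (hlam : 0 < lam)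
    (hlL : lam ≤ Lam) {a : En n → ℝ} (ha : KernelBounds lam Lam a) (ham : AM n a) {G : ℝ → ℝ} (hG : Continuous G)
    (hL : ∀ X, 0 < X → Int1 s G X ∧ L1 s G X = 0) (hB : 0 < B) (hgr : ∀ r, |G r| ≤ B * (1 + |r|) ^ (s + α))
    (h : ℝ) (hh : 0 < h) (δ : ℝ) (hδ : 0 < δ) : ∃ R, ∀ r, R ≤ r → |G (r + h) - G r| ≤ δ * gs s r := by
  have hs0 := hs.1
  have hα0 := hα.1
  have hσ0 : 0 < s + α := by linarith
  obtain ⟨A, hA, H⟩ := DL (n := n) (s := s) (σ := s + α) (ε := s) hn hs hσ0 (by linarith [hα.2]) hs (by linarith) hlam hlL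
  set M := B * 2 ^ (s + α) with hM
  have hM0 : 0 < M := by positivity
  have main : ∀ r, 1 ≤ r → 4 * h ≤ r → |G (r + h) - G r| ≤ A * M * r ^ α * h ^ s := by
    intro r hr hr4
    have hr0 : 0 < r := by linarith
    have hx0 : lastC (r • eLast n) = r := by rw [lastC_smul, lastC_eLast hn, mul_one]
    have key := H a ha (fun _ x => G (lastC x)) (r • eLast n) r M 0 hr0 hM0
      ((hG.comp (continuous_lastC.comp continuous_snd)).continuousOn) (by
        intro t _ x
        refine (hgr _).trans ?_
        rw [hM, mul_assoc, ← Real.mul_rpow (by norm_num) (by positivity)]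
        gcongr
        have h1 := abs_lastC_le (x - r • eLast n)
        rw [lastC_sub, hx0] at h1
        have h2 : |lastC x| ≤ |lastC x - r| + |r| := by
          have := abs_add_le (lastC x - r) r
          rwa [sub_add_cancel] at this
        rw [abs_of_pos hr0] at h2
        linarith [norm_nonneg (x - r • eLast n)]) (by
        intro t _ x z hx hz
        left
        have sol : ∀ y : En n, ‖y - r • eLast n‖ ≤ r / 2 → SolvesAt n s a (fun _ x => G (lastC x)) (fun _ _ => 0) t y := by
          intro y hy
          have h1 := abs_lastC_le (y - r • eLast n)
          rw [lastC_sub, hx0] at h1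
          have h2 : 0 < lastC y := by linarith [(abs_le.1 h1).1]
          have h3 := SLI hn hs0 hlam ha ham G hG.measurable y (hL _ h2).1
          refine ⟨h3.1, ?_⟩
          have e : Lop n s a (fun x => G (lastC x)) y + 0 = 0 := by rw [h3.2, (hL _ h2).2]; ring
          simp only [e]
          exact hasDerivAt_const _ _
        exact ⟨sol x hx, sol z hz⟩) (h • eLast n) (by
        rw [norm_smul, norm_eLast hn, mul_one, Real.norm_of_nonneg hh.le]; linarith)
    simp only [lastC_add, hx0] at key
    rw [lastC_smul, lastC_eLast hn, mul_one, norm_smul, norm_eLast hn, mul_one, Real.norm_of_nonneg hh.le,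
      show s + α - s = α by ring] at key
    exact key
  obtain ⟨R1, hR1, hR1'⟩ := gs_large (s := s - α) (by linarith [hα.2]) (A * M * h ^ s) hδ
  refine ⟨max (max 1 (4 * h)) R1, fun r hr => ?_⟩
  have h1 : 1 ≤ r := ((le_max_left _ _).trans (le_max_left _ _)).trans hr
  have h2 : 4 * h ≤ r := ((le_max_right _ _).trans (le_max_left _ _)).trans hr
  have h3 := hR1' r ((le_max_right _ _).trans hr)
  have h4 := main r h1 h2
  have hr0 : 0 < r := by linarith
  rw [gs_pos hr0.le] at h3 ⊢
  have e : r ^ s = r ^ α * r ^ (s - α) := by rw [← Real.rpow_add hr0]; congr 1; ring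
  have hp : 0 < r ^ α := by positivity
  rw [e]
  calc _ ≤ A * M * r ^ α * h ^ s := h4
    _ = r ^ α * (A * M * h ^ s) := by ring
    _ ≤ r ^ α * (δ * r ^ (s - α)) := by gcongr
    _ = _ := by ring


theorem QLIM {α β C : ℝ} {F : ℝ → ℝ} (hβ : 0 < β) (hC : 0 < C)
    (hF : ∀ R : ℝ, 1 ≤ R → ∀ r r' : ℝ, 0 < r → r < R → 0 < r' → r' < R → |F r - F r'| ≤ C * R ^ α * |r - r'| ^ β) :
    ∃ q, ∀ R : ℝ, 1 ≤ R → ∀ r : ℝ, 0 < r → r < R → |F r - q| ≤ C * R ^ α * r ^ β := by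
  set u : ℕ → ℝ := fun m => 1 / ((m : ℝ) + 2) with hu
  have hu0 : ∀ m, 0 < u m := fun m => by simp only [hu]; positivity
  have hu1 : ∀ m, u m < 1 := fun m => by
    simp only [hu]; rw [div_lt_one (by positivity)]
    have : (0:ℝ) ≤ m := Nat.cast_nonneg m
    linarith
  have hanti : ∀ N m, N ≤ m → u m ≤ u N := fun N m h => by
    simp only [hu]
    have : (N:ℝ) ≤ m := by exact_mod_cast h
    gcongr
  have hut : Tendsto u atTop (𝓝 0) := by
    have h1 := tendsto_one_div_add_atTop_nhds_zero_nat (𝕜 := ℝ)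
    refine squeeze_zero (fun m => (hu0 m).le) (fun m => ?_) h1
    simp only [hu]; gcongr; norm_num
  have hc : CauchySeq (fun m => F (u m)) := by
    refine cauchySeq_of_le_tendsto_0 (fun N => C * 1 ^ α * (u N) ^ β) ?_ ?_
    · intro n m N hn hm
      rw [Real.dist_eq]
      refine (hF 1 le_rfl _ _ (hu0 n) (hu1 n) (hu0 m) (hu1 m)).trans ?_
      have : |u n - u m| ≤ u N := by
        have a1 := hanti N n hn
        have a2 := hanti N m hm
        rw [abs_le]; constructor <;> linarith [hu0 n, hu0 m]
      rw [Real.one_rpow]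
      gcongr
    · have t2 := (hut.rpow_const (p := β) (Or.inr hβ.le)).const_mul (C * 1 ^ α)
      rwa [Real.zero_rpow hβ.ne', mul_zero] at t2
  obtain ⟨q, hq⟩ := cauchySeq_tendsto_of_complete hc
  refine ⟨q, fun R hR r h1 h2 => ?_⟩
  have t1 : Tendsto (fun m => |F r - F (u m)|) atTop (𝓝 |F r - q|) := (tendsto_const_nhds.sub hq).abs
  have t2 : Tendsto (fun m => C * R ^ α * |r - u m| ^ β) atTop (𝓝 (C * R ^ α * |r - 0| ^ β)) :=
    (((tendsto_const_nhds.sub hut).abs).rpow_const (Or.inr hβ.le)).const_mul _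
  rw [sub_zero, abs_of_pos h1] at t2
  exact le_of_tendsto_of_tendsto' t1 t2 fun m => hF R hR _ _ h1 h2 (hu0 m) (lt_of_lt_of_le (hu1 m) hR)

theorem FIN (n : ℕ) (s γ β α lam Lam : ℝ)
    (hn : 0 < n) (hs : s ∈ Ioo (0 : ℝ) 1) (hγ : γ ∈ Ioo 0 s) (hβ : β ∈ Ioo γ 1)
    (hα : α = s + γ - β) (hα' : α ∈ Ioo 0 s)
    (hlam : 0 < lam) (hlL : lam ≤ Lam)
    (a : En n → ℝ) (ha : KernelBounds lam Lam a)
    (w : ℝ → En n → ℝ) (C : ℝ) (hC : 0 < C)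
    (hbdry : ∀ t < (0 : ℝ), ∀ x : En n, lastC x ≤ 0 → w t x = 0)
    (heq : ∀ h : En n, 0 ≤ lastC h → ∀ τ < (0 : ℝ), ∀ t < (0 : ℝ), ∀ x : En n, 0 < lastC x →
      SolvesAt n s a (fun t' x' => w (t' + τ) (x' + h) - w t' x') (fun _ _ => 0) t x)
    (hgrowth : ∀ R ≥ (1 : ℝ),
      ParHolderBnd s β (C * R ^ α) (Ioo (-(R ^ (2 * s))) 0)
        (ball (0 : En n) R ∩ {x | 0 < lastC x})
        (fun t x => w t x / max (lastC x) 0 ^ s)) :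
    ∃ (p : En n) (q : ℝ),
      (∀ t < (0 : ℝ), ∀ x : En n, w t x = max (lastC x) 0 ^ s * ((∑ i, p i * x i) + q)) ∧
      (α + β < 1 → p = 0) := by
  have hs0 := hs.1
  have hβ0 : 0 < β := by linarith [hβ.1, hγ.1]
  have hW : WH s β α C (fun t x => w t x / max (lastC x) 0 ^ s) := by
    intro R hR t x t' x' h1 h2 h3 h4 h5 h6 h7 h8
    exact hgrowth R hR t ⟨h1, h2⟩ x ⟨by simpa using h5, h7⟩ t' ⟨h3, h4⟩ x' ⟨by simpa using h6, h8⟩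
  have hw : ∀ t < 0, ∀ x, w t x = gs s (lastC x) * (w t x / max (lastC x) 0 ^ s) := by
    intro t ht x
    rcases le_or_gt (lastC x) 0 with h | h
    · rw [gs_neg hs0 h, zero_mul, hbdry t ht x h]
    · have : 0 < max (lastC x) 0 ^ s := by rw [max_eq_left h.le]; positivity
      simp only [gs]; field_simp
  have hwc := WCONT hn hs hα'.1 hβ0 hC hW hw
  obtain ⟨a', P, F, ha', ham, hPe, hwF, hF, hLw⟩ := ST12 n s γ β α lam Lam hn hs hγ hβ hα hα' hlam hlL a ha w C hC hbdry heq hgrowth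
  obtain ⟨q, hq⟩ := QLIM hβ0 hC hF
  set F0 : ℝ → ℝ := fun r => F r - q with hF0
  set f : ℝ → ℝ := fun r => gs s r * F0 r with hf
  have hlc : ∀ X : ℝ, lastC (X • eLast n) = X := fun X => by rw [lastC_smul, lastC_eLast hn, mul_one]
  have hfc : Continuous f := by
    have hc1 : Continuous (w (-1)) := cont_slice hwc (by show (-1:ℝ) < 0; norm_num)
    have hc2 : Continuous (fun X : ℝ => w (-1) (X • eLast n) - q * gs s X) :=
      (hc1.comp (by fun_prop)).sub (continuous_const.mul (gs_cont hs0))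
    have e : f = fun X : ℝ => w (-1) (X • eLast n) - q * gs s X := by
      funext X
      rw [hwF (-1) (by norm_num), hlc, map_smul, hPe]
      simp only [hf, hF0, smul_eq_mul]; ring
    rw [e]; exact hc2
  have hF0h : ∀ R : ℝ, 1 ≤ R → ∀ r r' : ℝ, 0 < r → r < R → 0 < r' → r' < R → |F0 r - F0 r'| ≤ C * R ^ α * |r - r'| ^ β := by
    intro R hR r r' h1 h2 h3 h4
    have := hF R hR r r' h1 h2 h3 h4
    simp only [hF0]; rwa [sub_sub_sub_cancel_right]
  have hGG : ∀ k, 0 < k → GG s k (fun r => f (r + k) - f r) := by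
    intro k hk
    have hgc : Continuous (fun r => f (r + k) - f r) := by fun_prop
    have hL : ∀ X, 0 < X → Int1 s (fun r => f (r + k) - f r) X ∧ L1 s (fun r => f (r + k) - f r) X = 0 := by
      intro X hX
      obtain ⟨l1, l2⟩ := hLw k hk.le (X • eLast n) (by rw [hlc]; exact hX)
      have e : (fun x => w (-1) (x + k • eLast n) - w (-1) x) =
          fun z => qk s k (lastC z) * (P z + q) + (fun r => f (r + k) - f r) (lastC z) := by
        funext z
        rw [hwF (-1) (by norm_num), hwF (-1) (by norm_num), lastC_add, hlc, map_add, map_smul, hPe]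
        simp only [hf, hF0, qk, smul_eq_mul]; ring
      rw [e] at l1 l2
      have := RED hn hs hlam ha' ham hk.le _ hgc.measurable (X • eLast n) (by rw [hlc]; exact hX) l1 l2
      rwa [hlc] at this
    obtain ⟨B, hB, hB'⟩ := GROW hs hα' ⟨hβ0, hβ.2⟩ hC hk hF0h hq
    refine ⟨hgc, hL, ?_, ?_⟩
    · intro r hr
      simp only [hf]
      rw [gs_neg hs0 (by linarith), gs_neg hs0 (by linarith)]; ring
    · exact INC hn hs hα' hlam hlL ha' ham hgc hL hB hB'
  have hlin := ONED (C := C * 2 ^ α) hs hβ0 (by positivity) f F0 (fun r => rfl)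
    (fun r h1 h2 => hq 2 (by norm_num) r h1 (by linarith)) hGG
  set c := F0 1 with hc
  set Lf : En n →ₗ[ℝ] ℝ :=
    { toFun := fun x => P x + c * lastC x
      map_add' := fun x y => by rw [map_add, lastC_add]; ring
      map_smul' := fun m x => by rw [map_smul, lastC_smul]; simp only [smul_eq_mul, RingHom.id_apply]; ring } with hLf
  have hLfa : ∀ x, Lf x = P x + c * lastC x := fun x => rfl
  have hwL : ∀ t < 0, ∀ x, w t x = gs s (lastC x) * (Lf x + q) := by
    intro t ht x
    rw [hwF t ht x]
    rcases le_or_gt (lastC x) 0 with h | h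
    · rw [gs_neg hs0 h, zero_mul, zero_mul]
    · have h1 := hlin _ h
      have h2 : F0 (lastC x) = F (lastC x) - q := rfl
      rw [hLfa]
      congr 1
      linarith
  have hsum : ∀ x : En n, ∑ i, Lf (EuclideanSpace.single i (1:ℝ)) * x i = Lf x := by
    intro x
    have hx : x = ∑ i, x i • (EuclideanSpace.single i (1:ℝ) : En n) := by
      have := (EuclideanSpace.basisFun (Fin n) ℝ).sum_repr x
      simpa using this.symm
    conv_rhs => rw [hx, map_sum]
    refine Finset.sum_congr rfl fun i _ => ?_
    rw [map_smul, smul_eq_mul, mul_comm]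
  refine ⟨WithLp.toLp 2 (fun i => Lf (EuclideanSpace.single i (1:ℝ))), q, ?_, ?_⟩
  · intro t ht x
    rw [hwL t ht x, gs]
    congr 2
    exact (hsum x).symm
  · intro hab
    have hz : ∀ v : En n, ‖v‖ = 1 → Lf v = 0 := by
      intro v hv
      refine sublin (K := C * 4 ^ α) hab fun m hm => ?_
      have hm1 : (1:ℝ) ≤ m := by exact_mod_cast hm
      have hm0 : (0:ℝ) < m := by linarith
      have hR : (1:ℝ) ≤ 4 * m := by linarith
      have hR2 : 1 ≤ (4 * (m:ℝ)) ^ (2 * s) := Real.one_le_rpow hR (by linarith)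
      have hlv := abs_le.1 (abs_lastC_le v)
      rw [hv] at hlv
      have n1 : ‖(2 * (m:ℝ)) • eLast n‖ = 2 * m := by
        rw [norm_smul, norm_eLast hn, mul_one, Real.norm_of_nonneg (by linarith)]
      have n2 : ‖(m:ℝ) • v‖ = m := by rw [norm_smul, hv, mul_one, Real.norm_of_nonneg hm0.le]
      have l1 : 0 < lastC ((2 * (m:ℝ)) • eLast n) := by rw [hlc]; linarith
      have l2 : 0 < lastC ((2 * (m:ℝ)) • eLast n + (m:ℝ) • v) := by
        rw [lastC_add, hlc, lastC_smul]; nlinarith [hlv.1]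
      have h := hW (4 * m) hR (-(1/2)) ((2 * (m:ℝ)) • eLast n + (m:ℝ) • v) (-(1/2)) ((2 * (m:ℝ)) • eLast n)
        (by linarith) (by norm_num) (by linarith) (by norm_num)
        (lt_of_le_of_lt (norm_add_le _ _) (by rw [n1, n2]; linarith)) (by rw [n1]; linarith) l2 l1
      have e : ∀ x : En n, 0 < lastC x → w (-(1/2)) x / max (lastC x) 0 ^ s = Lf x + q := by
        intro x hx
        rw [hwL _ (by norm_num), gs]
        have : 0 < max (lastC x) 0 ^ s := by rw [max_eq_left hx.le]; positivity
        field_simp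
      simp only [e _ l1, e _ l2] at h
      rw [map_add, map_smul Lf (m:ℝ) v, add_sub_cancel_left, n2, sub_self, abs_zero,
        Real.zero_rpow (by positivity), zero_add, smul_eq_mul,
        show Lf ((2 * (m:ℝ)) • eLast n) + m * Lf v + q - (Lf ((2 * (m:ℝ)) • eLast n) + q) = m * Lf v by ring,
        abs_mul, abs_of_pos hm0, Real.mul_rpow (by norm_num) hm0.le] at h
      rw [Real.rpow_add hm0]
      linarith
    ext i
    simp only [PiLp.zero_apply]
    exact hz _ (by simp)

/-- Theorem 2.1: Liouville-type theorem in the half space. -/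
theorem stmt_2
    (n : ℕ) (s γ β α lam Lam : ℝ)
    (hn : 0 < n) (hs : s ∈ Ioo (0 : ℝ) 1) (hγ : γ ∈ Ioo 0 s) (hβ : β ∈ Ioo γ 1)
    (hα : α = s + γ - β) (hα' : α ∈ Ioo 0 s)
    (hlam : 0 < lam) (hlL : lam ≤ Lam)
    (a : En n → ℝ) (ha : KernelBounds lam Lam a)
    (w : ℝ → En n → ℝ) (C : ℝ) (hC : 0 < C)
    -- `w = 0` in `(-∞,0) × {x_n ≤ 0}`
    (hbdry : ∀ t < (0 : ℝ), ∀ x : En n, lastC x ≤ 0 → w t x = 0)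
    -- `(∂_t - L)(w(·+τ,·+h) - w) = 0` in `(-∞,0) × ℝ^n_+` for `h_n ≥ 0`, `τ < 0`
    (heq : ∀ h : En n, 0 ≤ lastC h → ∀ τ < (0 : ℝ), ∀ t < (0 : ℝ), ∀ x : En n, 0 < lastC x →
      SolvesAt n s a (fun t' x' => w (t' + τ) (x' + h) - w t' x') (fun _ _ => 0) t x)
    -- growth control `[w/(x_n)_+^s]_{C^{β/2s,β}(Q_R^+)} ≤ C R^α`
    (hgrowth : ∀ R ≥ (1 : ℝ),
      ParHolderBnd s β (C * R ^ α) (Ioo (-(R ^ (2 * s))) 0)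
        (ball (0 : En n) R ∩ {x | 0 < lastC x})
        (fun t x => w t x / max (lastC x) 0 ^ s)) :
    ∃ (p : En n) (q : ℝ),
      (∀ t < (0 : ℝ), ∀ x : En n, w t x = max (lastC x) 0 ^ s * ((∑ i, p i * x i) + q)) ∧
      (α + β < 1 → p = 0) := by
  exact FIN n s γ β α lam Lam hn hs hγ hβ hα hα' hlam hlL a ha w C hC hbdry heq hgrowth
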